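/- arXiv:0804.2404 — 8 statements merged into one kernel-verified Lean document; each statement's English description precedes it below -/
import Mathlib

section
/- Let g be a complex simple Lie algebra with Cartan subalgebra h, positive roots Δ⁺, simple roots Π, and for I ⊆ Π let p_I be the standard parabolic subalgebra. If i is an ad-nilpotent ideal of p_I and Φ_i = {α ∈ Δ⁺ \ Δ_I : g_α ⊆ i}, then i = ⊕_{α ∈ Φ_i} g_α, and whenever α ∈ Φ_i, β ∈ Δ⁺ ∪ Δ_I and α + β ∈ Δ⁺, one has α + β ∈ Φ_i. -/
open LieAlgebra

namespace LieAlgebra.IsKilling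

open LieModule Module

variable {K L : Type*} [Field K] [CharZero K] [LieRing L] [LieAlgebra K L]
  [FiniteDimensional K L] {H : LieSubalgebra K L} [H.IsCartanSubalgebra]

/-- A root space contained in the sum of the Cartan subalgebra and a family of root spaces belongs
to that family. -/
lemma mem_of_rootSpace_le {α : Weight K H L} (hα : α.IsNonZero) {S : Set (Module.Dual K H)}
    (h : (rootSpace H α).toSubmodule ≤
      H.toSubmodule ⊔ ⨆ β ∈ S, (rootSpace H ⇑β).toSubmodule) :
    α.toLinear ∈ S := by
  by_contra hS
  have hind := (LieSubmodule.iSupIndep_toSubmodule.mpr (iSupIndep_genWeightSpace K H L)) (α : H → K)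
  refine absurd α.genWeightSpace_ne_bot (not_not_intro ((LieSubmodule.toSubmodule_eq_bot _).mp
    (hind.eq_bot_of_le (h.trans (sup_le ?_ (iSup₂_le fun β hβ ↦ ?_))))))
  · have h0 : H.toSubmodule = (rootSpace H (0 : H → K)).toSubmodule := by
      rw [rootSpace_zero_eq]; rfl
    rw [h0]
    exact le_iSup₂_of_le (f := fun (j : H → K) (_ : j ≠ α) ↦ (genWeightSpace L j).toSubmodule)
      0 (Ne.symm hα) le_rfl
  · refine le_iSup₂_of_le (f := fun (j : H → K) (_ : j ≠ α) ↦ (genWeightSpace L j).toSubmodule)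
      β (fun hβα ↦ hS ?_) le_rfl
    have : α.toLinear = β := by ext x; simp [hβα]
    exact this ▸ hβ

variable [IsKilling K L] [IsTriangularizable K H L]

/-- If `α`, `β` and `α + β` are weights with `α ≠ 0`, then `⁅g_α, g_β⁆ ≠ 0`. -/
lemma exists_lie_ne_zero_of_rootSpace_add_ne_bot (α β : Weight K H L) (hα : α.IsNonZero)
    (h : rootSpace H (α + β : H → K) ≠ ⊥) :
    ∃ e ∈ rootSpace H α, ∃ y ∈ rootSpace H β, ⁅e, y⁆ ≠ 0 := by
  obtain ⟨x, hx, x_ne0⟩ := (chainTop α β).exists_ne_zero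
  obtain ⟨_, e, f, isSl2, he, hf⟩ := exists_isSl2Triple_of_weight_isNonZero hα
  obtain rfl := isSl2.h_eq_coroot hα he hf
  have prim : isSl2.HasPrimitiveVectorWith x (chainLength α β : K) :=
    have := lie_mem_genWeightSpace_of_mem_genWeightSpace he hx
    ⟨x_ne0, (chainLength_smul _ _ hx).symm, by rwa [genWeightSpace_add_chainTop _ _ hα] at this⟩
  have hk : 1 ≤ chainTopCoeff α β := by
    have := ((rootSpace_zsmul_add_ne_bot_iff α β hα 1).mp (by simpa using h)).1
    exact_mod_cast this
  obtain ⟨k, hk⟩ : ∃ k, chainTopCoeff α β = k + 1 := ⟨_, (Nat.sub_add_cancel hk).symm⟩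
  have hle : k + 1 ≤ chainLength α β := hk ▸ chainTopCoeff_le_chainLength α β
  refine ⟨e, he, (toEnd K L L f ^ (k + 1)) x, ?_, ?_⟩
  · have := toEnd_pow_apply_mem hf hx (k + 1)
    rwa [coe_chainTop', hk, smul_neg, neg_add_cancel_left] at this
  · rw [prim.lie_e_pow_succ_toEnd_f]
    refine smul_ne_zero (mul_ne_zero (Nat.cast_add_one_ne_zero k) ?_)
      (prim.pow_toEnd_f_ne_zero_of_eq_nat rfl (by lia))
    rw [sub_ne_zero]
    exact_mod_cast (by lia : chainLength α β ≠ k)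

/-- A submodule meeting a root space nontrivially contains it. -/
lemma rootSpace_le_of_mem {α : Weight K H L} (hα : α.IsNonZero) {N : Submodule K L} {x : L}
    (hx : x ∈ rootSpace H α) (hx0 : x ≠ 0) (hxN : x ∈ N) :
    (rootSpace H α).toSubmodule ≤ N := by
  intro y hy
  obtain ⟨c, hc⟩ := (finrank_eq_one_iff_of_nonzero' (⟨x, hx⟩ : rootSpace H α)
    (by simpa using hx0)).mp (finrank_rootSpace_eq_one α hα) ⟨y, hy⟩
  have : c • x = y := congrArg Subtype.val hc
  exact this ▸ N.smul_mem c hxN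

end LieAlgebra.IsKilling

open LieAlgebra

/-- If `i` is an ad-nilpotent ideal of the standard parabolic subalgebra `p_I`
and `Φ_i = {α ∈ Δ⁺ \ Δ_I : g_α ⊆ i}`, then `i = ⊕_{α ∈ Φ_i} g_α`, and whenever `α ∈ Φ_i`,
`β ∈ Δ⁺ ∪ Δ_I` and `α + β ∈ Δ⁺`, one has `α + β ∈ Φ_i`. -/
theorem stmt1
    {L : Type*} [LieRing L] [LieAlgebra ℂ L] [FiniteDimensional ℂ L]
    [LieAlgebra.IsSimple ℂ L]
    (H : LieSubalgebra ℂ L) [H.IsCartanSubalgebra]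
    -- the root system of (g, h)
    (Δ : Set (Module.Dual ℂ H))
    (hΔ : Δ = {α : Module.Dual ℂ H | α ≠ 0 ∧ rootSpace H ⇑α ≠ ⊥})
    -- a fixed system of positive roots
    (Δp : Set (Module.Dual ℂ H))
    (hΔpsub : Δp ⊆ Δ)
    (hΔppm : ∀ α ∈ Δ, (α ∈ Δp ↔ -α ∉ Δp))
    (hΔpcl : ∀ α ∈ Δp, ∀ β ∈ Δp, α + β ∈ Δ → α + β ∈ Δp)
    -- the corresponding simple roots
    (SR : Set (Module.Dual ℂ H))
    (hSR : SR = {α ∈ Δp | ¬ ∃ β ∈ Δp, ∃ γ ∈ Δp, α = β + γ})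
    -- a subset of the simple roots and the associated `Δ_I = ℤI ∩ Δ`
    (I : Set (Module.Dual ℂ H)) (hI : I ⊆ SR)
    (ΔI : Set (Module.Dual ℂ H))
    (hΔI : ΔI = {α ∈ Δ | α ∈ Submodule.span ℤ I})
    -- the standard parabolic subalgebra `p_I = h ⊕ (⊕_{α ∈ Δ_I ∪ Δ⁺} g_α)`
    (p : LieSubalgebra ℂ L)
    (hp : p.toSubmodule =
      H.toSubmodule ⊔ ⨆ α ∈ ΔI ∪ Δp, (rootSpace H ⇑α).toSubmodule)
    -- an ad-nilpotent ideal of `p_I`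
    (i : LieIdeal ℂ p)
    (hi : ∀ x : p, x ∈ i → IsNilpotent (LieAlgebra.ad ℂ p x))
    -- `Φ_i = {α ∈ Δ⁺ \ Δ_I : g_α ⊆ i}`
    (Φi : Set (Module.Dual ℂ H))
    (hΦi : Φi = {α ∈ Δp \ ΔI |
      (rootSpace H ⇑α).toSubmodule ≤ (i : Submodule ℂ p).map p.incl.toLinearMap}) :
    ((i : Submodule ℂ p).map p.incl.toLinearMap
        = ⨆ α ∈ Φi, (rootSpace H ⇑α).toSubmodule) ∧
      (∀ α ∈ Φi, ∀ β ∈ Δp ∪ ΔI, α + β ∈ Δp → α + β ∈ Φi) := by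
  set M : Submodule ℂ L := (i : Submodule ℂ p).map p.incl.toLinearMap with hM
  have hMmem {x : L} : x ∈ M ↔ ∃ hx : x ∈ p, (⟨x, hx⟩ : p) ∈ i := by
    constructor
    · rintro ⟨y, hy, rfl⟩
      exact ⟨y.2, hy⟩
    · rintro ⟨hx, hxi⟩
      exact ⟨_, hxi, rfl⟩
  have hMp : M ≤ p.toSubmodule := fun x hx ↦ (hMmem.mp hx).1
  have hlie {x y : L} (hx : x ∈ p) (hy : y ∈ M) : ⁅x, y⁆ ∈ M := by
    obtain ⟨hyp, hyi⟩ := hMmem.mp hy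
    exact hMmem.mpr ⟨p.lie_mem hx hyp, lie_mem_right ℂ p i ⟨x, hx⟩ _ hyi⟩
  have hHp : H.toSubmodule ≤ p.toSubmodule := hp ▸ le_sup_left
  have hrp {α : Module.Dual ℂ H} (hα : α ∈ ΔI ∪ Δp) :
      (rootSpace H ⇑α).toSubmodule ≤ p.toSubmodule :=
    hp ▸ le_sup_of_le_right (le_iSup₂_of_le α hα le_rfl)
  let N : LieSubmodule ℂ H L := { M with lie_mem := fun {h _} hm ↦ hlie (hHp h.2) hm }
  have hpos_apply {h : H} (hh : (h : L) ∈ M) (α : Module.Dual ℂ H) (hα : α ∈ Δp) : α h = 0 := by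
    obtain ⟨hhp, hhi⟩ := hMmem.mp hh
    have hα0 := hΔ ▸ hΔpsub hα
    obtain ⟨e, he, he0⟩ := (⟨_, hα0.2⟩ : LieModule.Weight ℂ H L).exists_ne_zero
    have hep : e ∈ p := hrp (Or.inr hα) he
    obtain ⟨n, hn⟩ := hi _ hhi
    have hpow (k : ℕ) : ((ad ℂ p ⟨h, hhp⟩ ^ k) ⟨e, hep⟩ : p) = (α h) ^ k • ⟨e, hep⟩ := by
      induction k with
      | zero => simp
      | succ k ih =>
        have hs : ⁅(⟨h, hhp⟩ : p), (⟨e, hep⟩ : p)⁆ = α h • (⟨e, hep⟩ : p) :=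
          Subtype.ext (IsKilling.lie_eq_smul_of_mem_rootSpace he h)
        rw [pow_succ', Module.End.mul_apply, ih, map_smul, ad_apply, hs, smul_smul, pow_succ]
    have h0 := hpow n
    rw [hn, LinearMap.zero_apply, eq_comm, smul_eq_zero] at h0
    rcases h0 with h0 | h0
    · exact eq_zero_of_pow_eq_zero h0
    · exact absurd (congrArg Subtype.val h0) he0
  have hweight (χ : LieModule.Weight ℂ H L) (hχ : χ.IsNonZero) : χ.toLinear ∈ Δ := by
    rw [hΔ]
    exact ⟨by simpa using hχ, χ.genWeightSpace_ne_bot⟩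
  have hMH {h : H} (hh : (h : L) ∈ M) : h = 0 := by
    suffices h ∈ ⨅ χ : LieModule.Weight ℂ H L, χ.ker by
      simpa [IsKilling.iInf_ker_weight_eq_bot] using this
    refine (Submodule.mem_iInf _).mpr fun χ ↦ LinearMap.mem_ker.mpr ?_
    by_cases hχ : χ.IsZero
    · exact congrFun hχ h
    · by_cases hχp : χ.toLinear ∈ Δp
      · exact hpos_apply hh _ hχp
      · have hneg := not_not.mp (mt (hΔppm _ (hweight χ hχ)).mpr hχp)
        simpa using hpos_apply hh _ hneg
  have hmem (χ : LieModule.Weight ℂ H L) (hχ : χ.IsNonZero)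
      (hle : (rootSpace H χ).toSubmodule ≤ M) : χ.toLinear ∈ Φi := by
    have hχI : χ.toLinear ∉ ΔI := by
      intro hχI
      obtain ⟨h, e, f, ht, he, hf⟩ := IsKilling.exists_isSl2Triple_of_weight_isNonZero hχ
      have hnegI : (-χ).toLinear ∈ ΔI := by
        rw [hΔI] at hχI ⊢
        refine ⟨hweight _ hχ.neg, ?_⟩
        rw [LieModule.Weight.toLinear_neg]
        exact neg_mem hχI.2
      have hfp : f ∈ p := hrp (Or.inl hnegI) (by simpa using hf)
      have hhM : h ∈ M := by
        rw [← ht.lie_e_f, ← lie_skew]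
        exact M.neg_mem (hlie hfp (hle he))
      rw [ht.h_eq_coroot hχ he hf] at hhM
      exact hχ (IsKilling.coroot_eq_zero_iff.mp (hMH hhM))
    have hχS : χ.toLinear ∈ ΔI ∪ Δp := IsKilling.mem_of_rootSpace_le hχ (hp ▸ hle.trans hMp)
    rw [hΦi]
    exact ⟨⟨hχS.resolve_left hχI, hχI⟩, hle⟩
  refine ⟨le_antisymm ?_ (iSup₂_le fun α hα ↦ (hΦi ▸ hα).2), ?_⟩
  · have hN : M = ⨆ χ : LieModule.Weight ℂ H L, (N ⊓ LieModule.genWeightSpace L χ).toSubmodule := by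
      rw [← LieSubmodule.iSup_toSubmodule, ← LieModule.eq_iSup_inf_genWeightSpace]
    rw [hN]
    refine iSup_le fun χ x ⟨hxM, hxχ⟩ ↦ ?_
    by_cases hx0 : x = 0
    · exact hx0 ▸ zero_mem _
    by_cases hχ : χ.IsZero
    · have hxH : x ∈ H := by
        have : x ∈ rootSpace H (0 : H → ℂ) := hχ.eq ▸ hxχ
        rwa [rootSpace_zero_eq] at this
      exact absurd (congrArg Subtype.val (hMH (h := ⟨x, hxH⟩) hxM)) hx0
    · exact le_iSup₂ (f := fun (α : Module.Dual ℂ H) (_ : α ∈ Φi) ↦ (rootSpace H ⇑α).toSubmodule)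
        χ.toLinear (hmem χ hχ (IsKilling.rootSpace_le_of_mem hχ hxχ hx0 hxM)) hxχ
  · intro α hα β hβ hαβ
    rw [hΦi] at hα
    have hα0 := hΔ ▸ hΔpsub hα.1.1
    have hβ0 : β ∈ Δ := hβ.elim (fun h ↦ hΔpsub h) (fun h ↦ (hΔI ▸ h).1)
    rw [hΔ] at hβ0
    have hαβ0 := hΔ ▸ hΔpsub hαβ
    let χ : LieModule.Weight ℂ H L := ⟨_, hαβ0.2⟩
    have hχ : χ.IsNonZero := fun h ↦ hαβ0.1 (by ext x; exact congrFun h x)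
    obtain ⟨e, he, y, hy, hey⟩ := IsKilling.exists_lie_ne_zero_of_rootSpace_add_ne_bot
      ⟨_, hα0.2⟩ ⟨_, hβ0.2⟩ (fun h ↦ hα0.1 (by ext x; exact congrFun h x)) hαβ0.2
    have heyM : ⁅e, y⁆ ∈ M := by
      rw [← lie_skew]
      exact M.neg_mem (hlie (hrp hβ.symm hy) (hα.2 he))
    exact hmem χ hχ (IsKilling.rootSpace_le_of_mem hχ
      (lie_mem_genWeightSpace_of_mem_genWeightSpace he hy) hey heyM)
end

section
/- Let g be a complex simple Lie algebra with Cartan subalgebra h, positive roots Δ⁺, simple roots Π, and for I ⊆ Π let p_I be the standard parabolic subalgebra. Define F_I = {Φ ⊆ Δ⁺ \ Δ_I : if α ∈ Φ, β ∈ Δ⁺ ∪ Δ_I and α + β ∈ Δ⁺, then α + β ∈ Φ}. For every Φ ∈ F_I, the subspace i_Φ = ⊕_{α ∈ Φ} g_α is an ad-nilpotent ideal of p_I, and the map i ↦ Φ_i = {α ∈ Δ⁺ \ Δ_I : g_α ⊆ i} is a bijection from the set of ad-nilpotent ideals of p_I onto F_I. -/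
open LieAlgebra

/-- A system of positive elements: a set closed under sums of obtuse pairs and under differences
(up to sign) of acute pairs, on whose nonnegative span the form is definite. -/
structure IsPositiveSystem {M : Type*} [AddCommGroup M] (B : M →+ M →+ ℝ) (D : Set M) : Prop where
  zero_notMem : (0 : M) ∉ D
  eq_zero_of_apply_self_nonpos : ∀ x ∈ AddSubmonoid.closure D, B x x ≤ 0 → x = 0
  add_mem_of_apply_neg : ∀ a ∈ D, ∀ b ∈ D, B a b < 0 → a + b ∈ D
  sub_mem_or_sub_mem : ∀ a ∈ D, ∀ b ∈ D, 0 < B a b → a ≠ b → a - b ∈ D ∨ b - a ∈ D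

namespace IsPositiveSystem

variable {M : Type*} [AddCommGroup M] {B : M →+ M →+ ℝ} {D : Set M}

theorem multiset_sum_ne_zero (h : IsPositiveSystem B D) (s : Multiset M) (hs : ∀ a ∈ s, a ∈ D)
    (hs0 : s ≠ 0) : s.sum ≠ 0 := by
  induction hn : s.card using Nat.strong_induction_on generalizing s with
  | _ n ih =>
  obtain ⟨a, ha⟩ := Multiset.exists_mem_of_ne_zero hs0
  obtain ⟨t, rfl⟩ := Multiset.exists_cons_of_mem ha
  intro hsum
  rw [Multiset.sum_cons] at hsum
  have haD := hs a ha
  have hapos : 0 < B a a := by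
    by_contra hle
    have := h.eq_zero_of_apply_self_nonpos a (AddSubmonoid.subset_closure haD) (not_lt.1 hle)
    exact h.zero_notMem (this ▸ haD)
  obtain ⟨b, hbt, hb⟩ : ∃ b ∈ t, B a b < 0 := by
    by_contra! hcon
    have h1 : 0 ≤ B a t.sum := by
      rw [map_multiset_sum]
      apply Multiset.sum_nonneg
      simpa using hcon
    have h2 : B a (a + t.sum) = 0 := by rw [hsum, map_zero]
    rw [map_add] at h2
    linarith
  obtain ⟨r, rfl⟩ := Multiset.exists_cons_of_mem hbt
  refine ih _ ?_ ((a + b) ::ₘ r) ?_ (Multiset.cons_ne_zero) rfl ?_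
  · rw [← hn]; simp
  · intro c hc
    rcases Multiset.mem_cons.1 hc with rfl | hc
    · exact h.add_mem_of_apply_neg a haD b (hs b (by simp)) hb
    · exact hs c (by simp [hc])
  · rw [← hsum]; simp [add_assoc]

theorem eq_zero_of_add_eq_zero (h : IsPositiveSystem B D) {x y : M}
    (hx : x ∈ AddSubmonoid.closure D) (hy : y ∈ AddSubmonoid.closure D) (hxy : x + y = 0) :
    x = 0 := by
  obtain ⟨s, hs, rfl⟩ := AddSubmonoid.exists_multiset_of_mem_closure hx
  obtain ⟨t, ht, rfl⟩ := AddSubmonoid.exists_multiset_of_mem_closure hy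
  by_contra hne
  refine h.multiset_sum_ne_zero (s + t) (fun a ha ↦ ?_) (fun h0 ↦ ?_) (by simpa using hxy)
  · exact (Multiset.mem_add.1 ha).elim (hs a) (ht a)
  · apply hne
    have : s = 0 := (add_eq_zero.1 h0).1
    simp [this]

theorem wellFounded (h : IsPositiveSystem B D) {X : Type*} [Finite X] {v : X → M}
    (hv : Function.Injective v) :
    WellFounded fun x y : X ↦ v y - v x ∈ AddSubmonoid.closure D ∧ x ≠ y := by
  have : IsTrans X fun x y : X ↦ v y - v x ∈ AddSubmonoid.closure D ∧ x ≠ y := by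
    refine ⟨fun x y z hxy hyz ↦ ⟨?_, ?_⟩⟩
    · simpa using add_mem hyz.1 hxy.1
    · rintro rfl
      have := h.eq_zero_of_add_eq_zero hxy.1 hyz.1 (by abel)
      exact hxy.2 (hv (sub_eq_zero.1 this)).symm
  have : Std.Irrefl fun x y : X ↦ v y - v x ∈ AddSubmonoid.closure D ∧ x ≠ y :=
    ⟨fun x hx ↦ hx.2 rfl⟩
  exact Finite.wellFounded_of_trans_of_irrefl _

/-- The indecomposable elements. -/
def simple (D : Set M) : Set M := {a ∈ D | ¬ ∃ b ∈ D, ∃ c ∈ D, a = b + c}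

theorem mem_closure_simple (h : IsPositiveSystem B D) (hD : D.Finite) {a : M} (ha : a ∈ D) :
    a ∈ AddSubmonoid.closure (simple D) := by
  have := hD.to_subtype
  suffices ∀ x : D, (x : M) ∈ AddSubmonoid.closure (simple D) from this ⟨a, ha⟩
  intro x
  induction x using (h.wellFounded (Subtype.val_injective (p := (· ∈ D)))).induction with
  | _ x ih =>
  by_cases hx : (x : M) ∈ simple D
  · exact AddSubmonoid.subset_closure hx
  · have : ∃ b ∈ D, ∃ c ∈ D, (x : M) = b + c := by
      by_contra hcon
      exact hx ⟨x.2, hcon⟩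
    obtain ⟨b, hb, c, hc, hbc⟩ := this
    have aux : ∀ b ∈ D, ∀ c ∈ D, (x : M) = b + c → b ∈ AddSubmonoid.closure (simple D) := by
      intro b hb c hc hbc
      refine ih ⟨b, hb⟩ ⟨?_, ?_⟩
      · have : (x : M) - b = c := by rw [hbc]; abel
        rw [this]
        exact AddSubmonoid.subset_closure hc
      · rintro rfl
        have : c = 0 := by simpa using hbc
        exact h.zero_notMem (this ▸ hc)
    rw [hbc]
    exact add_mem (aux b hb c hc hbc) (aux c hc b hb (by rw [hbc, add_comm]))

theorem apply_simple_nonpos (h : IsPositiveSystem B D) {a b : M} (ha : a ∈ simple D)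
    (hb : b ∈ simple D) (hab : a ≠ b) : B a b ≤ 0 := by
  by_contra! hpos
  rcases h.sub_mem_or_sub_mem a ha.1 b hb.1 hpos hab with hd | hd
  · exact ha.2 ⟨a - b, hd, b, hb.1, by abel⟩
  · exact hb.2 ⟨b - a, hd, a, ha.1, by abel⟩

theorem _root_.AddMonoidHom.apply_nonpos_of_mem_closure (B : M →+ M →+ ℝ) {X Y : Set M}
    (hXY : ∀ a ∈ X, ∀ b ∈ Y, B a b ≤ 0) {x y : M} (hx : x ∈ AddSubmonoid.closure X)
    (hy : y ∈ AddSubmonoid.closure Y) : B x y ≤ 0 := by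
  have h₁ : ∀ a ∈ X, B a y ≤ 0 := by
    intro a ha
    induction hy using AddSubmonoid.closure_induction with
    | mem b hb => exact hXY a ha b hb
    | zero => simp
    | add b c _ _ hb hc => simpa using add_nonpos hb hc
  induction hx using AddSubmonoid.closure_induction with
  | mem a ha => exact h₁ a ha
  | zero => simp
  | add b c _ _ hb hc => simpa using add_nonpos hb hc

theorem _root_.Submodule.exists_multiset_of_mem_span_int {I : Set M} {x : M}
    (hx : x ∈ Submodule.span ℤ I) :
    ∃ p q : Multiset M, (∀ a ∈ p, a ∈ I) ∧ (∀ a ∈ q, a ∈ I) ∧ x + q.sum = p.sum := by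
  rw [← Submodule.mem_toAddSubgroup, Submodule.span_int_eq_addSubgroupClosure] at hx
  induction hx using AddSubgroup.closure_induction with
  | mem a ha => exact ⟨{a}, 0, by simpa using ha, by simp, by simp⟩
  | zero => exact ⟨0, 0, by simp, by simp, by simp⟩
  | add a b _ _ iha ihb =>
    obtain ⟨p, q, hp, hq, h⟩ := iha
    obtain ⟨p', q', hp', hq', h'⟩ := ihb
    refine ⟨p + p', q + q', ?_, ?_, ?_⟩
    · intro c hc; exact (Multiset.mem_add.1 hc).elim (hp c) (hp' c)
    · intro c hc; exact (Multiset.mem_add.1 hc).elim (hq c) (hq' c)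
    · rw [Multiset.sum_add, Multiset.sum_add, ← h, ← h']; abel
  | neg a _ iha =>
    obtain ⟨p, q, hp, hq, h⟩ := iha
    exact ⟨q, p, hq, hp, by rw [← h]; abel⟩

theorem eq_zero_of_mem_span (h : IsPositiveSystem B D) {I : Set M} (hI : I ⊆ simple D) {u : M}
    (hu : u ∈ AddSubmonoid.closure (simple D \ I)) (huI : u ∈ Submodule.span ℤ I) : u = 0 := by
  classical
  have hSD : simple D ⊆ D := fun a ha ↦ ha.1
  obtain ⟨p, q, hp, hq, hpq⟩ := Submodule.exists_multiset_of_mem_span_int huI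
  have hpq' : u + (q - p).sum = (p - q).sum := by
    have h1 := congr_arg Multiset.sum (Multiset.sub_add_inter p q)
    have h2 := congr_arg Multiset.sum (Multiset.sub_add_inter q p)
    rw [Multiset.sum_add] at h1 h2
    rw [Multiset.inter_comm] at h2
    rw [← h1, ← h2, ← add_assoc] at hpq
    exact add_right_cancel hpq
  have hmem : ∀ r : Multiset M, (∀ a ∈ r, a ∈ I) → r.sum ∈ AddSubmonoid.closure {a | a ∈ r} :=
    fun r hr ↦ AddSubmonoid.multiset_sum_mem _ _ fun a ha ↦ AddSubmonoid.subset_closure ha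
  have hp' : ∀ a ∈ p - q, a ∈ I :=
    fun a ha ↦ hp a (Multiset.mem_of_le (Multiset.sub_le_self _ _) ha)
  have hq' : ∀ a ∈ q - p, a ∈ I :=
    fun a ha ↦ hq a (Multiset.mem_of_le (Multiset.sub_le_self _ _) ha)
  have hmemD : ∀ r : Multiset M, (∀ a ∈ r, a ∈ I) → r.sum ∈ AddSubmonoid.closure D :=
    fun r hr ↦ AddSubmonoid.multiset_sum_mem _ _
      fun a ha ↦ AddSubmonoid.subset_closure (hSD (hI (hr a ha)))
  have huD : u ∈ AddSubmonoid.closure D :=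
    AddSubmonoid.closure_mono (Set.sdiff_subset.trans hSD) hu
  have h0 : (p - q).sum = 0 := by
    apply h.eq_zero_of_apply_self_nonpos _ (hmemD _ hp')
    have h1 : B u (p - q).sum ≤ 0 := by
      refine B.apply_nonpos_of_mem_closure (fun a ha b hb ↦ ?_) hu (hmem _ hp')
      refine h.apply_simple_nonpos ha.1 (hI (hp' b hb)) ?_
      rintro rfl
      exact ha.2 (hp' _ hb)
    have h2 : B (q - p).sum (p - q).sum ≤ 0 := by
      refine B.apply_nonpos_of_mem_closure (fun a ha b hb ↦ ?_) (hmem _ hq') (hmem _ hp')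
      refine h.apply_simple_nonpos (hI (hq' a ha)) (hI (hp' b hb)) ?_
      rintro rfl
      have h3 := Multiset.count_pos.2 ha
      have h4 := Multiset.count_pos.2 hb
      rw [Multiset.count_sub] at h3 h4
      omega
    nth_rw 1 [← hpq']
    rw [map_add, AddMonoidHom.add_apply]
    linarith
  rw [h0] at hpq'
  exact h.eq_zero_of_add_eq_zero huD (hmemD _ hq') hpq'

/-- If a sum of two positive elements lies in the span of a set of simple elements, so does each
summand. -/
theorem mem_span_of_add_mem_span (h : IsPositiveSystem B D) (hD : D.Finite) {I : Set M}
    (hI : I ⊆ simple D) {a b : M} (ha : a ∈ D) (hb : b ∈ D)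
    (hab : a + b ∈ Submodule.span ℤ I) : a ∈ Submodule.span ℤ I := by
  have hSD : simple D ⊆ D := fun a ha ↦ ha.1
  have key : ∀ c ∈ D, ∃ u ∈ AddSubmonoid.closure (simple D \ I), c - u ∈ Submodule.span ℤ I := by
    intro c hc
    have hc' := h.mem_closure_simple hD hc
    rw [← Set.sdiff_union_of_subset hI, AddSubmonoid.closure_union, AddSubmonoid.mem_sup] at hc'
    obtain ⟨u, hu, v, hv, rfl⟩ := hc'
    refine ⟨u, hu, ?_⟩
    have : AddSubmonoid.closure I ≤ (Submodule.span ℤ I).toAddSubmonoid :=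
      AddSubmonoid.closure_le.2 Submodule.subset_span
    simpa using this hv
  obtain ⟨u, hu, hau⟩ := key a ha
  obtain ⟨w, hw, hbw⟩ := key b hb
  have hmono := AddSubmonoid.closure_mono (Set.sdiff_subset.trans hSD : simple D \ I ⊆ D)
  have huw : u + w = 0 := by
    refine h.eq_zero_of_mem_span hI (add_mem hu hw) ?_
    have := sub_mem hab (add_mem hau hbw)
    convert this using 1
    abel
  have hu0 : u = 0 := h.eq_zero_of_add_eq_zero (hmono hu) (hmono hw) huw
  simpa [hu0] using hau

end IsPositiveSystem

section RootSystem

open LieAlgebra.IsKilling LieModule Module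

variable {L : Type*} [LieRing L] [LieAlgebra ℂ L] [FiniteDimensional ℂ L] [IsKilling ℂ L]
  (H : LieSubalgebra ℂ L) [H.IsCartanSubalgebra]

/-- The real part of the canonical form of the root system of a Lie algebra. -/
noncomputable def reRootForm : Dual ℂ H →+ Dual ℂ H →+ ℝ :=
  AddMonoidHom.mk' (fun x ↦ Complex.reAddGroupHom.comp ((rootSystem H).RootForm x).toAddMonoidHom)
    fun x y ↦ by ext z; simp

theorem reRootForm_apply (x y : Dual ℂ H) :
    reRootForm H x y = ((rootSystem H).RootForm x y).re := rfl

theorem eq_zero_of_reRootForm_self_nonpos {x : Dual ℂ H}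
    (hx : x ∈ Submodule.span ℤ (Set.range (rootSystem H).root)) (h : reRootForm H x x ≤ 0) :
    x = 0 := by
  choose s hs using fun i ↦ (rootSystem H).coroot'_apply_apply_mem_of_mem_span ℤ hx i
  have hs' : ∀ i, (s i : ℂ) = (rootSystem H).coroot' i x := fun i ↦ by simpa using hs i
  rw [reRootForm_apply, RootPairing.rootForm_apply_apply] at h
  simp_rw [← hs'] at h
  norm_cast at h
  have h0 : ∀ i, s i = 0 := by
    have hsum : ∑ i, s i * s i = 0 :=
      le_antisymm (by exact_mod_cast h) (Finset.sum_nonneg fun i _ ↦ mul_self_nonneg _)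
    rw [Finset.sum_eq_zero_iff_of_nonneg fun i _ ↦ mul_self_nonneg _] at hsum
    intro i
    exact mul_self_eq_zero.1 (hsum i (Finset.mem_univ i))
  refine LinearMap.ext_on_range (v := (rootSystem H).coroot)
    RootPairing.IsRootSystem.span_coroot_eq_top fun i ↦ ?_
  have := hs' i
  rw [h0] at this
  simpa using this.symm

theorem two_mul_reRootForm (i j : H.root) :
    2 * reRootForm H ((rootSystem H).root i) ((rootSystem H).root j) =
      (rootSystem H).pairingIn ℤ i j *
        reRootForm H ((rootSystem H).root j) ((rootSystem H).root j) := by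
  have h := ((rootSystem H).posRootForm ℤ).two_mul_apply_root_root i j
  rw [← (rootSystem H).algebraMap_pairingIn ℤ i j] at h
  have h' := congr_arg Complex.re h
  simpa [RootPairing.posRootForm, reRootForm_apply] using h'

theorem reRootForm_root_self_pos (j : H.root) :
    0 < reRootForm H ((rootSystem H).root j) ((rootSystem H).root j) := by
  by_contra! h
  exact (rootSystem H).ne_zero j
    (eq_zero_of_reRootForm_self_nonpos H (Submodule.subset_span (Set.mem_range_self j)) h)

theorem isPositiveSystem_of_closed {Δp : Set (Dual ℂ H)}
    (hsub : Δp ⊆ Set.range (rootSystem H).root)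
    (hpm : ∀ α ∈ Set.range (rootSystem H).root, (α ∈ Δp ↔ -α ∉ Δp))
    (hcl : ∀ α ∈ Δp, ∀ β ∈ Δp, α + β ∈ Set.range (rootSystem H).root → α + β ∈ Δp) :
    IsPositiveSystem (reRootForm H) Δp where
  zero_notMem h := by
    obtain ⟨i, hi⟩ := hsub h
    exact (rootSystem H).ne_zero i hi
  eq_zero_of_apply_self_nonpos x hx h := by
    refine eq_zero_of_reRootForm_self_nonpos H ?_ h
    have : AddSubmonoid.closure Δp ≤
        (Submodule.span ℤ (Set.range (rootSystem H).root)).toAddSubmonoid :=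
      AddSubmonoid.closure_le.2 (hsub.trans Submodule.subset_span)
    exact this hx
  add_mem_of_apply_neg a ha b hb hab := by
    refine hcl a ha b hb ?_
    obtain ⟨i, rfl⟩ := hsub ha
    obtain ⟨j, rfl⟩ := hsub hb
    refine (rootSystem H).root_add_root_mem_of_pairingIn_neg ?_ ?_
    · have h1 := two_mul_reRootForm H i j
      have h2 := reRootForm_root_self_pos H j
      by_contra! h3
      have h4 : (0 : ℝ) ≤ (rootSystem H).pairingIn ℤ i j := by exact_mod_cast h3
      nlinarith [mul_nonneg h4 h2.le]
    · intro h
      rw [h] at ha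
      exact (hpm _ (Set.mem_range_self j)).1 hb ha
  sub_mem_or_sub_mem a ha b hb hab hne := by
    obtain ⟨i, rfl⟩ := hsub ha
    obtain ⟨j, rfl⟩ := hsub hb
    have hr : (rootSystem H).root i - (rootSystem H).root j ∈ Set.range (rootSystem H).root := by
      refine (rootSystem H).root_sub_root_mem_of_pairingIn_pos ?_ ?_
      · have h1 := two_mul_reRootForm H i j
        have h2 := reRootForm_root_self_pos H j
        by_contra! h3
        have h4 : ((rootSystem H).pairingIn ℤ i j : ℝ) ≤ 0 := by exact_mod_cast h3
        nlinarith [mul_nonneg (neg_nonneg.2 h4) h2.le]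
      · rintro rfl
        exact hne rfl
    by_cases h : (rootSystem H).root i - (rootSystem H).root j ∈ Δp
    · exact Or.inl h
    · right
      by_contra h'
      exact h ((hpm _ hr).2 (by simpa using h'))

theorem range_root_rootSystem :
    Set.range (rootSystem H).root = {α : Dual ℂ H | α ≠ 0 ∧ rootSpace H ⇑α ≠ ⊥} := by
  ext α
  constructor
  · rintro ⟨i, rfl⟩
    exact ⟨(rootSystem H).ne_zero i, by simpa using i.1.genWeightSpace_ne_bot⟩
  · rintro ⟨h0, hα⟩
    refine ⟨⟨⟨α, hα⟩, ?_⟩, ?_⟩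
    · simpa [Weight.IsNonZero, Weight.IsZero] using h0
    · ext; simp

/-- The bracket of two root spaces fills the root space of the sum, if the latter is a root. -/
theorem exists_lie_ne_zero {α β : Dual ℂ H} (hα : α ≠ 0)
    (hα' : rootSpace H α ≠ ⊥) (hβ' : rootSpace H β ≠ ⊥) (hαβ : rootSpace H ⇑(α + β) ≠ ⊥) :
    ∃ x ∈ rootSpace H α, ∃ y ∈ rootSpace H β, ⁅x, y⁆ ≠ 0 := by
  set a : Weight ℂ H L := ⟨α, hα'⟩
  set b : Weight ℂ H L := ⟨β, hβ'⟩
  have ha : a.IsNonZero := by simpa [a, Weight.IsNonZero, Weight.IsZero] using hα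
  have hk := ((rootSpace_zsmul_add_ne_bot_iff a b ha 1).1 (by rw [one_smul]; exact hαβ)).1
  obtain ⟨x, hx, x_ne0⟩ := (chainTop a b).exists_ne_zero
  obtain ⟨h, e, f, isSl2, he, hf⟩ := exists_isSl2Triple_of_weight_isNonZero ha
  obtain rfl := isSl2.h_eq_coroot ha he hf
  have prim : isSl2.HasPrimitiveVectorWith x (chainLength a b : ℂ) :=
    have := lie_mem_genWeightSpace_of_mem_genWeightSpace he hx
    ⟨x_ne0, (chainLength_smul _ _ hx).symm, by rwa [genWeightSpace_add_chainTop _ _ ha] at this⟩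
  obtain ⟨m, hm⟩ : ∃ m, chainTopCoeff a b = m + 1 := ⟨chainTopCoeff a b - 1, by lia⟩
  have hlen := chainTopCoeff_le_chainLength a b
  refine ⟨e, he, (toEnd ℂ L L f ^ (m + 1)) x, ?_, ?_⟩
  · have := toEnd_pow_apply_mem hf hx (m + 1)
    convert this using 2
    rw [coe_chainTop, hm]
    ext z
    simp [b, a]
  · rw [prim.lie_e_pow_succ_toEnd_f]
    refine smul_ne_zero (mul_ne_zero (by exact_mod_cast m.succ_ne_zero) ?_)
      (prim.pow_toEnd_f_ne_zero_of_eq_nat rfl (by lia))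
    rw [sub_ne_zero]
    norm_cast
    lia

end RootSystem

section RootSum

open LieAlgebra.IsKilling LieModule Module

variable {L : Type*} [LieRing L] [LieAlgebra ℂ L] (H : LieSubalgebra ℂ L) [H.IsCartanSubalgebra]

/-- The sum of the root spaces attached to a set of functionals; the functional `0` contributes
the Cartan subalgebra. -/
def rootSum (S : Set (Dual ℂ H)) : Submodule ℂ L := ⨆ α ∈ S, (rootSpace H ⇑α).toSubmodule

variable {H} {S T U : Set (Dual ℂ H)}

theorem mem_rootSum_of_mem {α : Dual ℂ H} (hα : α ∈ S) {x : L} (hx : x ∈ rootSpace H α) :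
    x ∈ rootSum H S :=
  Submodule.mem_iSup_of_mem α (Submodule.mem_iSup_of_mem hα hx)

theorem rootSum_le {N : Submodule ℂ L} (h : ∀ α ∈ S, (rootSpace H ⇑α).toSubmodule ≤ N) :
    rootSum H S ≤ N :=
  iSup₂_le h

theorem rootSum_mono (h : S ⊆ T) : rootSum H S ≤ rootSum H T :=
  biSup_mono h

theorem rootSum_insert_zero [FiniteDimensional ℂ L] :
    rootSum H (insert 0 S) = H.toSubmodule ⊔ ⨆ α ∈ S, (rootSpace H ⇑α).toSubmodule := by
  rw [rootSum, iSup_insert]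
  congr 1
  rw [show ⇑(0 : Dual ℂ H) = 0 from rfl, rootSpace_zero_eq, LieSubalgebra.coe_toLieSubmodule]

theorem eq_zero_of_mem_rootSum {α : Dual ℂ H} (hα : α ∉ S) {x : L} (hx : x ∈ rootSpace H α)
    (hxS : x ∈ rootSum H S) : x = 0 := by
  have hind : iSupIndep fun α : Dual ℂ H ↦ (rootSpace H ⇑α).toSubmodule :=
    (LieSubmodule.iSupIndep_toSubmodule.2 (iSupIndep_genWeightSpace ℂ H L)).comp
      DFunLike.coe_injective
  have hle : rootSum H S ≤ ⨆ β, ⨆ (_ : β ≠ α), (rootSpace H ⇑β).toSubmodule :=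
    biSup_mono fun β hβ h ↦ hα (h ▸ hβ)
  exact Submodule.disjoint_def.1 ((hind α).mono_right hle) x hx hxS

theorem lie_mem_rootSum (h : ∀ α ∈ S, ∀ β ∈ T, rootSpace H ⇑(α + β) ≠ ⊥ → α + β ∈ U) {x y : L}
    (hx : x ∈ rootSum H S) (hy : y ∈ rootSum H T) : ⁅x, y⁆ ∈ rootSum H U := by
  have h₁ : rootSum H S ≤ (rootSum H U).comap ((ad ℂ L : L →ₗ[ℂ] Module.End ℂ L).flip y) := by
    refine rootSum_le fun α hα x hx ↦ ?_
    have h₂ : rootSum H T ≤ (rootSum H U).comap (ad ℂ L x) := by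
      refine rootSum_le fun β hβ y hy ↦ ?_
      have hxy : ⁅x, y⁆ ∈ rootSpace H ⇑(α + β) := lie_mem_genWeightSpace_of_mem_genWeightSpace hx hy
      by_cases hb : rootSpace H ⇑(α + β) = ⊥
      · rw [hb, LieSubmodule.mem_bot] at hxy
        simp [hxy]
      · exact mem_rootSum_of_mem (h α hα β hβ hb) hxy
    exact h₂ hy
  exact h₁ hx

theorem isNilpotent_ad_of_mem_rootSum [FiniteDimensional ℂ L] {B : Dual ℂ H →+ Dual ℂ H →+ ℝ}
    (hS : IsPositiveSystem B S) {x : L} (hx : x ∈ rootSum H S) : IsNilpotent (ad ℂ L x) := by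
  suffices h : ∀ χ : Weight ℂ H L,
      (rootSpace H χ).toSubmodule ≤ (ad ℂ L x).maxGenEigenspace 0 by
    have htop : (ad ℂ L x).maxGenEigenspace 0 = ⊤ := by
      rw [eq_top_iff, ← LieSubmodule.top_toSubmodule (R := ℂ) (L := H),
        ← iSup_genWeightSpace_eq_top' ℂ H L, LieSubmodule.iSup_toSubmodule]
      exact iSup_le h
    rw [Module.End.isNilpotent_iff_of_finite]
    intro y
    have hy : y ∈ (ad ℂ L x).maxGenEigenspace 0 := htop ▸ Submodule.mem_top
    simpa using (Module.End.mem_maxGenEigenspace _ _ _).1 hy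
  intro χ
  have hinj : Function.Injective fun χ : Weight ℂ H L ↦ -χ.toLinear :=
    fun χ ψ h ↦ DFunLike.coe_injective <|
      congr_arg (DFunLike.coe : Dual ℂ H → H → ℂ) (neg_injective h)
  induction χ using (hS.wellFounded hinj).induction with
  | _ χ ih =>
  intro y hy
  have hxy : ⁅x, y⁆ ∈ rootSum H {β | ∃ α ∈ S, β = α + χ.toLinear ∧ rootSpace H ⇑β ≠ ⊥} :=
    lie_mem_rootSum (S := S) (T := {χ.toLinear})
      (U := {β | ∃ α ∈ S, β = α + χ.toLinear ∧ rootSpace H ⇑β ≠ ⊥})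
      (fun α hα β hβ h ↦ ⟨α, hα, by rw [Set.mem_singleton_iff.1 hβ], h⟩) hx
      (mem_rootSum_of_mem (Set.mem_singleton _) hy)
  have hle : rootSum H {β | ∃ α ∈ S, β = α + χ.toLinear ∧ rootSpace H ⇑β ≠ ⊥} ≤
      (ad ℂ L x).maxGenEigenspace 0 := by
    refine rootSum_le ?_
    rintro β ⟨α, hα, hβ, hb⟩
    have hβ' : (⟨β, hb⟩ : Weight ℂ H L).toLinear = β := rfl
    refine ih ⟨β, hb⟩ ⟨?_, ?_⟩
    · have : -χ.toLinear - -(⟨β, hb⟩ : Weight ℂ H L).toLinear = α := by rw [hβ', hβ]; abel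
      rw [this]
      exact AddSubmonoid.subset_closure hα
    · intro h
      rw [← hβ', h] at hβ
      have : α = 0 := by simpa using hβ
      exact hS.zero_notMem (this ▸ hα)
  obtain ⟨k, hk⟩ := (Module.End.mem_maxGenEigenspace _ _ _).1 (hle hxy)
  refine (Module.End.mem_maxGenEigenspace _ _ _).2 ⟨k + 1, ?_⟩
  rw [zero_smul, sub_zero] at hk ⊢
  rw [pow_succ]
  exact hk

variable [FiniteDimensional ℂ L] [IsKilling ℂ L]

theorem rootSpace_le_of_mem {α : Dual ℂ H} (hα : α ≠ 0) {N : Submodule ℂ L} {x : L}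
    (hx : x ∈ rootSpace H α) (hx0 : x ≠ 0) (hxN : x ∈ N) : (rootSpace H ⇑α).toSubmodule ≤ N := by
  have hb : rootSpace H ⇑α ≠ ⊥ := fun h ↦ hx0 (by simpa [h] using hx)
  have h1 := finrank_rootSpace_eq_one (⟨α, hb⟩ : Weight ℂ H L)
    (by simpa [Weight.IsNonZero, Weight.IsZero] using hα)
  intro y hy
  obtain ⟨c, hc⟩ := (finrank_eq_one_iff_of_nonzero' (⟨x, hx⟩ : rootSpace H ⇑α)
    (by simpa using hx0)).1 h1 ⟨y, hy⟩
  have : c • x = y := congr_arg Subtype.val hc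
  exact this ▸ N.smul_mem c hxN

theorem rootSpace_neg_ne_bot {α : Dual ℂ H} (hα : rootSpace H ⇑α ≠ ⊥) : rootSpace H ⇑(-α) ≠ ⊥ :=
  (-(⟨α, hα⟩ : Weight ℂ H L)).genWeightSpace_ne_bot

theorem eq_zero_of_isNilpotent_ad {R : Set (Dual ℂ H)}
    (hR : ∀ α : Dual ℂ H, α ≠ 0 → rootSpace H ⇑α ≠ ⊥ → α ∈ R ∨ -α ∈ R) {x : L} (hx : x ∈ H)
    (hnil : ∃ n : ℕ, ∀ z ∈ rootSum H R, (ad ℂ L x ^ n) z = 0) : x = 0 := by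
  obtain ⟨n, hn⟩ := hnil
  have hker : ∀ α ∈ R, rootSpace H ⇑α ≠ ⊥ → α ⟨x, hx⟩ = 0 := by
    intro α hα hb
    obtain ⟨z, hz, hz0⟩ := (⟨α, hb⟩ : Weight ℂ H L).exists_ne_zero
    have hpow : ∀ k : ℕ, (ad ℂ L x ^ k) z = α ⟨x, hx⟩ ^ k • z := by
      intro k
      induction k with
      | zero => simp
      | succ k ih =>
        have h1 : ⁅x, z⁆ = α ⟨x, hx⟩ • z := lie_eq_smul_of_mem_rootSpace hz ⟨x, hx⟩
        rw [pow_succ', Module.End.mul_apply, ih, map_smul, ad_apply, h1, smul_smul, pow_succ]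
    have h0 := hn z (mem_rootSum_of_mem hα hz)
    rw [hpow, smul_eq_zero_iff_left hz0] at h0
    exact eq_zero_of_pow_eq_zero h0
  have hmem : (⟨x, hx⟩ : H) ∈ ⨅ α : Weight ℂ H L, α.ker := by
    refine (Submodule.mem_iInf _).2 fun χ ↦ ?_
    change Weight.toLinear ℂ H L χ ⟨x, hx⟩ = 0
    by_cases h0 : χ.toLinear = 0
    · simp [h0]
    rcases hR χ.toLinear h0 χ.genWeightSpace_ne_bot with h | h
    · exact hker _ h χ.genWeightSpace_ne_bot
    · have := hker _ h (rootSpace_neg_ne_bot χ.genWeightSpace_ne_bot)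
      simpa using this
  rw [iInf_ker_weight_eq_bot, Submodule.mem_bot] at hmem
  exact congr_arg Subtype.val hmem

theorem exists_lie_mem_ne_zero {α : Dual ℂ H} (hα : α ≠ 0) (hb : rootSpace H ⇑α ≠ ⊥) :
    ∃ e ∈ rootSpace H ⇑α, ∃ f ∈ rootSpace H ⇑(-α), ⁅e, f⁆ ∈ H ∧ ⁅e, f⁆ ≠ 0 := by
  have hα' : (⟨α, hb⟩ : Weight ℂ H L).IsNonZero := by
    simpa [Weight.IsNonZero, Weight.IsZero] using hα
  obtain ⟨h, e, f, hsl2, he, hf⟩ := exists_isSl2Triple_of_weight_isNonZero hα'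
  refine ⟨e, he, f, hf, ?_, ?_⟩
  · rw [hsl2.lie_e_f, hsl2.h_eq_coroot hα' he hf]
    exact SetLike.coe_mem _
  · rw [hsl2.lie_e_f]
    exact hsl2.h_ne_zero

/-- A subspace stable under a subalgebra containing the Cartan subalgebra, on which the subalgebra
acts nilpotently, is a sum of root spaces for roots whose negatives do not occur in the
subalgebra. -/
theorem eq_rootSum_of_isNilpotent_ad {R : Set (Dual ℂ H)}
    (hR : ∀ α : Dual ℂ H, α ≠ 0 → rootSpace H ⇑α ≠ ⊥ → α ∈ R ∨ -α ∈ R)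
    (hS : ∀ α ∈ R, -α ∉ R → α ∈ S) {J : Submodule ℂ L} (hJ : J ≤ rootSum H (insert 0 R))
    (hlie : ∀ x ∈ rootSum H (insert 0 R), ∀ y ∈ J, ⁅x, y⁆ ∈ J)
    (hnil : ∀ x ∈ J, ∃ n : ℕ, ∀ z ∈ rootSum H (insert 0 R), (ad ℂ L x ^ n) z = 0) :
    J = rootSum H {α ∈ S | (rootSpace H ⇑α).toSubmodule ≤ J} := by
  have hJH : ∀ x ∈ J, x ∈ H → x = 0 := fun x hxJ hxH ↦ by
    obtain ⟨n, hn⟩ := hnil x hxJ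
    exact eq_zero_of_isNilpotent_ad hR hxH
      ⟨n, fun z hz ↦ hn z (rootSum_mono (Set.subset_insert _ _) hz)⟩
  refine le_antisymm ?_ (rootSum_le fun α hα ↦ hα.2)
  let N : LieSubmodule ℂ H L :=
    { J with
      lie_mem := fun {h y} hy ↦ hlie h (rootSum_insert_zero (S := R) ▸
        Submodule.mem_sup_left h.2) y hy }
  have hsup : J = ⨆ χ : Weight ℂ H L, (N ⊓ genWeightSpace L χ).toSubmodule := by
    rw [← LieSubmodule.iSup_toSubmodule, ← eq_iSup_inf_genWeightSpace]
  refine hsup.le.trans <| iSup_le fun χ x hx ↦ ?_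
  suffices key : ∀ α : Dual ℂ H, x ∈ J → x ∈ rootSpace H ⇑α →
      x ∈ rootSum H {α ∈ S | (rootSpace H ⇑α).toSubmodule ≤ J} from
    key χ.toLinear hx.1 hx.2
  intro α hxJ hx
  by_cases hx0 : x = 0
  · rw [hx0]
    exact zero_mem _
  by_cases hα : α = 0
  · refine absurd (hJH x hxJ ?_) hx0
    rw [hα, show ⇑(0 : Dual ℂ H) = 0 from rfl, rootSpace_zero_eq] at hx
    exact hx
  have hle : (rootSpace H ⇑α).toSubmodule ≤ J := rootSpace_le_of_mem hα hx hx0 hxJ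
  have hmem : α ∈ R := by
    by_contra h
    exact hx0 (eq_zero_of_mem_rootSum (S := insert 0 R) (by simp [hα, h]) hx (hJ hxJ))
  have hαS : α ∈ S := by
    refine hS _ hmem fun hneg ↦ ?_
    have hb : rootSpace H ⇑α ≠ ⊥ := fun h ↦ hx0 (by simpa [h] using hx)
    obtain ⟨e, he, f, hf, hH, h0⟩ := exists_lie_mem_ne_zero hα hb
    refine h0 (hJH _ ?_ hH)
    rw [← lie_skew]
    exact J.neg_mem (hlie f (mem_rootSum_of_mem (Set.mem_insert_of_mem _ hneg) hf) e (hle he))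
  have hαT : α ∈ {α ∈ S | (rootSpace H ⇑α).toSubmodule ≤ J} := ⟨hαS, hle⟩
  exact mem_rootSum_of_mem hαT hx

end RootSum

section Parabolic

open LieAlgebra.IsKilling LieModule Module

variable {L : Type*} [LieRing L] [LieAlgebra ℂ L] {p : LieSubalgebra ℂ L}

theorem LieSubalgebra.ad_pow_apply_coe (x y : p) (n : ℕ) :
    (ad ℂ L (x : L) ^ n) (y : L) = ((ad ℂ p x ^ n) y : p) := by
  induction n with
  | zero => simp
  | succ n ih => rw [pow_succ', pow_succ', Module.End.mul_apply, Module.End.mul_apply, ih]; simp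

theorem LieIdeal.lie_mem_map_incl (j : LieIdeal ℂ p) {x y : L} (hx : x ∈ p)
    (hy : y ∈ (j : Submodule ℂ p).map p.incl.toLinearMap) :
    ⁅x, y⁆ ∈ (j : Submodule ℂ p).map p.incl.toLinearMap := by
  obtain ⟨y, hy, rfl⟩ := hy
  exact ⟨⁅⟨x, hx⟩, y⁆, j.lie_mem hy, by simp⟩

theorem LieIdeal.exists_ad_pow_eq_zero {j : LieIdeal ℂ p}
    (hj : ∀ x : p, x ∈ j → IsNilpotent (ad ℂ p x)) {x : L}
    (hx : x ∈ (j : Submodule ℂ p).map p.incl.toLinearMap) :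
    ∃ n : ℕ, ∀ z ∈ p, (ad ℂ L x ^ n) z = 0 := by
  obtain ⟨x, hx, rfl⟩ := hx
  obtain ⟨n, hn⟩ := hj x hx
  refine ⟨n, fun z hz ↦ ?_⟩
  have := LieSubalgebra.ad_pow_apply_coe x ⟨z, hz⟩ n
  rw [hn] at this
  simpa using this

theorem LieIdeal.map_incl_injective :
    Function.Injective fun j : LieIdeal ℂ p ↦ (j : Submodule ℂ p).map p.incl.toLinearMap :=
  fun _ _ h ↦ LieSubmodule.toSubmodule_injective <|
    Submodule.map_injective_of_injective (f := p.incl.toLinearMap) Subtype.val_injective h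

variable {H : LieSubalgebra ℂ L} [H.IsCartanSubalgebra]

theorem exists_lieIdeal_map_incl_eq_rootSum {R Φ : Set (Dual ℂ H)}
    (hp : p.toSubmodule = rootSum H R) (hΦ : Φ ⊆ R)
    (h : ∀ α ∈ R, ∀ β ∈ Φ, rootSpace H ⇑(α + β) ≠ ⊥ → α + β ∈ Φ) :
    ∃ j : LieIdeal ℂ p, (j : Submodule ℂ p).map p.incl.toLinearMap = rootSum H Φ := by
  refine ⟨{ (rootSum H Φ).comap p.incl.toLinearMap with
    lie_mem := fun {x y} hy ↦ lie_mem_rootSum h (hp ▸ x.2 : (x : L) ∈ rootSum H R) hy }, ?_⟩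
  refine (Submodule.map_comap_eq _ _).trans (inf_eq_right.2 ?_)
  refine (rootSum_mono hΦ).trans (hp.ge.trans fun x hx ↦ ⟨⟨x, hx⟩, rfl⟩)

/-- The ad-nilpotent ideals of the subalgebra with roots `R` correspond to the `R`-stable subsets of
`S`, when `S` absorbs `R`, lies in a system of positive elements and contains every root in `R`
whose negative is not in `R`. -/
theorem bijOn_lieIdeal_of_isPositiveSystem [FiniteDimensional ℂ L] [IsKilling ℂ L]
    {B : Dual ℂ H →+ Dual ℂ H →+ ℝ} {R D S : Set (Dual ℂ H)}
    (hD : IsPositiveSystem B D) (hSD : S ⊆ D) (hSR : S ⊆ R)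
    (hRb : ∀ α ∈ R, α ≠ 0 ∧ rootSpace H ⇑α ≠ ⊥)
    (hR : ∀ α : Dual ℂ H, α ≠ 0 → rootSpace H ⇑α ≠ ⊥ → α ∈ R ∨ -α ∈ R)
    (hS : ∀ α ∈ R, -α ∉ R → α ∈ S)
    (hadd : ∀ α ∈ S, ∀ β ∈ R, rootSpace H ⇑(α + β) ≠ ⊥ → α + β ∈ S)
    (hp : p.toSubmodule = rootSum H (insert 0 R)) :
    let F : Set (Set (Dual ℂ H)) := {Φ | Φ ⊆ S ∧ ∀ α ∈ Φ, ∀ β ∈ R, α + β ∈ S → α + β ∈ Φ}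
    (∀ Φ ∈ F, ∃ j : LieIdeal ℂ p, (∀ x : p, x ∈ j → IsNilpotent (ad ℂ p x)) ∧
        (j : Submodule ℂ p).map p.incl.toLinearMap = rootSum H Φ) ∧
      Set.BijOn
        (fun j : LieIdeal ℂ p ↦
          {α ∈ S | (rootSpace H ⇑α).toSubmodule ≤ (j : Submodule ℂ p).map p.incl.toLinearMap})
        {j : LieIdeal ℂ p | ∀ x : p, x ∈ j → IsNilpotent (ad ℂ p x)} F := by
  intro F
  have hmemp : ∀ x, x ∈ p ↔ x ∈ rootSum H (insert 0 R) := fun x ↦ by rw [← hp]; rfl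
  have hex : ∀ Φ ∈ F, ∃ j : LieIdeal ℂ p, (∀ x : p, x ∈ j → IsNilpotent (ad ℂ p x)) ∧
      (j : Submodule ℂ p).map p.incl.toLinearMap = rootSum H Φ := by
    rintro Φ ⟨hΦS, hΦ⟩
    obtain ⟨j, hj⟩ := exists_lieIdeal_map_incl_eq_rootSum (Φ := Φ) hp
      (hΦS.trans (hSR.trans (Set.subset_insert _ _))) fun α hα β hβ hb ↦ by
        rcases hα with rfl | hα
        · rwa [zero_add]
        · rw [add_comm] at hb ⊢
          exact hΦ β hβ α hα (hadd β (hΦS hβ) α hα hb)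
    refine ⟨j, fun x hx ↦ ?_, hj⟩
    refine LieSubalgebra.isNilpotent_ad_of_isNilpotent_ad p (isNilpotent_ad_of_mem_rootSum hD ?_)
    refine rootSum_mono (hΦS.trans hSD) ?_
    rw [← hj]
    exact ⟨x, hx, rfl⟩
  refine ⟨hex, ?_, ?_, ?_⟩
  · intro j hj
    refine ⟨fun α hα ↦ hα.1, ?_⟩
    rintro α ⟨hαS, hαj⟩ β hβ hαβ
    refine ⟨hαβ, ?_⟩
    obtain ⟨hβ0, hβb⟩ := hRb β hβ
    obtain ⟨hαβ0, hαβb⟩ := hRb _ (hSR hαβ)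
    obtain ⟨x, hx, y, hy, hxy⟩ := exists_lie_ne_zero H hβ0 hβb (hRb α (hSR hαS)).2
      (by rwa [add_comm])
    have hxp : x ∈ p := (hmemp x).2 (mem_rootSum_of_mem (Set.mem_insert_of_mem _ hβ) hx)
    refine rootSpace_le_of_mem hαβ0 ?_ hxy (j.lie_mem_map_incl hxp (hαj hy))
    rw [add_comm]
    exact lie_mem_genWeightSpace_of_mem_genWeightSpace hx hy
  · have key : ∀ j : LieIdeal ℂ p, (∀ x : p, x ∈ j → IsNilpotent (ad ℂ p x)) →
        (j : Submodule ℂ p).map p.incl.toLinearMap =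
          rootSum H {α ∈ S | (rootSpace H ⇑α).toSubmodule ≤
            (j : Submodule ℂ p).map p.incl.toLinearMap} := by
      intro j hj
      refine eq_rootSum_of_isNilpotent_ad hR hS ?_ ?_ ?_
      · rintro - ⟨x, -, rfl⟩
        exact (hmemp _).1 x.2
      · exact fun x hx y hy ↦ j.lie_mem_map_incl ((hmemp x).2 hx) hy
      · intro x hx
        obtain ⟨n, hn⟩ := LieIdeal.exists_ad_pow_eq_zero hj hx
        exact ⟨n, fun z hz ↦ hn z ((hmemp z).2 hz)⟩
    intro i hi j hj hij
    refine LieIdeal.map_incl_injective ?_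
    exact (key i hi).trans ((congr_arg (rootSum H) hij).trans (key j hj).symm)
  · intro Φ hΦ
    obtain ⟨j, hj, hjΦ⟩ := hex Φ hΦ
    refine ⟨j, hj, ?_⟩
    ext α
    change α ∈ S ∧ _ ↔ _
    rw [hjΦ]
    refine ⟨fun ⟨hαS, hα⟩ ↦ ?_, fun hα ↦ ⟨hΦ.1 hα, fun x hx ↦ mem_rootSum_of_mem hα hx⟩⟩
    by_contra hαΦ
    refine (hRb α (hSR hαS)).2 ((LieSubmodule.eq_bot_iff _).2 fun x hx ↦ ?_)
    exact eq_zero_of_mem_rootSum hαΦ hx (hα hx)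

end Parabolic

/-- Define `F_I = {Φ ⊆ Δ⁺ \ Δ_I : if α ∈ Φ, β ∈ Δ⁺ ∪ Δ_I and α + β ∈ Δ⁺, then
α + β ∈ Φ}`.  For every `Φ ∈ F_I`, the subspace `i_Φ = ⊕_{α ∈ Φ} g_α` is an ad-nilpotent ideal
of `p_I`, and the map `i ↦ Φ_i = {α ∈ Δ⁺ \ Δ_I : g_α ⊆ i}` is a bijection from the set of
ad-nilpotent ideals of `p_I` onto `F_I`. -/
theorem stmt2
    {L : Type*} [LieRing L] [LieAlgebra ℂ L] [FiniteDimensional ℂ L]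
    [LieAlgebra.IsSimple ℂ L]
    (H : LieSubalgebra ℂ L) [H.IsCartanSubalgebra]
    -- the root system of (g, h)
    (Δ : Set (Module.Dual ℂ H))
    (hΔ : Δ = {α : Module.Dual ℂ H | α ≠ 0 ∧ rootSpace H ⇑α ≠ ⊥})
    -- a fixed system of positive roots
    (Δp : Set (Module.Dual ℂ H))
    (hΔpsub : Δp ⊆ Δ)
    (hΔppm : ∀ α ∈ Δ, (α ∈ Δp ↔ -α ∉ Δp))
    (hΔpcl : ∀ α ∈ Δp, ∀ β ∈ Δp, α + β ∈ Δ → α + β ∈ Δp)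
    -- the corresponding simple roots
    (SR : Set (Module.Dual ℂ H))
    (hSR : SR = {α ∈ Δp | ¬ ∃ β ∈ Δp, ∃ γ ∈ Δp, α = β + γ})
    -- a subset of the simple roots and the associated `Δ_I = ℤI ∩ Δ`
    (I : Set (Module.Dual ℂ H)) (hI : I ⊆ SR)
    (ΔI : Set (Module.Dual ℂ H))
    (hΔI : ΔI = {α ∈ Δ | α ∈ Submodule.span ℤ I})
    -- the standard parabolic subalgebra `p_I = h ⊕ (⊕_{α ∈ Δ_I ∪ Δ⁺} g_α)`
    (p : LieSubalgebra ℂ L)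
    (hp : p.toSubmodule =
      H.toSubmodule ⊔ ⨆ α ∈ ΔI ∪ Δp, (rootSpace H ⇑α).toSubmodule)
    -- the combinatorial family `F_I`
    (FI : Set (Set (Module.Dual ℂ H)))
    (hFI : FI = {Φ | Φ ⊆ Δp \ ΔI ∧
      ∀ α ∈ Φ, ∀ β ∈ Δp ∪ ΔI, α + β ∈ Δp → α + β ∈ Φ}) :
    (∀ Φ ∈ FI, ∃ j : LieIdeal ℂ p,
        (∀ x : p, x ∈ j → IsNilpotent (LieAlgebra.ad ℂ p x)) ∧
        (j : Submodule ℂ p).map p.incl.toLinearMap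
          = ⨆ α ∈ Φ, (rootSpace H ⇑α).toSubmodule) ∧
      Set.BijOn
        (fun j : LieIdeal ℂ p => {α ∈ Δp \ ΔI |
          (rootSpace H ⇑α).toSubmodule ≤ (j : Submodule ℂ p).map p.incl.toLinearMap})
        {j : LieIdeal ℂ p | ∀ x : p, x ∈ j → IsNilpotent (LieAlgebra.ad ℂ p x)}
        FI := by
  have hΔ' : Δ = Set.range (IsKilling.rootSystem H).root := by rw [hΔ, range_root_rootSystem]
  have hmemΔ : ∀ α : Module.Dual ℂ H, α ≠ 0 → rootSpace H ⇑α ≠ ⊥ → α ∈ Δ :=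
    fun α h0 hb ↦ hΔ ▸ ⟨h0, hb⟩
  have hnegΔ : ∀ α ∈ Δ, -α ∈ Δ := by
    intro α hα
    rw [hΔ] at hα ⊢
    exact ⟨neg_ne_zero.2 hα.1, rootSpace_neg_ne_bot hα.2⟩
  have hpos : IsPositiveSystem (reRootForm H) Δp :=
    isPositiveSystem_of_closed H (hΔ' ▸ hΔpsub) (hΔ' ▸ hΔppm) (hΔ' ▸ hΔpcl)
  have hfin : Δp.Finite := (Set.finite_range (IsKilling.rootSystem H).root).subset (hΔ' ▸ hΔpsub)
  have hIs : I ⊆ IsPositiveSystem.simple Δp := hI.trans hSR.le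
  have hmemΔI : ∀ α, α ∈ ΔI ↔ α ∈ Δ ∧ α ∈ Submodule.span ℤ I := fun α ↦ by rw [hΔI]; rfl
  have hnegΔI : ∀ α ∈ ΔI, -α ∈ ΔI := fun α hα ↦
    (hmemΔI _).2 ⟨hnegΔ α ((hmemΔI α).1 hα).1, neg_mem ((hmemΔI α).1 hα).2⟩
  have hsum : ∀ α ∈ Δp \ ΔI, ∀ β ∈ Δp, α + β ∉ Submodule.span ℤ I := fun α hα β hβ h ↦
    hα.2 ((hmemΔI α).2 ⟨hΔpsub hα.1, hpos.mem_span_of_add_mem_span hfin hIs hα.1 hβ h⟩)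
  have hRΔ : ∀ α ∈ ΔI ∪ Δp, α ∈ Δ := by
    rintro α (hα | hα)
    · exact ((hmemΔI α).1 hα).1
    · exact hΔpsub hα
  have hadd : ∀ α ∈ Δp \ ΔI, ∀ β ∈ ΔI ∪ Δp, rootSpace H ⇑(α + β) ≠ ⊥ → α + β ∈ Δp \ ΔI := by
    rintro α hα β (hβ | hβ) hb
    · have hβs := ((hmemΔI β).1 hβ).2
      have hns : α + β ∉ Submodule.span ℤ I := fun h ↦ hα.2 <| (hmemΔI α).2
        ⟨hΔpsub hα.1, by simpa using sub_mem h hβs⟩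
      refine ⟨?_, fun h ↦ hns ((hmemΔI _).1 h).2⟩
      have hΔαβ := hmemΔ (α + β) (fun h ↦ hns (by rw [h]; exact zero_mem _)) hb
      rw [hΔppm _ hΔαβ]
      intro hneg
      exact hsum α hα _ hneg (by simpa using neg_mem hβs)
    · have hns := hsum α hα β hβ
      exact ⟨hΔpcl α hα.1 β hβ (hmemΔ (α + β) (fun h ↦ hns (by rw [h]; exact zero_mem _)) hb),
        fun h ↦ hns ((hmemΔI _).1 h).2⟩
  have hFI' : FI = {Φ | Φ ⊆ Δp \ ΔI ∧
      ∀ α ∈ Φ, ∀ β ∈ ΔI ∪ Δp, α + β ∈ Δp \ ΔI → α + β ∈ Φ} := by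
    rw [hFI]
    ext Φ
    refine and_congr_right fun hΦ ↦ ⟨fun h α hα β hβ hαβ ↦ h α hα β hβ.symm hαβ.1,
      fun h α hα β hβ hαβ ↦ h α hα β hβ.symm (hadd α (hΦ hα) β hβ.symm ?_)⟩
    exact (hΔ.le (hΔpsub hαβ)).2
  rw [hFI']
  refine bijOn_lieIdeal_of_isPositiveSystem hpos Set.sdiff_subset
    (Set.sdiff_subset.trans Set.subset_union_right) (fun α hα ↦ hΔ.le (hRΔ α hα)) ?_ ?_ hadd
    (hp.trans rootSum_insert_zero.symm)
  · intro α h0 hb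
    by_cases hα : α ∈ Δp
    · exact Or.inl (Or.inr hα)
    · have := (hΔppm α (hmemΔ α h0 hb)).not.1 hα
      exact Or.inr (Or.inr (not_not.1 this))
  · intro α hα hneg
    have hαI : α ∉ ΔI := fun h ↦ hneg (Or.inl (hnegΔI α h))
    exact ⟨hα.resolve_left hαI, hαI⟩
end

section
/- Let g be a complex simple Lie algebra with highest root θ, and for I ⊆ Π let p_I be the standard parabolic subalgebra. For Φ ∈ F_I with associated ad-nilpotent ideal i_Φ = ⊕_{α ∈ Φ} g_α, define Φ² = {α + β : α, β ∈ Φ} ∩ Δ⁺. Then Φ² ≠ ∅ if and only if θ ∈ Φ²; consequently i_Φ is abelian if and only if θ ∉ Φ². -/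
open LieAlgebra

/-- An abstract form of a finite root system: every `α ∈ Δ` has a real functional, playing the role
of its coroot, whose sign on `β ∈ Δ` decides whether `α` can be added to or subtracted from `β`. -/
def HasCoroots {V : Type*} [AddCommGroup V] (Δ : Set V) : Prop :=
  ∀ α ∈ Δ, ∃ f : V →+ ℝ, f α = 2 ∧ ∀ β ∈ Δ,
    (f β < 0 → α + β ∈ Δ ∨ α + β = 0) ∧ (0 < f β → β - α ∈ Δ ∨ β - α = 0)

/-- A closed subset of `Δ` containing exactly one of each pair of opposite elements. -/
structure IsPositiveSystem_s7 {V : Type*} [AddCommGroup V] (Δ Δp : Set V) : Prop where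
  subset : Δp ⊆ Δ
  mem_iff : ∀ α ∈ Δ, (α ∈ Δp ↔ -α ∉ Δp)
  add_mem : ∀ α ∈ Δp, ∀ β ∈ Δp, α + β ∈ Δ → α + β ∈ Δp

namespace IsPositiveSystem_s7

variable {V : Type*} [AddCommGroup V] {Δ Δp : Set V}

lemma add_ne_zero (h : IsPositiveSystem_s7 Δ Δp) {α β : V} (hα : α ∈ Δp) (hβ : β ∈ Δp) :
    α + β ≠ 0 := fun e ↦
  (h.mem_iff α (h.subset hα)).mp hα (by rwa [neg_eq_of_add_eq_zero_right e])

lemma sum_ne_zero (h : IsPositiveSystem_s7 Δ Δp) (hc : HasCoroots Δ) (l : Multiset V)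
    (hl : ∀ x ∈ l, x ∈ Δp) (h0 : l ≠ 0) : l.sum ≠ 0 := by
  induction hn : l.card using Nat.strong_induction_on generalizing l with
  | _ n ih =>
  intro hs
  obtain ⟨a, ha⟩ := Multiset.exists_mem_of_ne_zero h0
  obtain ⟨t, rfl⟩ := Multiset.exists_cons_of_mem ha
  obtain ⟨f, hf, hf'⟩ := hc a (h.subset (hl a ha))
  have hft : 2 + (t.map f).sum = 0 := by
    simpa [hf, map_multiset_sum] using congrArg f hs
  obtain ⟨b, hb, hfb⟩ : ∃ b ∈ t, f b < 0 := by
    by_contra! hcon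
    have : 0 ≤ (t.map f).sum := Multiset.sum_nonneg (by simpa using hcon)
    linarith
  have hbp : b ∈ Δp := hl b (Multiset.mem_cons_of_mem hb)
  have hab := h.add_mem a (hl a ha) b hbp
    (((hf' b (h.subset hbp)).1 hfb).resolve_right (h.add_ne_zero (hl a ha) hbp))
  obtain ⟨s, rfl⟩ := Multiset.exists_cons_of_mem hb
  refine ih _ ?_ ((a + b) ::ₘ s) ?_ (by simp) rfl (by simpa [add_assoc] using hs)
  · simp [← hn]
  · intro x hx
    rcases Multiset.mem_cons.mp hx with rfl | hx
    · exact hab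
    · exact hl x (by simp [hx])

lemma exists_add_mem_of_ne (h : IsPositiveSystem_s7 Δ Δp) (hc : HasCoroots Δ) {θ γ : V}
    (hθ : θ ∈ Δp) (hγ : γ ∈ Δp) (hne : γ ≠ θ) {l : Multiset V} (hl : ∀ x ∈ l, x ∈ Δp)
    (hsum : θ = γ + l.sum) : ∃ δ ∈ Δp, γ + δ ∈ Δp := by
  by_contra! hcon
  obtain ⟨f, hf, hf'⟩ := hc γ (h.subset hγ)
  have hnn : ∀ δ ∈ Δp, 0 ≤ f δ := fun δ hδ ↦ by
    by_contra! hlt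
    exact hcon δ hδ (h.add_mem γ hγ δ hδ
      (((hf' δ (h.subset hδ)).1 hlt).resolve_right (h.add_ne_zero hγ hδ)))
  have hfθ : 0 < f θ := by
    have : 0 ≤ (l.map f).sum := Multiset.sum_nonneg (by simpa using fun x hx ↦ hnn x (hl x hx))
    rw [hsum, map_add, map_multiset_sum, hf]
    linarith
  have hsub : θ - γ ∈ Δ :=
    ((hf' θ (h.subset hθ)).2 hfθ).resolve_right (sub_ne_zero.mpr hne.symm)
  by_cases hp : θ - γ ∈ Δp
  · exact hcon _ hp (by rwa [add_sub_cancel])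
  · have hp' : γ - θ ∈ Δp := by simpa using mt (h.mem_iff _ hsub).mpr hp
    refine h.sum_ne_zero hc ((γ - θ) ::ₘ l) ?_ (by simp) ?_
    · intro x hx
      rcases Multiset.mem_cons.mp hx with rfl | hx
      exacts [hp', hl x hx]
    · rw [Multiset.sum_cons, hsum]
      abel

/-- A property of positive roots that is stable under adding positive roots and holds for some
positive root holds for the highest root. -/
lemma highest_of_stable (h : IsPositiveSystem_s7 Δ Δp) (hc : HasCoroots Δ) (hfin : Δ.Finite) {θ : V}
    (hθ : θ ∈ Δp)
    (hmax : ∀ α ∈ Δp, ∃ l : Multiset V, (∀ x ∈ l, x ∈ Δp) ∧ θ = α + l.sum) {P : V → Prop}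
    (hP : ∀ γ ∈ Δp, ∀ δ ∈ Δp, γ + δ ∈ Δp → P γ → P (γ + δ)) {γ : V} (hγ : γ ∈ Δp) (hPγ : P γ) :
    P θ := by
  have : Finite Δp := hfin.subset h.subset
  let r : Δp → Δp → Prop := fun a b ↦
    ∃ l : Multiset V, (∀ x ∈ l, x ∈ Δp) ∧ l ≠ 0 ∧ (a : V) = b + l.sum
  have : IsTrans Δp r := ⟨by
    rintro a b c ⟨l, hl, h0, e⟩ ⟨m, hm, -, e'⟩
    refine ⟨l + m, fun x hx ↦ (Multiset.mem_add.mp hx).elim (hl x) (hm x), ?_, ?_⟩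
    · simp [h0]
    · rw [e, e', Multiset.sum_add]
      abel⟩
  have : Std.Irrefl r := ⟨by
    rintro a ⟨l, hl, h0, e⟩
    exact h.sum_ne_zero hc l hl h0 (by simpa using e)⟩
  suffices ∀ a : Δp, P a → P θ from this ⟨γ, hγ⟩ hPγ
  intro a
  induction a using (Finite.wellFounded_of_trans_of_irrefl r).induction with
  | _ a ih =>
  intro ha
  by_cases hne : (a : V) = θ
  · rwa [← hne]
  obtain ⟨l, hl, hsum⟩ := hmax a a.2
  obtain ⟨δ, hδ, hadd⟩ := h.exists_add_mem_of_ne hc hθ a.2 hne hl hsum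
  exact ih ⟨a + δ, hadd⟩ ⟨{δ}, by simpa using hδ, by simp, by simp⟩ (hP a a.2 δ hδ hadd ha)

end IsPositiveSystem_s7

namespace LieAlgebra.IsKilling

open LieModule

variable {L : Type*} [LieRing L] [LieAlgebra ℂ L]
  {H : LieSubalgebra ℂ L} [H.IsCartanSubalgebra]

variable (H) in
/-- The roots of `H`, as linear functionals. -/
def roots : Set (Module.Dual ℂ H) := {α | α ≠ 0 ∧ rootSpace H ⇑α ≠ ⊥}

/-- A root, viewed as a weight. -/
def roots.weight {α : Module.Dual ℂ H} (hα : α ∈ roots H) : Weight ℂ H L := ⟨α, hα.2⟩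

lemma roots.isNonZero_weight {α : Module.Dual ℂ H} (hα : α ∈ roots H) :
    (roots.weight hα).IsNonZero := fun h ↦ hα.1 (DFunLike.coe_injective h)

lemma mem_roots_or_eq_zero {α : Module.Dual ℂ H} (hα : rootSpace H ⇑α ≠ ⊥) :
    α ∈ roots H ∨ α = 0 :=
  (eq_or_ne α 0).symm.imp_left (⟨·, hα⟩)

lemma exists_mem_rootSpace {α : Module.Dual ℂ H} (hα : α ∈ roots H) :
    ∃ x ∈ rootSpace H ⇑α, x ≠ 0 :=
  (roots.weight hα).exists_ne_zero

lemma lie_eq_zero_of_add_notMem_roots {α β : Module.Dual ℂ H} (h0 : α + β ≠ 0)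
    (hαβ : α + β ∉ roots H) {x y : L} (hx : x ∈ rootSpace H ⇑α) (hy : y ∈ rootSpace H ⇑β) :
    ⁅x, y⁆ = 0 := by
  have hbot : rootSpace H ⇑(α + β) = ⊥ := by
    by_contra h
    exact hαβ ⟨h0, h⟩
  have : ⁅x, y⁆ ∈ rootSpace H ⇑(α + β) := lie_mem_genWeightSpace_of_mem_genWeightSpace hx hy
  simpa only [hbot, LieSubmodule.mem_bot] using this

variable [FiniteDimensional ℂ L]

lemma finite_roots : (roots H).Finite := by
  refine Set.Finite.of_finite_image (f := fun α : Module.Dual ℂ H ↦ (α : H → ℂ))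
    ((finite_genWeightSpace_ne_bot ℂ H L).subset ?_) DFunLike.coe_injective.injOn
  rintro _ ⟨α, hα, rfl⟩
  exact hα.2

variable [IsKilling ℂ L]

/-- Brackets of nonzero vectors in two root spaces do not vanish if the sum is again a root. -/
lemma lie_ne_zero_of_mem_rootSpace {α β : Weight ℂ H L} (hα : α.IsNonZero) (hβ : β.IsNonZero)
    (hαβ : rootSpace H (α + β : H → ℂ) ≠ ⊥) {x y : L} (hx : x ∈ rootSpace H α)
    (hy : y ∈ rootSpace H β) (hx0 : x ≠ 0) (hy0 : y ≠ 0) : ⁅x, y⁆ ≠ 0 := by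
  obtain ⟨v, hv, hv0⟩ := (chainTop α β).exists_ne_zero
  obtain ⟨h, e, f, isSl2, he, hf⟩ := exists_isSl2Triple_of_weight_isNonZero hα
  obtain rfl := isSl2.h_eq_coroot hα he hf
  have prim : isSl2.HasPrimitiveVectorWith v (chainLength α β : ℂ) :=
    have := lie_mem_genWeightSpace_of_mem_genWeightSpace he hv
    ⟨hv0, (chainLength_smul _ _ hv).symm, by rwa [genWeightSpace_add_chainTop _ _ hα] at this⟩
  have htop : 1 ≤ chainTopCoeff α β := by
    have := ((rootSpace_zsmul_add_ne_bot_iff α β hα 1).mp (by simpa using hαβ)).1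
    exact_mod_cast this
  obtain ⟨q, hq⟩ : ∃ q, chainTopCoeff α β = q + 1 := ⟨_, (Nat.sub_add_cancel htop).symm⟩
  have hlen : q + 1 ≤ chainLength α β := hq ▸ chainTopCoeff_le_chainLength α β
  have hw : ((toEnd ℂ L L f) ^ (q + 1)) v ∈ rootSpace H β := by
    have := toEnd_pow_apply_mem hf hv (q + 1)
    rwa [coe_chainTop', hq, smul_neg, neg_add_cancel_left] at this
  have hne (n : ℕ) (hn : n ≤ chainLength α β) : ((toEnd ℂ L L f) ^ n) v ≠ 0 :=
    prim.pow_toEnd_f_ne_zero_of_eq_nat rfl hn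
  obtain ⟨k, rfl⟩ : ∃ k : ℂ, k • e = x := by
    simpa using (finrank_eq_one_iff_of_nonzero' ⟨e, he⟩ (by simpa using isSl2.e_ne_zero)).mp
      (finrank_rootSpace_eq_one α hα) ⟨x, hx⟩
  obtain ⟨m, rfl⟩ : ∃ m : ℂ, m • ((toEnd ℂ L L f) ^ (q + 1)) v = y := by
    simpa using (finrank_eq_one_iff_of_nonzero' ⟨_, hw⟩ (by simpa using hne _ hlen)).mp
      (finrank_rootSpace_eq_one β hβ) ⟨y, hy⟩
  rw [smul_lie, lie_smul, prim.lie_e_pow_succ_toEnd_f]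
  refine smul_ne_zero (left_ne_zero_of_smul hx0) (smul_ne_zero (left_ne_zero_of_smul hy0)
    (smul_ne_zero (mul_ne_zero (by exact_mod_cast q.succ_ne_zero) ?_) (hne q (by lia))))
  rw [sub_ne_zero]
  exact_mod_cast (by lia : chainLength α β ≠ q)

lemma lie_ne_zero_of_mem_roots {α β : Module.Dual ℂ H} (hα : α ∈ roots H) (hβ : β ∈ roots H)
    (hαβ : α + β ∈ roots H) {x y : L} (hx : x ∈ rootSpace H ⇑α) (hy : y ∈ rootSpace H ⇑β)
    (hx0 : x ≠ 0) (hy0 : y ≠ 0) : ⁅x, y⁆ ≠ 0 :=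
  lie_ne_zero_of_mem_rootSpace (roots.isNonZero_weight hα) (roots.isNonZero_weight hβ) hαβ.2
    hx hy hx0 hy0

lemma hasCoroots_roots : HasCoroots (roots H) := by
  intro α hα
  set a := roots.weight hα
  have ha := roots.isNonZero_weight hα
  refine ⟨Complex.reAddGroupHom.comp
    (AddMonoidHom.mk' (fun β : Module.Dual ℂ H ↦ β (coroot a)) fun _ _ ↦ rfl), ?_, ?_⟩
  · have : α (coroot a) = 2 := root_apply_coroot ha
    simp [this]
  · intro β hβ
    have hval : β (coroot a) = _ := apply_coroot_eq_cast a (roots.weight hβ)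
    have hiff := rootSpace_zsmul_add_ne_bot_iff a (roots.weight hβ) ha
    have hre : (β (coroot a)).re = ((chainBotCoeff a (roots.weight hβ) -
      chainTopCoeff a (roots.weight hβ) : ℤ) : ℝ) := by rw [hval, Complex.intCast_re]
    refine ⟨fun h ↦ ?_, fun h ↦ ?_⟩
    · replace h : (β (coroot a)).re < 0 := h
      rw [hre, Int.cast_lt_zero] at h
      refine mem_roots_or_eq_zero ?_
      have := (hiff 1).mpr ⟨by lia, by lia⟩
      rwa [one_zsmul] at this
    · replace h : 0 < (β (coroot a)).re := h
      rw [hre, Int.cast_pos] at h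
      refine mem_roots_or_eq_zero ?_
      have := (hiff (-1)).mpr ⟨by lia, by lia⟩
      rwa [neg_one_zsmul, neg_add_eq_sub] at this

/-- By the Jacobi identity, if `α + β` and `α + β + δ` are roots then so is `α + δ` or `β + δ`,
unless one of these vanishes. -/
lemma add_mem_roots_or_add_mem_roots {α β δ : Module.Dual ℂ H} (hα : α ∈ roots H)
    (hβ : β ∈ roots H) (hδ : δ ∈ roots H) (hαβ : α + β ∈ roots H) (hαβδ : α + β + δ ∈ roots H)
    (hαδ : α + δ ≠ 0) (hβδ : β + δ ≠ 0) : α + δ ∈ roots H ∨ β + δ ∈ roots H := by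
  by_contra! hcon
  obtain ⟨x, hx, hx0⟩ := exists_mem_rootSpace hα
  obtain ⟨y, hy, hy0⟩ := exists_mem_rootSpace hβ
  obtain ⟨z, hz, hz0⟩ := exists_mem_rootSpace hδ
  have hxy : ⁅x, y⁆ ∈ rootSpace H ⇑(α + β) := lie_mem_genWeightSpace_of_mem_genWeightSpace hx hy
  apply lie_ne_zero_of_mem_roots hαβ hδ hαβδ hxy hz
    (lie_ne_zero_of_mem_roots hα hβ hαβ hx hy hx0 hy0) hz0
  rw [lie_lie, lie_eq_zero_of_add_notMem_roots hβδ hcon.2 hy hz,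
    lie_eq_zero_of_add_notMem_roots hαδ hcon.1 hx hz, lie_zero, lie_zero, sub_zero]

/-- A subspace of the form `⨆ α ∈ Φ, g_α` is commutative if and only if no sum of two elements
of `Φ` is a root, provided such sums are nonzero. -/
lemma forall_lie_eq_zero_iff {Φ : Set (Module.Dual ℂ H)} (hΦ : Φ ⊆ roots H)
    (h0 : ∀ α ∈ Φ, ∀ β ∈ Φ, α + β ≠ 0) :
    (∀ x ∈ ⨆ α ∈ Φ, (rootSpace H ⇑α).toSubmodule, ∀ y ∈ ⨆ α ∈ Φ, (rootSpace H ⇑α).toSubmodule,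
      ⁅x, y⁆ = 0) ↔ ∀ α ∈ Φ, ∀ β ∈ Φ, α + β ∉ roots H := by
  refine ⟨fun h α hα β hβ hαβ ↦ ?_, fun h x hx y hy ↦ ?_⟩
  · obtain ⟨x, hx, hx0⟩ := exists_mem_rootSpace (hΦ hα)
    obtain ⟨y, hy, hy0⟩ := exists_mem_rootSpace (hΦ hβ)
    have hle {γ : Module.Dual ℂ H} (hγ : γ ∈ Φ) :
        (rootSpace H ⇑γ).toSubmodule ≤ ⨆ α ∈ Φ, (rootSpace H ⇑α).toSubmodule :=
      le_iSup₂_of_le γ hγ le_rfl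
    exact lie_ne_zero_of_mem_roots (hΦ hα) (hΦ hβ) hαβ hx hy hx0 hy0
      (h x (hle hα hx) y (hle hβ hy))
  · rw [iSup_subtype'] at hx hy
    induction hx using Submodule.iSup_induction' with
    | zero => exact zero_lie y
    | add x₁ x₂ _ _ h₁ h₂ => rw [add_lie, h₁, h₂, add_zero]
    | mem α x hx =>
      induction hy using Submodule.iSup_induction' with
      | zero => exact lie_zero x
      | add y₁ y₂ _ _ h₁ h₂ => rw [lie_add, h₁, h₂, add_zero]
      | mem β y hy =>
        exact lie_eq_zero_of_add_notMem_roots (h0 α α.2 β β.2) (h α α.2 β β.2) hx hy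

end LieAlgebra.IsKilling

lemma LieIdeal.isLieAbelian_iff_forall_map {R L : Type*} [CommRing R] [LieRing L] [LieAlgebra R L]
    {p : LieSubalgebra R L} (i : LieIdeal R p) :
    IsLieAbelian i ↔ ∀ x ∈ (i : Submodule R p).map p.incl.toLinearMap,
      ∀ y ∈ (i : Submodule R p).map p.incl.toLinearMap, ⁅x, y⁆ = 0 := by
  constructor
  · rintro h _ ⟨x, hx, rfl⟩ _ ⟨y, hy, rfl⟩
    have := h.trivial ⟨x, hx⟩ ⟨y, hy⟩
    simpa [Subtype.ext_iff] using this
  · intro h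
    refine ⟨fun x y ↦ ?_⟩
    have := h _ ⟨x, x.2, rfl⟩ _ ⟨y, y.2, rfl⟩
    simpa [Subtype.ext_iff] using this

/-- Let `θ` be the highest root.  For `Φ ∈ F_I` with associated ad-nilpotent
ideal `i_Φ = ⊕_{α ∈ Φ} g_α`, define `Φ² = {α + β : α, β ∈ Φ} ∩ Δ⁺`.  Then `Φ² ≠ ∅` if and only
if `θ ∈ Φ²`; consequently `i_Φ` is abelian if and only if `θ ∉ Φ²`. -/
theorem stmt7
    {L : Type*} [LieRing L] [LieAlgebra ℂ L] [FiniteDimensional ℂ L]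
    [LieAlgebra.IsSimple ℂ L]
    (H : LieSubalgebra ℂ L) [H.IsCartanSubalgebra]
    -- the root system of (g, h)
    (Δ : Set (Module.Dual ℂ H))
    (hΔ : Δ = {α : Module.Dual ℂ H | α ≠ 0 ∧ rootSpace H ⇑α ≠ ⊥})
    -- a fixed system of positive roots
    (Δp : Set (Module.Dual ℂ H))
    (hΔpsub : Δp ⊆ Δ)
    (hΔppm : ∀ α ∈ Δ, (α ∈ Δp ↔ -α ∉ Δp))
    (hΔpcl : ∀ α ∈ Δp, ∀ β ∈ Δp, α + β ∈ Δ → α + β ∈ Δp)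
    -- the highest root
    (θ : Module.Dual ℂ H)
    (hθ : θ ∈ Δp ∧ ∀ α ∈ Δp, ∃ l : Multiset (Module.Dual ℂ H),
      (∀ x ∈ l, x ∈ Δp) ∧ θ = α + l.sum)
    -- the corresponding simple roots
    (SR : Set (Module.Dual ℂ H))
    (hSR : SR = {α ∈ Δp | ¬ ∃ β ∈ Δp, ∃ γ ∈ Δp, α = β + γ})
    -- a subset of the simple roots and the associated `Δ_I = ℤI ∩ Δ`
    (I : Set (Module.Dual ℂ H)) (hI : I ⊆ SR)
    (ΔI : Set (Module.Dual ℂ H))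
    (hΔI : ΔI = {α ∈ Δ | α ∈ Submodule.span ℤ I})
    -- the standard parabolic subalgebra `p_I = h ⊕ (⊕_{α ∈ Δ_I ∪ Δ⁺} g_α)`
    (p : LieSubalgebra ℂ L)
    (hp : p.toSubmodule =
      H.toSubmodule ⊔ ⨆ α ∈ ΔI ∪ Δp, (rootSpace H ⇑α).toSubmodule)
    -- an element `Φ ∈ F_I`
    (Φ : Set (Module.Dual ℂ H))
    (hΦ : Φ ⊆ Δp \ ΔI ∧ ∀ α ∈ Φ, ∀ β ∈ Δp ∪ ΔI, α + β ∈ Δp → α + β ∈ Φ)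
    -- the set `Φ² = {α + β : α, β ∈ Φ} ∩ Δ⁺`
    (Φsq : Set (Module.Dual ℂ H))
    (hΦsq : Φsq = {γ | ∃ α ∈ Φ, ∃ β ∈ Φ, γ = α + β} ∩ Δp) :
    (Φsq ≠ ∅ ↔ θ ∈ Φsq) ∧
      ∀ i : LieIdeal ℂ p,
        (i : Submodule ℂ p).map p.incl.toLinearMap
          = ⨆ α ∈ Φ, (rootSpace H ⇑α).toSubmodule →
        (IsLieAbelian i ↔ θ ∉ Φsq) := by
  change Δ = IsKilling.roots H at hΔ
  have hpos : IsPositiveSystem_s7 Δ Δp := ⟨hΔpsub, hΔppm, hΔpcl⟩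
  subst hΔ
  have hΦp : Φ ⊆ Δp := fun α hα ↦ (hΦ.1 hα).1
  have hstable : ∀ γ ∈ Δp, ∀ δ ∈ Δp, γ + δ ∈ Δp → γ ∈ Φsq → γ + δ ∈ Φsq := by
    subst hΦsq
    rintro _ - δ hδ hadd ⟨⟨α, hα, β, hβ, rfl⟩, hγ⟩
    refine ⟨?_, hadd⟩
    obtain h | h := IsKilling.add_mem_roots_or_add_mem_roots (hΔpsub (hΦp hα)) (hΔpsub (hΦp hβ))
      (hΔpsub hδ) (hΔpsub hγ) (hΔpsub hadd) (hpos.add_ne_zero (hΦp hα) hδ)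
      (hpos.add_ne_zero (hΦp hβ) hδ)
    · exact ⟨α + δ, hΦ.2 α hα δ (.inl hδ) (hΔpcl α (hΦp hα) δ hδ h), β, hβ, by abel⟩
    · exact ⟨α, hα, β + δ, hΦ.2 β hβ δ (.inl hδ) (hΔpcl β (hΦp hβ) δ hδ h), by abel⟩
  have hθiff : Φsq ≠ ∅ ↔ θ ∈ Φsq := by
    refine ⟨fun h ↦ ?_, fun h ↦ Set.nonempty_iff_ne_empty.mp ⟨θ, h⟩⟩
    obtain ⟨γ, hγ⟩ := Set.nonempty_iff_ne_empty.mpr h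
    exact hpos.highest_of_stable IsKilling.hasCoroots_roots IsKilling.finite_roots hθ.1 hθ.2
      hstable (hΦsq ▸ hγ).2 hγ
  refine ⟨hθiff, fun i hi ↦ ?_⟩
  rw [LieIdeal.isLieAbelian_iff_forall_map, hi, ← hθiff, not_not,
    IsKilling.forall_lie_eq_zero_iff (hΦp.trans hΔpsub)
      fun α hα β hβ ↦ hpos.add_ne_zero (hΦp hα) (hΦp hβ), hΦsq, Set.eq_empty_iff_forall_notMem]
  constructor
  · rintro h _ ⟨⟨α, hα, β, hβ, rfl⟩, hγ⟩
    exact h α hα β hβ (hΔpsub hγ)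
  · intro h α hα β hβ hγ
    exact h _ ⟨⟨α, hα, β, hβ, rfl⟩, hΔpcl α (hΦp hα) β (hΦp hβ) hγ⟩
end

section
/- In the root system of type E₆, the number of antichains of the poset of positive roots (Δ⁺, ≤), where α ≤ β iff β − α is a sum of positive roots, is 833; equivalently, the Borel subalgebra (the standard parabolic p_∅) of the simple Lie algebra of type E₆ has exactly 833 ad-nilpotent ideals. -/
/-- The roots of the root system of type `E₈`, realized (scaled by a factor 2) as the integer
vectors `±2eᵢ ± 2eⱼ` (`i ≠ j`) together with the vectors with all coordinates `±1` and an even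
number of coordinates equal to `-1`. -/
def E8roots : Set (Fin 8 → ℤ) :=
  {v | (∑ i, v i ^ 2 = 8) ∧
    ((∀ i, Even (v i)) ∨
      ((∀ i, v i = 1 ∨ v i = -1) ∧
        Even (Finset.univ.filter (fun i => v i = -1)).card))}

/-- The root system of type `E₆`, realized as the subsystem of `E₈` orthogonal to the
`A₂`-subsystem spanned by `2e₆ + 2e₇` and `2e₅ + 2e₆`. -/
def E6roots : Set (Fin 8 → ℤ) :=
  {v | v ∈ E8roots ∧ v 6 + v 7 = 0 ∧ v 5 + v 6 = 0}

/-- A system of positive roots for `E₆`: the roots on which the (generic) linear functional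
`v ↦ ∑ i, 2 ^ i * v i` is positive. -/
def E6pos : Set (Fin 8 → ℤ) :=
  {v | v ∈ E6roots ∧ 0 < ∑ i : Fin 8, 2 ^ i.val * v i}

/-- The partial order on positive roots: `α ≤ β` iff `β − α` is a (possibly empty) sum of
positive roots. -/
def rootLe (pos : Set (Fin 8 → ℤ)) (a b : Fin 8 → ℤ) : Prop :=
  ∃ l : Multiset (Fin 8 → ℤ), (∀ x ∈ l, x ∈ pos) ∧ b = a + l.sum

/-- The number of antichains contained in a list without repetitions, computed by splitting on
whether the head of the list is used; the first argument bounds the length of the list. -/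
def antichainCount {α : Type*} [LE α] [DecidableLE α] : ℕ → List α → ℕ
  | 0, _ => 1
  | _, [] => 1
  | n + 1, a :: l =>
    antichainCount n l + antichainCount n (l.filter fun b => ¬ a ≤ b ∧ ¬ b ≤ a)

theorem setOf_isAntichain_cons {α : Type*} [LE α] [DecidableLE α] (a : α) (l : List α) :
    {A : Set α | A ⊆ {x | x ∈ a :: l} ∧ IsAntichain (· ≤ ·) A} =
      {A : Set α | A ⊆ {x | x ∈ l} ∧ IsAntichain (· ≤ ·) A} ∪
        insert a '' {A : Set α | A ⊆ {x | x ∈ l.filter fun b => ¬ a ≤ b ∧ ¬ b ≤ a} ∧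
          IsAntichain (· ≤ ·) A} := by
  ext A
  constructor
  · rintro ⟨hA, hanti⟩
    by_cases ha : a ∈ A
    · refine Or.inr ⟨A \ {a}, ⟨fun x hx => ?_, hanti.subset Set.sdiff_subset⟩, by simp [ha]⟩
      have hxl : x ∈ l := (List.mem_cons.1 (hA hx.1)).resolve_left hx.2
      have hax : a ≠ x := fun h => hx.2 h.symm
      simpa [hxl] using ⟨hanti ha hx.1 hax, hanti hx.1 ha hax.symm⟩
    · refine Or.inl ⟨fun x hx => (List.mem_cons.1 (hA hx)).resolve_left ?_, hanti⟩
      rintro rfl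
      exact ha hx
  · rintro (⟨hA, hanti⟩ | ⟨B, ⟨hB, hanti⟩, rfl⟩)
    · exact ⟨fun x hx => List.mem_cons_of_mem a (hA hx), hanti⟩
    · have hB' : ∀ x ∈ B, x ∈ l ∧ ¬ a ≤ x ∧ ¬ x ≤ a := fun x hx => by simpa using hB hx
      refine ⟨?_, hanti.insert (fun x hx _ => (hB' x hx).2.2) fun x hx _ => (hB' x hx).2.1⟩
      rintro x (rfl | hx)
      · exact List.mem_cons_self
      · exact List.mem_cons_of_mem a (hB' x hx).1

theorem ncard_setOf_isAntichain {α : Type*} [LE α] [DecidableLE α] (n : ℕ) (l : List α)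
    (hl : l.Nodup) (hn : l.length ≤ n) :
    {A : Set α | A ⊆ {x | x ∈ l} ∧ IsAntichain (· ≤ ·) A}.ncard = antichainCount n l := by
  have hnil : {A : Set α | A ⊆ {x | x ∈ []} ∧ IsAntichain (· ≤ ·) A} = {∅} := by
    ext A
    suffices A = ∅ → IsAntichain (· ≤ ·) A by simpa [Set.subset_empty_iff]
    rintro rfl
    exact IsAntichain.empty
  have hfin (l : List α) : {A : Set α | A ⊆ {x | x ∈ l} ∧ IsAntichain (· ≤ ·) A}.Finite :=
    l.finite_toSet.finite_subsets.subset fun _ hA => hA.1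
  induction n generalizing l with
  | zero =>
    obtain rfl : l = [] := List.length_eq_zero_iff.1 (Nat.le_zero.1 hn)
    rw [hnil, Set.ncard_singleton, antichainCount]
  | succ n ih =>
    cases l with
    | nil => rw [hnil, Set.ncard_singleton, antichainCount.eq_2 _ (by simp)]
    | cons a l =>
      obtain ⟨ha, hl⟩ := List.nodup_cons.1 hl
      have hn : l.length ≤ n := Nat.le_of_succ_le_succ hn
      have hinj : Set.InjOn (insert a)
          {A : Set α | A ⊆ {x | x ∈ l.filter fun b => ¬ a ≤ b ∧ ¬ b ≤ a} ∧
            IsAntichain (· ≤ ·) A} := by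
        have hmem {A : Set α} (hA : A ⊆ {x | x ∈ l.filter fun b => ¬ a ≤ b ∧ ¬ b ≤ a}) :
            a ∉ A := fun h => ha (List.mem_filter.1 (hA h)).1
        intro A hA B hB hAB
        rw [← Set.insert_sdiff_self_of_notMem (hmem hA.1), hAB,
          Set.insert_sdiff_self_of_notMem (hmem hB.1)]
      rw [setOf_isAntichain_cons, Set.ncard_union_eq _ (hfin _) ((hfin _).image _),
        hinj.ncard_image, ih l hl hn,
        ih _ (hl.filter _) ((List.length_filter_le _ l).trans hn), antichainCount]
      rw [Set.disjoint_left]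
      rintro _ ⟨hA, -⟩ ⟨B, -, rfl⟩
      exact ha (hA (Set.mem_insert a B))

/-- The combination of the simple roots of `E6pos` with the given coefficients. -/
def simpleRootComb : ℕ × ℕ × ℕ × ℕ × ℕ × ℕ → Fin 8 → ℤ
  | (a, b, c, d, e, f) =>
    ![-2 * a + 2 * c - f, 2 * a - 2 * b + 2 * c - f, 2 * b - 2 * d - f, 2 * d - 2 * e - f,
      2 * e - f, f, -f, f]

theorem simpleRootComb_zero : simpleRootComb 0 = 0 := by
  decide

theorem simpleRootComb_add (m n : ℕ × ℕ × ℕ × ℕ × ℕ × ℕ) :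
    simpleRootComb (m + n) = simpleRootComb m + simpleRootComb n := by
  ext i
  fin_cases i <;> simp [simpleRootComb] <;> ring

theorem simpleRootComb_injective : Function.Injective simpleRootComb := by
  rintro ⟨a, b, c, d, e, f⟩ ⟨a', b', c', d', e', f'⟩ h
  have h0 := congrFun h 0
  have h1 := congrFun h 1
  have h2 := congrFun h 2
  have h3 := congrFun h 3
  have h4 := congrFun h 4
  have h5 := congrFun h 5
  simp [simpleRootComb] at h0 h1 h2 h3 h4 h5
  simp only [Prod.mk.injEq]
  omega

/-- The coefficients of the positive roots of `E₆` with respect to the simple roots. -/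
def positiveCoeffs : List (ℕ × ℕ × ℕ × ℕ × ℕ × ℕ) :=
  [(0, 0, 0, 0, 0, 1), (0, 0, 0, 0, 1, 0), (0, 0, 0, 1, 0, 0), (0, 0, 1, 0, 0, 0),
   (0, 1, 0, 0, 0, 0), (1, 0, 0, 0, 0, 0), (0, 0, 0, 1, 1, 0), (0, 0, 1, 0, 0, 1),
   (0, 1, 0, 1, 0, 0), (0, 1, 1, 0, 0, 0), (1, 1, 0, 0, 0, 0), (0, 1, 0, 1, 1, 0),
   (0, 1, 1, 0, 0, 1), (0, 1, 1, 1, 0, 0), (1, 1, 0, 1, 0, 0), (1, 1, 1, 0, 0, 0),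
   (0, 1, 1, 1, 0, 1), (0, 1, 1, 1, 1, 0), (1, 1, 0, 1, 1, 0), (1, 1, 1, 0, 0, 1),
   (1, 1, 1, 1, 0, 0), (0, 1, 1, 1, 1, 1), (1, 1, 1, 1, 0, 1), (1, 1, 1, 1, 1, 0),
   (1, 2, 1, 1, 0, 0), (1, 1, 1, 1, 1, 1), (1, 2, 1, 1, 0, 1), (1, 2, 1, 1, 1, 0),
   (1, 2, 1, 1, 1, 1), (1, 2, 1, 2, 1, 0), (1, 2, 2, 1, 0, 1), (1, 2, 1, 2, 1, 1),
   (1, 2, 2, 1, 1, 1), (1, 2, 2, 2, 1, 1), (1, 3, 2, 2, 1, 1), (2, 3, 2, 2, 1, 1)]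

instance (v : Fin 8 → ℤ) : Decidable (v ∈ E6pos) := by
  unfold E6pos E6roots E8roots
  simp only [Set.mem_ofPred_eq]
  infer_instance

theorem E6pos_eq : E6pos = simpleRootComb '' {n | n ∈ positiveCoeffs} := by
  apply Set.Subset.antisymm
  · intro v hv
    have hsurj_even : ∀ a ∈ [-2, 0, 2], ∀ b ∈ [-2, 0, 2], ∀ c ∈ [-2, 0, 2], ∀ d ∈ [-2, 0, 2],
        ∀ e ∈ [-2, 0, 2], ![a, b, c, d, e, 0, 0, 0] ∈ E6pos →
          ∃ n ∈ positiveCoeffs, simpleRootComb n = ![a, b, c, d, e, 0, 0, 0] := by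
      decide +kernel
    have hsurj_odd : ∀ a ∈ [1, -1], ∀ b ∈ [1, -1], ∀ c ∈ [1, -1], ∀ d ∈ [1, -1],
        ∀ e ∈ [1, -1], ∀ f ∈ [1, -1], ![a, b, c, d, e, f, -f, f] ∈ E6pos →
          ∃ n ∈ positiveCoeffs, simpleRootComb n = ![a, b, c, d, e, f, -f, f] := by
      decide +kernel
    obtain ⟨⟨⟨hsq, hpar⟩, h67, h56⟩, -⟩ := id hv
    have hsix : v 6 = -v 5 := by omega
    have hseven : v 7 = v 5 := by omega
    have hvec : v = ![v 0, v 1, v 2, v 3, v 4, v 5, -v 5, v 5] := by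
      ext i
      fin_cases i <;> simp [hsix, hseven]
    rcases hpar with heven | ⟨hone, -⟩
    · rw [Fin.sum_univ_eight, hsix, hseven] at hsq
      have hfive : v 5 = 0 := by
        obtain ⟨r, hr⟩ := heven 5
        have : r = 0 := by
          by_contra h
          have hr2 : 0 < r ^ 2 := by positivity
          rw [hr] at hsq
          nlinarith [sq_nonneg (v 0), sq_nonneg (v 1), sq_nonneg (v 2), sq_nonneg (v 3),
            sq_nonneg (v 4)]
        omega
      have hmem (x : ℤ) (hx : Even x) (hx8 : x ^ 2 ≤ 8) : x ∈ [-2, 0, 2] := by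
        have h₁ : x < 3 := by nlinarith
        have h₂ : -3 < x := by nlinarith
        obtain ⟨r, rfl⟩ := hx
        simp
        omega
      rw [hfive, neg_zero] at hvec
      rw [hvec] at hv ⊢
      refine hsurj_even _ (hmem _ (heven 0) ?_) _ (hmem _ (heven 1) ?_) _ (hmem _ (heven 2) ?_) _
        (hmem _ (heven 3) ?_) _ (hmem _ (heven 4) ?_) hv <;>
      linarith [sq_nonneg (v 0), sq_nonneg (v 1), sq_nonneg (v 2), sq_nonneg (v 3),
        sq_nonneg (v 4), sq_nonneg (v 5), sq_nonneg (-v 5)]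
    · have hmem (i : Fin 8) : v i ∈ [1, -1] := by simpa using hone i
      rw [hvec] at hv ⊢
      exact hsurj_odd _ (hmem 0) _ (hmem 1) _ (hmem 2) _ (hmem 3) _ (hmem 4) _ (hmem 5) hv
  · have hpos : ∀ n ∈ positiveCoeffs, simpleRootComb n ∈ E6pos := by
      decide +kernel
    rintro _ ⟨n, hn, rfl⟩
    exact hpos n hn

theorem exists_multiset_sum_eq_simpleRootComb (n : ℕ × ℕ × ℕ × ℕ × ℕ × ℕ) :
    ∃ l : Multiset (Fin 8 → ℤ), (∀ x ∈ l, x ∈ E6pos) ∧ simpleRootComb n = l.sum := by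
  obtain ⟨a, b, c, d, e, f⟩ := n
  have hpos : ∀ n ∈ positiveCoeffs, simpleRootComb n ∈ E6pos := fun n hn =>
    E6pos_eq ▸ Set.mem_image_of_mem _ hn
  refine ⟨Multiset.replicate a (simpleRootComb (1, 0, 0, 0, 0, 0)) +
    Multiset.replicate b (simpleRootComb (0, 1, 0, 0, 0, 0)) +
    Multiset.replicate c (simpleRootComb (0, 0, 1, 0, 0, 0)) +
    Multiset.replicate d (simpleRootComb (0, 0, 0, 1, 0, 0)) +
    Multiset.replicate e (simpleRootComb (0, 0, 0, 0, 1, 0)) +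
    Multiset.replicate f (simpleRootComb (0, 0, 0, 0, 0, 1)), fun x hx => ?_, ?_⟩
  · simp only [Multiset.mem_add, Multiset.mem_replicate] at hx
    rcases hx with ((((⟨-, rfl⟩ | ⟨-, rfl⟩) | ⟨-, rfl⟩) | ⟨-, rfl⟩) | ⟨-, rfl⟩) | ⟨-, rfl⟩ <;>
    exact hpos _ (by decide)
  · ext i
    fin_cases i <;> simp [simpleRootComb] <;> ring

theorem rootLe_simpleRootComb_iff (m n : ℕ × ℕ × ℕ × ℕ × ℕ × ℕ) :
    rootLe E6pos (simpleRootComb m) (simpleRootComb n) ↔ m ≤ n := by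
  constructor
  · rintro ⟨l, hl, h⟩
    have hsum : ∃ k, simpleRootComb k = l.sum := by
      refine Multiset.sum_induction (fun x => ∃ k, simpleRootComb k = x) l ?_
        ⟨0, simpleRootComb_zero⟩ fun x hx => ?_
      · rintro _ _ ⟨j, rfl⟩ ⟨k, rfl⟩
        exact ⟨j + k, simpleRootComb_add j k⟩
      · obtain ⟨k, -, hk⟩ := E6pos_eq ▸ hl x hx
        exact ⟨k, hk⟩
    obtain ⟨k, hk⟩ := hsum
    rw [← hk, ← simpleRootComb_add] at h
    exact le_iff_exists_add.2 ⟨k, simpleRootComb_injective h⟩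
  · intro h
    obtain ⟨k, rfl⟩ := le_iff_exists_add.1 h
    obtain ⟨l, hl, hk⟩ := exists_multiset_sum_eq_simpleRootComb k
    exact ⟨l, hl, by rw [simpleRootComb_add, hk]⟩

theorem isAntichain_image_simpleRootComb (B : Set (ℕ × ℕ × ℕ × ℕ × ℕ × ℕ)) :
    IsAntichain (rootLe E6pos) (simpleRootComb '' B) ↔ IsAntichain (· ≤ ·) B := by
  constructor
  · intro h m hm n hn hmn hle
    exact h (Set.mem_image_of_mem _ hm) (Set.mem_image_of_mem _ hn)
      (simpleRootComb_injective.ne hmn) ((rootLe_simpleRootComb_iff m n).2 hle)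
  · rintro h _ ⟨m, hm, rfl⟩ _ ⟨n, hn, rfl⟩ hmn hle
    exact h hm hn (fun h => hmn (congrArg _ h)) ((rootLe_simpleRootComb_iff m n).1 hle)

/-- In the root system of type `E₆`, the number of antichains of the poset of
positive roots `(Δ⁺, ≤)`, where `α ≤ β` iff `β − α` is a sum of positive roots, is `833`;
equivalently, the Borel subalgebra of the simple Lie algebra of type `E₆` has exactly `833`
ad-nilpotent ideals. -/
theorem stmt9 :
    {A : Set (Fin 8 → ℤ) | A ⊆ E6pos ∧ IsAntichain (rootLe E6pos) A}.ncard = 833 := by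
  have himage : {A : Set (Fin 8 → ℤ) | A ⊆ E6pos ∧ IsAntichain (rootLe E6pos) A} =
      Set.image simpleRootComb ''
        {B | B ⊆ {n | n ∈ positiveCoeffs} ∧ IsAntichain (· ≤ ·) B} := by
    ext A
    constructor
    · rintro ⟨hA, hanti⟩
      rw [E6pos_eq, Set.subset_image_iff] at hA
      obtain ⟨B, hB, rfl⟩ := hA
      exact ⟨B, ⟨hB, (isAntichain_image_simpleRootComb B).1 hanti⟩, rfl⟩
    · rintro ⟨B, ⟨hB, hanti⟩, rfl⟩
      exact ⟨E6pos_eq ▸ Set.image_mono hB, (isAntichain_image_simpleRootComb B).2 hanti⟩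
  rw [himage, Set.ncard_image_of_injective _ simpleRootComb_injective.image_injective,
    ncard_setOf_isAntichain 36 positiveCoeffs (by decide +kernel) (by decide)]
  decide +kernel
end

section
/- In the root system of type E₇, the number of antichains of the poset of positive roots (Δ⁺, ≤), where α ≤ β iff β − α is a sum of positive roots, is 4160; equivalently, the Borel subalgebra of the simple Lie algebra of type E₇ has exactly 4160 ad-nilpotent ideals. -/
/-- The root system of type `E₇`, realized as the subsystem of `E₈` orthogonal to the root
`2e₆ + 2e₇`. -/
def E7roots : Set (Fin 8 → ℤ) :=
  {v | v ∈ E8roots ∧ v 6 + v 7 = 0}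

/-- A system of positive roots for `E₇`: the roots on which the (generic) linear functional
`v ↦ ∑ i, 2 ^ i * v i` is positive. -/
def E7pos : Set (Fin 8 → ℤ) :=
  {v | v ∈ E7roots ∧ 0 < ∑ i : Fin 8, 2 ^ i.val * v i}

/-- The number of antichains contained in a duplicate-free list of length at most `n`. -/
def countAntichains {α : Type*} [LE α] [DecidableLE α] : ℕ → List α → ℕ
  | 0, _ => 1
  | _ + 1, [] => 1
  | n + 1, x :: l =>
    countAntichains n l + countAntichains n (l.filter fun y => !decide (x ≤ y) && !decide (y ≤ x))

/-- Splitting the antichains of `insert x s` according to whether they contain `x`. -/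
theorem setOf_antichain_insert {α : Type*} [LE α] {s : Set α} {x : α} :
    {A : Set α | A ⊆ insert x s ∧ IsAntichain (· ≤ ·) A} =
      {A | A ⊆ s ∧ IsAntichain (· ≤ ·) A} ∪
        insert x '' {A | A ⊆ {y ∈ s | ¬x ≤ y ∧ ¬y ≤ x} ∧ IsAntichain (· ≤ ·) A} := by
  ext A
  simp only [Set.mem_ofPred_eq, Set.mem_union, Set.mem_image]
  constructor
  · rintro ⟨hA, hanti⟩
    by_cases hx : x ∈ A
    · refine .inr ⟨A \ {x}, ⟨fun y hy => ?_, hanti.subset Set.sdiff_subset⟩, by simp [hx]⟩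
      have hyx : y ≠ x := hy.2
      exact ⟨(hA hy.1).resolve_left hyx, hanti hx hy.1 hyx.symm, hanti hy.1 hx hyx⟩
    · exact .inl ⟨(Set.subset_insert_iff_of_notMem hx).1 hA, hanti⟩
  · rintro (⟨hA, hanti⟩ | ⟨B, ⟨hB, hanti⟩, rfl⟩)
    · exact ⟨hA.trans (Set.subset_insert x s), hanti⟩
    · refine ⟨Set.insert_subset_insert fun y hy => (hB hy).1, ?_⟩
      exact hanti.insert (fun y hy _ => (hB hy).2.2) fun y hy _ => (hB hy).2.1

theorem ncard_antichains_eq_countAntichains {α : Type*} [LE α] [DecidableLE α] (n : ℕ) :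
    ∀ l : List α, l.Nodup → l.length ≤ n →
      {A : Set α | A ⊆ {x | x ∈ l} ∧ IsAntichain (· ≤ ·) A}.ncard = countAntichains n l := by
  have nil : {A : Set α | A ⊆ {x | x ∈ ([] : List α)} ∧ IsAntichain (· ≤ ·) A} = {∅} := by
    ext A
    simp +contextual [Set.subset_empty_iff]
  induction n with
  | zero =>
    intro l _ hl
    rw [List.length_eq_zero_iff.1 (Nat.le_zero.1 hl), nil]
    simp [countAntichains]
  | succ n ih =>
    rintro (_ | ⟨x, l⟩) hnd hl
    · rw [nil]
      simp [countAntichains]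
    obtain ⟨hx, hnd⟩ := List.nodup_cons.1 hnd
    have hl : l.length ≤ n := Nat.le_of_succ_le_succ hl
    have hfin (s : Set α) (hs : s ⊆ {y | y ∈ l}) :
        {A : Set α | A ⊆ s ∧ IsAntichain (· ≤ ·) A}.Finite :=
      ((l.finite_toSet.subset hs).finite_subsets).subset fun _ h => h.1
    have hcons : {y | y ∈ x :: l} = insert x {y | y ∈ l} := by
      ext y
      simp
    have hfilter : {y ∈ {y | y ∈ l} | ¬x ≤ y ∧ ¬y ≤ x} =
        {y | y ∈ l.filter fun y => !decide (x ≤ y) && !decide (y ≤ x)} := by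
      ext y
      simp
    have hdisj : Disjoint {A : Set α | A ⊆ {y | y ∈ l} ∧ IsAntichain (· ≤ ·) A}
        (insert x '' {A | A ⊆ {y ∈ {y | y ∈ l} | ¬x ≤ y ∧ ¬y ≤ x} ∧
          IsAntichain (· ≤ ·) A}) := by
      rw [Set.disjoint_left]
      rintro _ ⟨hA, -⟩ ⟨B, -, rfl⟩
      exact hx (hA (Set.mem_insert x B))
    rw [hcons, setOf_antichain_insert, Set.ncard_union_eq hdisj (hfin _ subset_rfl)
      ((hfin _ (Set.sep_subset _ _)).image _), Set.InjOn.ncard_image, hfilter,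
      ih l hnd hl, ih _ (hnd.filter _) ((List.length_filter_le _ _).trans hl), countAntichains]
    rintro A ⟨hA, -⟩ B ⟨hB, -⟩ h
    have hxA : x ∉ A := fun h => hx (hA h).1
    have hxB : x ∉ B := fun h => hx (hB h).1
    rw [← Set.insert_sdiff_self_of_notMem hxA, ← Set.insert_sdiff_self_of_notMem hxB, h]

/-- Coordinates of an element of the root lattice of `E₇` with respect to the simple roots. -/
abbrev E7Coord : Type := ℕ × ℕ × ℕ × ℕ × ℕ × ℕ × ℕ

/-- The nonnegative combination of the simple roots of `E7pos` with given coefficients. -/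
def E7comb : E7Coord → Fin 8 → ℤ
  | (a, b, c, d, e, f, g) =>
    a • ![-2, 2, 0, 0, 0, 0, 0, 0] + b • ![0, -2, 2, 0, 0, 0, 0, 0] +
    c • ![0, 0, -2, 2, 0, 0, 0, 0] + d • ![0, 0, 0, -2, 2, 0, 0, 0] +
    e • ![0, 0, 0, 0, -2, 2, 0, 0] + f • ![1, -1, -1, -1, -1, -1, -1, 1] +
    g • ![2, 2, 0, 0, 0, 0, 0, 0]

theorem E7comb_add (x y : E7Coord) : E7comb (x + y) = E7comb x + E7comb y := by
  obtain ⟨a, b, c, d, e, f, g⟩ := x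
  obtain ⟨a', b', c', d', e', f', g'⟩ := y
  simp only [E7comb, add_smul]
  abel

theorem E7comb_injective : Function.Injective E7comb := by
  rintro ⟨a, b, c, d, e, f, g⟩ ⟨a', b', c', d', e', f', g'⟩ h
  have h0 := congrFun h 0
  have h1 := congrFun h 1
  have h2 := congrFun h 2
  have h3 := congrFun h 3
  have h4 := congrFun h 4
  have h5 := congrFun h 5
  have h6 := congrFun h 6
  simp [E7comb] at h0 h1 h2 h3 h4 h5 h6
  simp only [Prod.mk.injEq]
  omega

/-- The coordinates of the positive roots of `E₇`, by increasing height. -/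
def E7posCoords : List E7Coord :=
  [(0, 0, 0, 0, 0, 0, 1), (0, 0, 0, 0, 0, 1, 0), (0, 0, 0, 0, 1, 0, 0), (0, 0, 0, 1, 0, 0, 0),
   (0, 0, 1, 0, 0, 0, 0), (0, 1, 0, 0, 0, 0, 0), (1, 0, 0, 0, 0, 0, 0), (0, 0, 0, 1, 1, 0, 0),
   (0, 0, 1, 1, 0, 0, 0), (0, 1, 0, 0, 0, 0, 1), (0, 1, 1, 0, 0, 0, 0), (1, 0, 0, 0, 0, 1, 0),
   (1, 1, 0, 0, 0, 0, 0), (0, 0, 1, 1, 1, 0, 0), (0, 1, 1, 0, 0, 0, 1), (0, 1, 1, 1, 0, 0, 0),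
   (1, 1, 0, 0, 0, 0, 1), (1, 1, 0, 0, 0, 1, 0), (1, 1, 1, 0, 0, 0, 0), (0, 1, 1, 1, 0, 0, 1),
   (0, 1, 1, 1, 1, 0, 0), (1, 1, 0, 0, 0, 1, 1), (1, 1, 1, 0, 0, 0, 1), (1, 1, 1, 0, 0, 1, 0),
   (1, 1, 1, 1, 0, 0, 0), (0, 1, 1, 1, 1, 0, 1), (1, 1, 1, 0, 0, 1, 1), (1, 1, 1, 1, 0, 0, 1),
   (1, 1, 1, 1, 0, 1, 0), (1, 1, 1, 1, 1, 0, 0), (1, 2, 1, 0, 0, 0, 1), (1, 1, 1, 1, 0, 1, 1),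
   (1, 1, 1, 1, 1, 0, 1), (1, 1, 1, 1, 1, 1, 0), (1, 2, 1, 0, 0, 1, 1), (1, 2, 1, 1, 0, 0, 1),
   (1, 1, 1, 1, 1, 1, 1), (1, 2, 1, 1, 0, 1, 1), (1, 2, 1, 1, 1, 0, 1), (1, 2, 2, 1, 0, 0, 1),
   (2, 2, 1, 0, 0, 1, 1), (1, 2, 1, 1, 1, 1, 1), (1, 2, 2, 1, 0, 1, 1), (1, 2, 2, 1, 1, 0, 1),
   (2, 2, 1, 1, 0, 1, 1), (1, 2, 2, 1, 1, 1, 1), (1, 2, 2, 2, 1, 0, 1), (2, 2, 1, 1, 1, 1, 1),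
   (2, 2, 2, 1, 0, 1, 1), (1, 2, 2, 2, 1, 1, 1), (2, 2, 2, 1, 1, 1, 1), (2, 3, 2, 1, 0, 1, 1),
   (2, 2, 2, 2, 1, 1, 1), (2, 3, 2, 1, 0, 1, 2), (2, 3, 2, 1, 1, 1, 1), (2, 3, 2, 1, 1, 1, 2),
   (2, 3, 2, 2, 1, 1, 1), (2, 3, 2, 2, 1, 1, 2), (2, 3, 3, 2, 1, 1, 1), (2, 3, 3, 2, 1, 1, 2),
   (2, 4, 3, 2, 1, 1, 2), (3, 4, 3, 2, 1, 1, 2), (3, 4, 3, 2, 1, 2, 2)]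

set_option synthInstance.maxSize 1000 in
theorem E7posCoords_nodup : E7posCoords.Nodup := by
  decide +kernel

instance (v : Fin 8 → ℤ) : Decidable (v ∈ E7pos) :=
  inferInstanceAs (Decidable ((((∑ i, v i ^ 2 = 8) ∧
    ((∀ i, Even (v i)) ∨
      ((∀ i, v i = 1 ∨ v i = -1) ∧
        Even (Finset.univ.filter (fun i => v i = -1)).card))) ∧ v 6 + v 7 = 0) ∧
    0 < ∑ i : Fin 8, 2 ^ i.val * v i))

theorem E7comb_mem_E7pos : ∀ x ∈ E7posCoords, E7comb x ∈ E7pos := by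
  decide +kernel

theorem mem_of_mem_E7pos_of_even :
    ∀ a ∈ [-2, 0, 2], ∀ b ∈ [-2, 0, 2], ∀ c ∈ [-2, 0, 2], ∀ d ∈ [-2, 0, 2], ∀ e ∈ [-2, 0, 2],
    ∀ f ∈ [-2, 0, 2], ∀ g ∈ [-2, 0, 2],
      a * a + b * b + c * c + d * d + e * e + f * f + 2 * (g * g) = 8 →
      ![a, b, c, d, e, f, g, -g] ∈ E7pos →
      ![a, b, c, d, e, f, g, -g] ∈ E7posCoords.map E7comb := by
  decide +kernel

theorem mem_of_mem_E7pos_of_odd :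
    ∀ a ∈ [1, -1], ∀ b ∈ [1, -1], ∀ c ∈ [1, -1], ∀ d ∈ [1, -1], ∀ e ∈ [1, -1],
    ∀ f ∈ [1, -1], ∀ g ∈ [1, -1], ![a, b, c, d, e, f, g, -g] ∈ E7pos →
      ![a, b, c, d, e, f, g, -g] ∈ E7posCoords.map E7comb := by
  decide +kernel

theorem E7pos_eq_image : E7pos = E7comb '' {x | x ∈ E7posCoords} := by
  refine Set.Subset.antisymm (fun v hv => ?_) (Set.image_subset_iff.2 E7comb_mem_E7pos)
  obtain ⟨⟨⟨hsq, hpar⟩, h67⟩, -⟩ := id hv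
  have hvec : v = ![v 0, v 1, v 2, v 3, v 4, v 5, v 6, -v 6] := by
    ext i
    fin_cases i <;> simp
    omega
  suffices v ∈ E7posCoords.map E7comb by simpa using this
  rw [hvec] at hv ⊢
  rcases hpar with hpar | ⟨hpar, -⟩
  · have hmem (i : Fin 8) : v i ∈ [-2, 0, 2] := by
      have hi : v i ^ 2 ≤ 8 :=
        hsq ▸ Finset.single_le_sum (fun j _ => sq_nonneg (v j)) (Finset.mem_univ i)
      have hlt : v i < 3 := by nlinarith
      have hgt : -3 < v i := by nlinarith
      obtain ⟨k, hk⟩ := hpar i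
      simp only [List.mem_cons, List.not_mem_nil, or_false]
      omega
    have hsum : v 0 * v 0 + v 1 * v 1 + v 2 * v 2 + v 3 * v 3 + v 4 * v 4 + v 5 * v 5 +
        2 * (v 6 * v 6) = 8 := by
      rw [Fin.sum_univ_eight, show v 7 = -v 6 by omega] at hsq
      linarith
    exact mem_of_mem_E7pos_of_even _ (hmem 0) _ (hmem 1) _ (hmem 2) _ (hmem 3) _ (hmem 4)
      _ (hmem 5) _ (hmem 6) hsum hv
  · have hmem (i : Fin 8) : v i ∈ [1, -1] := by simpa using hpar i
    exact mem_of_mem_E7pos_of_odd _ (hmem 0) _ (hmem 1) _ (hmem 2) _ (hmem 3) _ (hmem 4)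
      _ (hmem 5) _ (hmem 6) hv

theorem rootLe_iff_exists_mem_closure {pos : Set (Fin 8 → ℤ)} {v w : Fin 8 → ℤ} :
    rootLe pos v w ↔ ∃ s ∈ AddSubmonoid.closure pos, w = v + s := by
  constructor
  · rintro ⟨l, hl, rfl⟩
    exact ⟨l.sum, AddSubmonoid.multiset_sum_mem _ _ fun x hx =>
      AddSubmonoid.subset_closure (hl x hx), rfl⟩
  · rintro ⟨s, hs, rfl⟩
    obtain ⟨l, hl, rfl⟩ := AddSubmonoid.exists_multiset_of_mem_closure hs
    exact ⟨l, hl, rfl⟩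

theorem mem_closure_E7pos_iff {v : Fin 8 → ℤ} :
    v ∈ AddSubmonoid.closure E7pos ↔ v ∈ Set.range E7comb := by
  constructor
  · intro hv
    induction hv using AddSubmonoid.closure_induction with
    | mem v hv =>
      rw [E7pos_eq_image] at hv
      exact Set.image_subset_range _ _ hv
    | zero => exact ⟨0, by decide⟩
    | add _ _ _ _ hv hw =>
      obtain ⟨x, rfl⟩ := hv
      obtain ⟨y, rfl⟩ := hw
      exact ⟨x + y, E7comb_add x y⟩
  · rintro ⟨⟨a, b, c, d, e, f, g⟩, rfl⟩
    have hnsmul {w : Fin 8 → ℤ} (n : ℕ) (hw : w ∈ E7pos) : n • w ∈ AddSubmonoid.closure E7pos :=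
      nsmul_mem (AddSubmonoid.subset_closure hw) n
    refine add_mem (add_mem (add_mem (add_mem (add_mem (add_mem ?_ ?_) ?_) ?_) ?_) ?_) ?_ <;>
      exact hnsmul _ (by decide +kernel)

theorem rootLe_E7comb_iff {x y : E7Coord} : rootLe E7pos (E7comb x) (E7comb y) ↔ x ≤ y := by
  simp only [rootLe_iff_exists_mem_closure, mem_closure_E7pos_iff, Set.exists_range_iff,
    ← E7comb_add, E7comb_injective.eq_iff, le_iff_exists_add]

/-- In the root system of type `E₇`, the number of antichains of the poset of
positive roots `(Δ⁺, ≤)`, where `α ≤ β` iff `β − α` is a sum of positive roots, is `4160`;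
equivalently, the Borel subalgebra of the simple Lie algebra of type `E₇` has exactly `4160`
ad-nilpotent ideals. -/
theorem stmt10 :
    {A : Set (Fin 8 → ℤ) | A ⊆ E7pos ∧ IsAntichain (rootLe E7pos) A}.ncard = 4160 := by
  have himage : {A : Set (Fin 8 → ℤ) | A ⊆ E7pos ∧ IsAntichain (rootLe E7pos) A} =
      Set.image E7comb ''
        {A : Set E7Coord | A ⊆ {x | x ∈ E7posCoords} ∧ IsAntichain (· ≤ ·) A} := by
    have hanti (A : Set E7Coord) :
        IsAntichain (rootLe E7pos) (E7comb '' A) ↔ IsAntichain (· ≤ ·) A := by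
      simp only [IsAntichain, E7comb_injective.injOn.pairwise_image]
      simp [Set.Pairwise, Function.onFun, rootLe_E7comb_iff]
    ext A
    constructor
    · rintro ⟨hA, h⟩
      rw [E7pos_eq_image] at hA
      obtain ⟨B, hB, rfl⟩ := Set.subset_image_iff.1 hA
      exact ⟨B, ⟨hB, (hanti B).1 h⟩, rfl⟩
    · rintro ⟨B, ⟨hB, h⟩, rfl⟩
      exact ⟨E7pos_eq_image ▸ Set.image_mono hB, (hanti B).2 h⟩
  rw [himage, Set.ncard_image_of_injective _ E7comb_injective.image_injective,
    ncard_antichains_eq_countAntichains 63 E7posCoords E7posCoords_nodup (by decide)]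
  decide +kernel
end

section
/- In the root system of type E₈, the number of antichains of the poset of positive roots (Δ⁺, ≤), where α ≤ β iff β − α is a sum of positive roots, is 25080; equivalently, the Borel subalgebra of the simple Lie algebra of type E₈ has exactly 25080 ad-nilpotent ideals. -/
/-- A system of positive roots for `E₈`: the roots on which the (generic) linear functional
`v ↦ ∑ i, 2 ^ i * v i` is positive. -/
def E8pos : Set (Fin 8 → ℤ) :=
  {v | v ∈ E8roots ∧ 0 < ∑ i : Fin 8, 2 ^ i.val * v i}

namespace E8

/-- The simple roots of the positive system `E8pos`, in Bourbaki's numbering. -/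
def simple : Fin 8 → Fin 8 → ℤ :=
  ![![1, -1, -1, -1, -1, -1, -1, 1],
    ![2, 2, 0, 0, 0, 0, 0, 0],
    ![-2, 2, 0, 0, 0, 0, 0, 0],
    ![0, -2, 2, 0, 0, 0, 0, 0],
    ![0, 0, -2, 2, 0, 0, 0, 0],
    ![0, 0, 0, -2, 2, 0, 0, 0],
    ![0, 0, 0, 0, -2, 2, 0, 0],
    ![0, 0, 0, 0, 0, -2, 2, 0]]

/-- Four times the dual basis of `simple`. -/
def coweight : Fin 8 → Fin 8 → ℤ :=
  ![![0, 0, 0, 0, 0, 0, 0, 4],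
    ![1, 1, 1, 1, 1, 1, 1, 5],
    ![-1, 1, 1, 1, 1, 1, 1, 7],
    ![0, 0, 2, 2, 2, 2, 2, 10],
    ![0, 0, 0, 2, 2, 2, 2, 8],
    ![0, 0, 0, 0, 2, 2, 2, 6],
    ![0, 0, 0, 0, 0, 2, 2, 4],
    ![0, 0, 0, 0, 0, 0, 2, 2]]

/-- The vector with coefficients `c` in the basis of simple roots. -/
def comb (c : Fin 8 → ℕ) : Fin 8 → ℤ := ∑ k, c k • simple k

/-- The coefficient vector whose entries are the decimal digits of `n`. -/
def digits (n : ℕ) : Fin 8 → ℕ := fun k => n / 10 ^ k.val % 10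

/-- The positive roots of `E₈`, by increasing height; the decimal digits of an entry are the
coefficients of a root in the basis of simple roots. -/
def codes : List ℕ :=
  [10000000, 1000000, 100000, 10000, 1000, 100, 10, 1, 11000000, 1100000, 110000, 11000, 1100,
   1010, 101, 11100000, 1110000, 111000, 11100, 11010, 1110, 1101, 11110000, 1111000, 111100,
   111010, 11110, 11101, 1111, 11111000, 1111100, 1111010, 111110, 12110, 111101, 11111,
   11111100, 11111010, 1111110, 112110, 1111101, 111111, 12111, 11111110, 1112110, 122110,
   11111101, 1111111, 112111, 12211, 11112110, 1122110, 11111111, 1112111, 122111, 112211,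
   11122110, 1222110, 11112111, 1122111, 1112211, 122211, 11222110, 11122111, 1222111, 11112211,
   1122211, 123211, 12222110, 11222111, 11122211, 1222211, 1123211, 123221, 12222111, 11222211,
   11123211, 1223211, 1123221, 12222211, 11223211, 1233211, 11123221, 1223221, 12223211,
   11233211, 11223221, 1233221, 12233211, 12223221, 11233221, 1234221, 12333211, 12233221,
   11234221, 1234321, 12333221, 12234221, 11234321, 1234322, 12334221, 12234321, 11234322,
   12344221, 12334321, 12234322, 12344321, 12334322, 12345321, 12344322, 12345331, 12345322,
   12345422, 12345332, 12345432, 12346432, 12356432, 12456432, 13456432, 23456432]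

/-- The code of the vector `v`, if `v` is a positive root. -/
def code (v : Fin 8 → ℤ) : ℕ := ∑ k, 10 ^ k.val * ((∑ i, coweight k i * v i) / 4).toNat

/-- Comparability of the coefficient vectors encoded by `a` and `b`. -/
def compB (a b : ℕ) : Bool :=
  decide (∀ k, digits a k ≤ digits b k) || decide (∀ k, digits b k ≤ digits a k)

/-- The number whose `i`-th bit tells whether the `i`-th entry of the list satisfies `p`. -/
def mask {α : Type*} (p : α → Bool) : List α → ℕ
  | [] => 0
  | x :: L => (p x).toNat + 2 * mask p L

/-- For each entry of the list, the mask of the later entries related to it by `r`. -/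
def masks {α : Type*} (r : α → α → Bool) : List α → List ℕ
  | [] => []
  | x :: L => mask (r x) L :: masks r L

/-- The number of cliques among the entries selected by the bits of `m`, for a graph given by
its `masks`. -/
def count : List ℕ → ℕ → ℕ
  | [], _ => 1
  | p :: ps, m =>
    match m with
    | 0 => 1
    | k + 1 =>
      bif Nat.beq ((k + 1) % 2) 0 then count ps ((k + 1) / 2)
      else count ps ((k + 1) / 2) + count ps (Nat.land ((k + 1) / 2) p)

theorem count_codes :
    count (masks (fun a b => !compB a b) codes) (mask (fun _ => true) codes) = 25080 := by
  decide +kernel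

section Cliques

variable {α : Type*}

/-- The sublist of `L` selected by the bits of `m`. -/
def select : List α → ℕ → List α
  | [], _ => []
  | x :: L, m => if m % 2 = 0 then select L (m / 2) else x :: select L (m / 2)

theorem select_sublist (L : List α) (m : ℕ) : (select L m).Sublist L := by
  induction L generalizing m with
  | nil => exact List.Sublist.slnil
  | cons x L ih =>
    rw [select]
    split_ifs
    · exact (ih _).cons x
    · exact (ih _).cons_cons x

theorem select_mask_true (L : List α) : select L (mask (fun _ => true) L) = L := by
  induction L with
  | nil => rfl
  | cons x L ih =>
    have h1 : (1 + 2 * mask (fun _ => true) L) % 2 ≠ 0 := by omega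
    have h2 : (1 + 2 * mask (fun _ => true) L) / 2 = mask (fun _ => true) L := by omega
    simp only [mask, select, Bool.toNat_true, h1, h2, ih, if_false]

theorem select_land_mask (p : α → Bool) (L : List α) (m : ℕ) :
    select L (m &&& mask p L) = (select L m).filter p := by
  induction L generalizing m with
  | nil => rfl
  | cons x L ih =>
    have hd : (m &&& mask p (x :: L)) / 2 = m / 2 &&& mask p L := by
      rw [Nat.and_div_two, mask]
      congr 1
      cases p x
      · simp
      · simp
        omega
    have hm : (m &&& mask p (x :: L)) % 2 = m % 2 &&& (p x).toNat := by
      rw [Nat.and_mod_two_pow (n := 1), mask]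
      congr 1
      cases p x <;> simp
    simp only [select, hd, hm, ih]
    rcases Nat.mod_two_eq_zero_or_one m with h | h <;> cases hp : p x <;> simp [h, hp]

theorem count_zero (ps : List ℕ) : count ps 0 = 1 := by
  cases ps <;> rfl

theorem count_cons (p : ℕ) (ps : List ℕ) (m : ℕ) :
    count (p :: ps) m =
      if m % 2 = 0 then count ps (m / 2) else count ps (m / 2) + count ps (m / 2 &&& p) := by
  cases m with
  | zero => simp [count_zero]
  | succ k =>
    rw [count]
    rcases Nat.mod_two_eq_zero_or_one (k + 1) with h | h
    · simp [h]
    · simp only [h]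
      rfl

/-- The sets of entries of `K` that are cliques for the relation `r`. -/
def cliques (r : α → α → Bool) (K : List α) : Set (Set α) :=
  {s | s ⊆ {x | x ∈ K} ∧ s.Pairwise fun a b => r a b}

theorem finite_cliques (r : α → α → Bool) (K : List α) : (cliques r K).Finite :=
  (K.finite_toSet.powerset).subset fun _ hs => hs.1

theorem ncard_cliques_cons {r : α → α → Bool} (hr : ∀ a b, r a b = r b a) {x : α} {K : List α}
    (hx : x ∉ K) :
    (cliques r (x :: K)).ncard = (cliques r K).ncard + (cliques r (K.filter (r x))).ncard := by
  have : Std.Symm fun a b => (r a b : Prop) := ⟨fun a b h => by simpa [hr b a] using h⟩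
  have hnot : ∀ s ∈ cliques r (K.filter (r x)), x ∉ s := fun s hs h =>
    hx (List.mem_of_mem_filter (hs.1 h))
  have key : cliques r (x :: K) = cliques r K ∪ insert x '' cliques r (K.filter (r x)) := by
    ext s
    constructor
    · rintro ⟨hs, hp⟩
      by_cases hxs : x ∈ s
      · refine Or.inr ⟨s \ {x}, ⟨fun y hy => ?_, hp.mono Set.sdiff_subset⟩, by simp [hxs]⟩
        have hyx : y ≠ x := hy.2
        exact List.mem_filter.2
          ⟨(List.mem_cons.1 (hs hy.1)).resolve_left hyx, hp hxs hy.1 hyx.symm⟩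
      · refine Or.inl ⟨fun y hy => (List.mem_cons.1 (hs hy)).resolve_left ?_, hp⟩
        rintro rfl
        exact hxs hy
    · rintro (⟨hs, hp⟩ | ⟨t, ⟨ht, hp⟩, rfl⟩)
      · exact ⟨fun y hy => List.mem_cons_of_mem _ (hs hy), hp⟩
      · refine ⟨Set.insert_subset List.mem_cons_self fun y hy =>
          List.mem_cons_of_mem _ (List.mem_of_mem_filter (ht hy)), ?_⟩
        exact Set.pairwise_insert_of_symm.2
          ⟨hp, fun y hy _ => (List.mem_filter.1 (ht hy)).2⟩
  have hdisj : Disjoint (cliques r K) (insert x '' cliques r (K.filter (r x))) := by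
    rw [Set.disjoint_left]
    rintro _ hs ⟨t, -, rfl⟩
    exact hx (hs.1 (Set.mem_insert x t))
  have hinj : Set.InjOn (insert x) (cliques r (K.filter (r x))) := fun s hs t ht h => by
    rw [← Set.insert_sdiff_self_of_notMem (hnot s hs), h,
      Set.insert_sdiff_self_of_notMem (hnot t ht)]
  rw [key, Set.ncard_union_eq hdisj (finite_cliques r K) ((finite_cliques r _).image _),
    hinj.ncard_image]

theorem ncard_cliques_select {r : α → α → Bool} (hr : ∀ a b, r a b = r b a) {L : List α}
    (hL : L.Nodup) (m : ℕ) : (cliques r (select L m)).ncard = count (masks r L) m := by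
  induction L generalizing m with
  | nil =>
    have : cliques r [] = {∅} := by
      ext s
      simp only [cliques, List.not_mem_nil, Set.ofPred_false, Set.subset_empty_iff,
        Set.mem_ofPred_eq, Set.mem_singleton_iff, and_iff_left_iff_imp]
      rintro rfl
      exact Set.pairwise_empty _
    simp [select, this, masks, count]
  | cons x L ih =>
    obtain ⟨hx, hL⟩ := List.nodup_cons.1 hL
    rw [masks, count_cons, select]
    split_ifs
    · exact ih hL _
    · rw [ncard_cliques_cons hr fun h => hx ((select_sublist L _).subset h), ← select_land_mask,
        ih hL, ih hL]

end Cliques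

theorem comb_add (c d : Fin 8 → ℕ) : comb (c + d) = comb c + comb d := by
  simp only [comb, Pi.add_apply, add_smul, Finset.sum_add_distrib]

theorem sum_coweight_mul_comb (c : Fin 8 → ℕ) (j : Fin 8) :
    ∑ i, coweight j i * comb c i = 4 * c j := by
  have h : ∀ k, ∑ i, coweight j i * simple k i = if k = j then 4 else 0 := by
    revert j
    decide +kernel
  calc ∑ i, coweight j i * comb c i = ∑ k, c k * ∑ i, coweight j i * simple k i := by
        simp only [comb, Finset.sum_apply, Pi.smul_apply, Finset.mul_sum]
        rw [Finset.sum_comm]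
        simp only [nsmul_eq_mul, mul_left_comm]
    _ = 4 * c j := by simp [h, mul_comm]

theorem comb_injective : Function.Injective comb := by
  intro c d h
  ext j
  have hc := sum_coweight_mul_comb c j
  rw [h, sum_coweight_mul_comb] at hc
  omega

theorem comb_digits_mem {n : ℕ} (hn : n ∈ codes) : comb (digits n) ∈ E8pos := by
  have h : ∀ n ∈ codes, (∑ i, comb (digits n) i ^ 2 = 8 ∧
      ((∀ i, Even (comb (digits n) i)) ∨ ((∀ i, comb (digits n) i = 1 ∨ comb (digits n) i = -1) ∧
        Even (Finset.univ.filter fun i => comb (digits n) i = -1).card))) ∧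
      0 < ∑ i : Fin 8, 2 ^ i.val * comb (digits n) i := by
    decide +kernel
  exact h n hn

theorem eq_single_add_single {v : Fin 8 → ℤ} (h8 : ∑ i, v i ^ 2 = 8) (hev : ∀ i, Even (v i)) :
    ∃ i j, ∃ a ∈ [2, -2], ∃ b ∈ [2, -2], i ≠ j ∧ v = Pi.single i a + Pi.single j b := by
  have hv : ∀ i, v i ^ 2 = if v i = 0 then 0 else 4 := by
    intro i
    have hle : v i ^ 2 ≤ 8 := h8 ▸ Finset.single_le_sum (f := fun i => v i ^ 2)
      (fun i _ => sq_nonneg (v i)) (Finset.mem_univ i)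
    obtain ⟨k, hk⟩ := hev i
    have h1 : -2 < k := by nlinarith
    have h2 : k < 2 := by nlinarith
    rw [hk]
    interval_cases k <;> simp
  have hcard : (Finset.univ.filter fun i => v i ≠ 0).card = 2 := by
    simp only [hv, Finset.sum_ite, Finset.sum_const_zero, Finset.sum_const, zero_add] at h8
    simp only [nsmul_eq_mul] at h8
    have : ((Finset.univ.filter fun i => ¬ v i = 0).card : ℤ) = 2 := by linarith
    exact_mod_cast this
  obtain ⟨i, j, hij, hs⟩ := Finset.card_eq_two.1 hcard
  have hmem : ∀ k, v k ≠ 0 ↔ k = i ∨ k = j := fun k => by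
    simpa using Finset.ext_iff.1 hs k
  have hval : ∀ k, v k ≠ 0 → v k ∈ [2, -2] := fun k hk => by
    have := hv k
    rw [if_neg hk, show (4 : ℤ) = 2 ^ 2 by norm_num, sq_eq_sq_iff_eq_or_eq_neg] at this
    simpa using this
  refine ⟨i, j, v i, hval i ((hmem i).2 (Or.inl rfl)), v j, hval j ((hmem j).2 (Or.inr rfl)),
    hij, ?_⟩
  ext k
  by_cases hi : k = i
  · subst hi
    simp [hij]
  · by_cases hj : k = j
    · subst hj
      simp [hi]
    · simpa [hi, hj] using (hmem k).not.2 (by simp [hi, hj])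

theorem exists_code {v : Fin 8 → ℤ} (hv : v ∈ E8pos) : ∃ n ∈ codes, comb (digits n) = v := by
  obtain ⟨⟨h8, hev | ⟨h1, hodd⟩⟩, hpos⟩ := hv
  · obtain ⟨i, j, a, ha, b, hb, hij, rfl⟩ := eq_single_add_single h8 hev
    have h : ∀ i j : Fin 8, ∀ a ∈ [(2 : ℤ), -2], ∀ b ∈ [(2 : ℤ), -2], i ≠ j →
        0 < ∑ k : Fin 8, 2 ^ k.val * (Pi.single i a + Pi.single j b : Fin 8 → ℤ) k →
        code (Pi.single i a + Pi.single j b) ∈ codes ∧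
        comb (digits (code (Pi.single i a + Pi.single j b))) =
          Pi.single i a + Pi.single j b := by
      decide +kernel
    exact ⟨_, h i j a ha b hb hij hpos⟩
  · have h : ∀ f : Fin 8 → Bool,
        Even (Finset.univ.filter fun i => (bif f i then 1 else -1 : ℤ) = -1).card →
        0 < ∑ i : Fin 8, 2 ^ i.val * (bif f i then 1 else -1 : ℤ) →
        code (fun i => bif f i then 1 else -1) ∈ codes ∧
        comb (digits (code fun i => bif f i then 1 else -1)) =
          fun i => bif f i then 1 else -1 := by
      decide +kernel
    have hf : v = fun i => bif decide (v i = 1) then 1 else -1 := by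
      ext i
      rcases h1 i with hi | hi <;> simp [hi]
    have := h fun i => decide (v i = 1)
    rw [← hf] at this
    simp only [← congrFun hf] at this
    exact ⟨_, this hodd hpos⟩

theorem simple_mem (k : Fin 8) : simple k ∈ E8pos := by
  have h : ∀ k, ∃ n ∈ codes, comb (digits n) = simple k := by decide +kernel
  obtain ⟨n, hn, h⟩ := h k
  exact h ▸ comb_digits_mem hn

theorem rootLe_comb_iff (c d : Fin 8 → ℕ) : rootLe E8pos (comb c) (comb d) ↔ c ≤ d := by
  constructor
  · rintro ⟨l, hl, h⟩
    have hsum : ∃ e, l.sum = comb e := by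
      clear h
      induction l using Multiset.induction_on with
      | empty => exact ⟨0, by simp [comb]⟩
      | cons x l ih =>
        obtain ⟨e, he⟩ := ih fun y hy => hl y (Multiset.mem_cons_of_mem hy)
        obtain ⟨n, -, hn⟩ := exists_code (hl x (Multiset.mem_cons_self x l))
        exact ⟨digits n + e, by rw [Multiset.sum_cons, comb_add, he, hn]⟩
    obtain ⟨e, he⟩ := hsum
    rw [he, ← comb_add] at h
    rw [comb_injective h]
    exact le_self_add
  · intro h
    refine ⟨∑ k, Multiset.replicate ((d - c) k) (simple k), fun x hx => ?_, ?_⟩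
    · obtain ⟨k, -, hk⟩ := Multiset.mem_sum.1 hx
      rw [Multiset.eq_of_mem_replicate hk]
      exact simple_mem k
    · have : (∑ k, Multiset.replicate ((d - c) k) (simple k)).sum = comb (d - c) := by
        rw [Multiset.sum_sum]
        simp [comb]
      rw [this, ← comb_add, add_tsub_cancel_of_le h]

theorem not_compB_eq_true_iff (a b : ℕ) : (!compB a b) = true ↔
    ¬ rootLe E8pos (comb (digits a)) (comb (digits b)) ∧
      ¬ rootLe E8pos (comb (digits b)) (comb (digits a)) := by
  simp only [rootLe_comb_iff, compB, Pi.le_def, Bool.not_or, Bool.and_eq_true,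
    Bool.not_eq_true', decide_eq_false_iff_not]

theorem injOn_comb_digits : Set.InjOn (fun n => comb (digits n)) {n | n ∈ codes} := by
  have h : ∀ m ∈ codes, ∑ k : Fin 8, 10 ^ k.val * digits m k = m := by decide +kernel
  intro m hm n hn hmn
  rw [← h m hm, ← h n hn, comb_injective hmn]

theorem antichains_eq_image :
    {A : Set (Fin 8 → ℤ) | A ⊆ E8pos ∧ IsAntichain (rootLe E8pos) A} =
      Set.image (fun n => comb (digits n)) '' cliques (fun a b => !compB a b) codes := by
  ext A
  constructor
  · rintro ⟨hA, hanti⟩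
    refine ⟨{n | n ∈ codes ∧ comb (digits n) ∈ A}, ⟨fun n hn => hn.1, ?_⟩, ?_⟩
    · intro m hm n hn hmn
      have hne := injOn_comb_digits.ne hm.1 hn.1 hmn
      exact (not_compB_eq_true_iff m n).2 ⟨hanti hm.2 hn.2 hne, hanti hn.2 hm.2 hne.symm⟩
    · ext v
      constructor
      · rintro ⟨n, hn, rfl⟩
        exact hn.2
      · intro hv
        obtain ⟨n, hn, rfl⟩ := exists_code (hA hv)
        exact ⟨n, ⟨hn, hv⟩, rfl⟩
  · rintro ⟨s, ⟨hs, hp⟩, rfl⟩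
    refine ⟨?_, ?_⟩
    · rintro _ ⟨n, hn, rfl⟩
      exact comb_digits_mem (hs hn)
    · rintro _ ⟨m, hm, rfl⟩ _ ⟨n, hn, rfl⟩ hmn
      exact ((not_compB_eq_true_iff m n).1 (hp hm hn fun h => hmn (h ▸ rfl))).1

end E8

/-- In the root system of type `E₈`, the number of antichains of the poset of
positive roots `(Δ⁺, ≤)`, where `α ≤ β` iff `β − α` is a sum of positive roots, is `25080`;
equivalently, the Borel subalgebra of the simple Lie algebra of type `E₈` has exactly `25080`
ad-nilpotent ideals. -/
theorem stmt11 :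
    {A : Set (Fin 8 → ℤ) | A ⊆ E8pos ∧ IsAntichain (rootLe E8pos) A}.ncard = 25080 := by
  have hinj : Set.InjOn (Set.image fun n => E8.comb (E8.digits n))
      (E8.cliques (fun a b => !E8.compB a b) E8.codes) := fun s hs t ht h =>
    (E8.injOn_comb_digits.image_eq_image_iff hs.1 ht.1).1 h
  have hsymm : ∀ a b, (!E8.compB a b) = !E8.compB b a := fun a b => by
    rw [E8.compB, E8.compB, Bool.or_comm]
  have hnodup : E8.codes.Nodup := by decide +kernel
  rw [E8.antichains_eq_image, hinj.ncard_image, ← E8.count_codes,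
    ← E8.ncard_cliques_select hsymm hnodup, E8.select_mask_true]
end

section
/- In the root system of type E₆ with highest root θ, the number of upper sets Φ of the poset of positive roots (Δ⁺, ≤) such that θ ∉ Φ² (where Φ² = {α + β : α, β ∈ Φ} ∩ Δ⁺) is 64 = 2⁶; equivalently, the Borel subalgebra of the simple Lie algebra of type E₆ has exactly 64 abelian ideals. -/
namespace E6

/-! ### Enumerating order-closed bitmasks -/

/-- The bitmasks `m < 2 ^ n` that contain `u i` and avoid `o i` for each of their bits `i`. -/
def goodMasks (u o : ℕ → ℕ) : ℕ → List ℕ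
  | 0 => [0]
  | n + 1 => goodMasks u o n ++
      ((goodMasks u o n).filter fun m => m &&& u n = u n ∧ m &&& o n = 0).map (· ||| 2 ^ n)

/-- The set of bits of `m` is closed under `u` and no two of its bits are related by `o`. -/
def IsGood (u o : ℕ → ℕ) (m : ℕ) : Prop :=
  ∀ i, m.testBit i → ∀ j,
    ((u i).testBit j → m.testBit j) ∧ ((o i).testBit j → ¬ m.testBit j)

theorem lt_of_testBit {a n i : ℕ} (ha : a < 2 ^ n) (hi : a.testBit i) : i < n := by
  by_contra! hni
  simp [Nat.testBit_lt_two_pow (ha.trans_le (Nat.pow_le_pow_right two_pos hni))] at hi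

theorem lt_two_pow_of_testBit_eq_false {m n : ℕ} (hm : m < 2 ^ (n + 1))
    (h : m.testBit n = false) : m < 2 ^ n := by
  refine Nat.lt_pow_two_of_testBit m fun i hi => ?_
  rcases hi.eq_or_lt with rfl | hi
  · exact h
  · exact Nat.testBit_lt_two_pow (hm.trans_le (Nat.pow_le_pow_right two_pos hi))

theorem and_eq_right_iff_testBit {m a : ℕ} :
    m &&& a = a ↔ ∀ j, a.testBit j → m.testBit j := by
  constructor
  · intro h j hj
    rw [← h, Nat.testBit_and] at hj
    simp_all
  · intro h
    refine Nat.eq_of_testBit_eq fun j => ?_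
    rw [Nat.testBit_and]
    cases hj : a.testBit j with
    | false => simp
    | true => simpa using h j hj

theorem and_eq_zero_iff_testBit {m a : ℕ} :
    m &&& a = 0 ↔ ∀ j, a.testBit j → ¬ m.testBit j := by
  constructor
  · intro h j hj hm
    have h' : (m &&& a).testBit j = false := by rw [h, Nat.zero_testBit]
    simp [hj, hm] at h'
  · intro h
    refine Nat.eq_of_testBit_eq fun j => ?_
    rw [Nat.testBit_and, Nat.zero_testBit]
    cases hj : a.testBit j with
    | false => simp
    | true => simpa using h j hj

theorem testBit_or_two_pow {m n i : ℕ} :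
    (m ||| 2 ^ n).testBit i ↔ m.testBit i ∨ i = n := by
  rw [Nat.testBit_or, Nat.testBit_two_pow, Bool.or_eq_true, decide_eq_true_eq, eq_comm (a := n)]

variable {u o : ℕ → ℕ}

theorem isGood_or_two_pow (hu : ∀ i, u i < 2 ^ i)
    (hs : ∀ i j, (o i).testBit j → (o j).testBit i) (ho : ∀ i, ¬ (o i).testBit i)
    {m n : ℕ} (hm : m < 2 ^ n) :
    IsGood u o (m ||| 2 ^ n) ↔ IsGood u o m ∧ m &&& u n = u n ∧ m &&& o n = 0 := by
  rw [and_eq_right_iff_testBit, and_eq_zero_iff_testBit]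
  simp only [IsGood, testBit_or_two_pow]
  constructor
  · intro h
    refine ⟨fun i hi j => ⟨fun hj => ?_, fun hj hmj => (h i (.inl hi) j).2 hj (.inl hmj)⟩,
      fun j hj => ?_, fun j hj hmj => (h n (.inr rfl) j).2 hj (.inl hmj)⟩
    · exact ((h i (.inl hi) j).1 hj).resolve_right
        ((lt_of_testBit (hu i) hj).trans (lt_of_testBit hm hi)).ne
    · exact ((h n (.inr rfl) j).1 hj).resolve_right (lt_of_testBit (hu n) hj).ne
  · rintro ⟨h, h₁, h₂⟩ i (hi | rfl) j
    · refine ⟨fun hj => .inl ((h i hi j).1 hj), fun hj => ?_⟩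
      rintro (hmj | rfl)
      · exact (h i hi j).2 hj hmj
      · exact h₂ i (hs _ _ hj) hi
    · refine ⟨fun hj => .inl (h₁ j hj), fun hj => ?_⟩
      rintro (hmj | rfl)
      · exact h₂ j hj hmj
      · exact ho _ hj

theorem mem_goodMasks (hu : ∀ i, u i < 2 ^ i)
    (hs : ∀ i j, (o i).testBit j → (o j).testBit i) (ho : ∀ i, ¬ (o i).testBit i)
    {n m : ℕ} : m ∈ goodMasks u o n ↔ m < 2 ^ n ∧ IsGood u o m := by
  induction n generalizing m with
  | zero =>
    simp only [goodMasks, List.mem_singleton, pow_zero, Nat.lt_one_iff]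
    refine ⟨?_, And.left⟩
    rintro rfl
    exact ⟨rfl, fun i hi => by simp at hi⟩
  | succ n ih =>
    simp only [goodMasks, List.mem_append, List.mem_map, List.mem_filter, decide_eq_true_eq, ih]
    constructor
    · rintro (⟨h, hg⟩ | ⟨m, ⟨⟨h, hg⟩, hc⟩, rfl⟩)
      · exact ⟨h.trans (Nat.pow_lt_pow_right one_lt_two n.lt_succ_self), hg⟩
      · have hn := Nat.pow_lt_pow_right one_lt_two n.lt_succ_self
        exact ⟨Nat.or_lt_two_pow (h.trans hn) hn, (isGood_or_two_pow hu hs ho h).2 ⟨hg, hc⟩⟩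
    · rintro ⟨hm, hg⟩
      cases hb : m.testBit n with
      | false => exact .inl ⟨lt_two_pow_of_testBit_eq_false hm hb, hg⟩
      | true =>
        have h : m % 2 ^ n < 2 ^ n := Nat.mod_lt _ (Nat.two_pow_pos n)
        have he : m % 2 ^ n ||| 2 ^ n = m := by
          refine Nat.eq_of_testBit_eq fun i => ?_
          rw [Bool.eq_iff_iff, testBit_or_two_pow, Nat.testBit_mod_two_pow]
          rcases lt_trichotomy i n with hi | rfl | hi
          · simp [hi, hi.ne]
          · simp [hb]
          · have := Nat.testBit_lt_two_pow (hm.trans_le (Nat.pow_le_pow_right two_pos hi))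
            simp [hi.not_gt, hi.ne', this]
        rw [← he, isGood_or_two_pow hu hs ho h] at hg
        exact .inr ⟨_, ⟨⟨h, hg.1⟩, hg.2⟩, he⟩

theorem nodup_goodMasks (hu : ∀ i, u i < 2 ^ i)
    (hs : ∀ i j, (o i).testBit j → (o j).testBit i) (ho : ∀ i, ¬ (o i).testBit i) (n : ℕ) :
    (goodMasks u o n).Nodup := by
  induction n with
  | zero => simp [goodMasks]
  | succ n ih =>
    have hn {m : ℕ} (hm : m ∈ goodMasks u o n) : m.testBit n = false :=
      Nat.testBit_lt_two_pow ((mem_goodMasks hu hs ho).1 hm).1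
    rw [goodMasks, List.nodup_append']
    refine ⟨ih, (ih.filter _).map_on fun a ha b hb hab => ?_, fun a ha ha' => ?_⟩
    · refine Nat.eq_of_testBit_eq fun i => ?_
      by_cases hi : i = n
      · rw [hi, hn (List.mem_of_mem_filter ha), hn (List.mem_of_mem_filter hb)]
      · have := congrArg (Nat.testBit · i) hab
        simpa [Nat.testBit_two_pow, Ne.symm hi] using this
    · obtain ⟨b, -, rfl⟩ := List.mem_map.1 ha'
      have := hn ha
      simp at this

/-! ### The positive roots of `E₆` -/

/-- The positive roots in decreasing lexicographic order, which linearly extends the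
reverse of the root order. -/
def posList : List (Fin 8 → ℤ) :=
  [![-1, 1, 1, 1, 1, 1, -1, 1], ![1, -1, 1, 1, 1, 1, -1, 1],
   ![1, 1, -1, 1, 1, 1, -1, 1], ![-1, -1, -1, 1, 1, 1, -1, 1],
   ![1, 1, 1, -1, 1, 1, -1, 1], ![-1, -1, 1, -1, 1, 1, -1, 1],
   ![-1, 1, -1, -1, 1, 1, -1, 1], ![1, -1, -1, -1, 1, 1, -1, 1],
   ![1, 1, 1, 1, -1, 1, -1, 1], ![-1, -1, 1, 1, -1, 1, -1, 1],
   ![-1, 1, -1, 1, -1, 1, -1, 1], ![1, -1, -1, 1, -1, 1, -1, 1],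
   ![-1, 1, 1, -1, -1, 1, -1, 1], ![1, -1, 1, -1, -1, 1, -1, 1],
   ![1, 1, -1, -1, -1, 1, -1, 1], ![-1, -1, -1, -1, -1, 1, -1, 1],
   ![0, 0, 0, 2, 2, 0, 0, 0], ![0, 0, 2, 0, 2, 0, 0, 0],
   ![0, 2, 0, 0, 2, 0, 0, 0], ![2, 0, 0, 0, 2, 0, 0, 0],
   ![-2, 0, 0, 0, 2, 0, 0, 0], ![0, -2, 0, 0, 2, 0, 0, 0],
   ![0, 0, -2, 0, 2, 0, 0, 0], ![0, 0, 0, -2, 2, 0, 0, 0],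
   ![0, 0, 2, 2, 0, 0, 0, 0], ![0, 2, 0, 2, 0, 0, 0, 0],
   ![2, 0, 0, 2, 0, 0, 0, 0], ![-2, 0, 0, 2, 0, 0, 0, 0],
   ![0, -2, 0, 2, 0, 0, 0, 0], ![0, 0, -2, 2, 0, 0, 0, 0],
   ![0, 2, 2, 0, 0, 0, 0, 0], ![2, 0, 2, 0, 0, 0, 0, 0],
   ![-2, 0, 2, 0, 0, 0, 0, 0], ![0, -2, 2, 0, 0, 0, 0, 0],
   ![2, 2, 0, 0, 0, 0, 0, 0], ![-2, 2, 0, 0, 0, 0, 0, 0]]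

/-- The `i`-th entry of `posList`. -/
def root (i : ℕ) : Fin 8 → ℤ := posList.getD i 0

/-- Bit `j` of `upperMask i` records whether `root i < root j`. -/
def upperMask (i : ℕ) : ℕ :=
  [0, 1, 3, 7, 7, 31, 63, 127,
   23, 319, 895, 2047, 1919, 8191, 16383, 32767,
   15, 65599, 196735, 459007, 458879, 2031871, 4129023, 8323327,
   197439, 17237887, 51318783, 51840895, 255791103, 528420863, 50796415, 1192181759,
   1259804543, 8040431615, 3339681791, 5554771839].getD i 0

/-- Bit `j` of `partnerMask i` records whether `root i + root j` is the highest root. -/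
def partnerMask (i : ℕ) : ℕ :=
  [0, 34359738368, 4294967296, 1073741824, 134217728, 33554432, 16777216, 0,
   1048576, 262144, 131072, 0, 65536, 0, 0, 0,
   4096, 1024, 512, 0, 256, 0, 0, 0,
   64, 32, 0, 16, 0, 0, 8, 0,
   4, 0, 0, 2].getD i 0

/-- The simple roots. -/
def simpleRoot : Fin 6 → Fin 8 → ℤ :=
  ![![-1, -1, -1, -1, -1, 1, -1, 1],
    ![0, 0, 0, -2, 2, 0, 0, 0],
    ![0, 0, -2, 2, 0, 0, 0, 0],
    ![0, -2, 2, 0, 0, 0, 0, 0],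
    ![-2, 2, 0, 0, 0, 0, 0, 0],
    ![2, 2, 0, 0, 0, 0, 0, 0]]

/-- Four times the coordinates with respect to `simpleRoot`. -/
def coord : Matrix (Fin 6) (Fin 8) ℤ :=
  !![0, 0, 0, 0, 0, 4, 0, 0;
     0, 0, 0, 0, 2, 2, 0, 0;
     0, 0, 0, 2, 2, 4, 0, 0;
     0, 0, 2, 2, 2, 6, 0, 0;
     -1, 1, 1, 1, 1, 3, 0, 0;
     1, 1, 1, 1, 1, 5, 0, 0]

instance (v : Fin 8 → ℤ) : Decidable (v ∈ E6pos) :=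
  inferInstanceAs (Decidable ((((∑ i, v i ^ 2 = 8) ∧
    ((∀ i, Even (v i)) ∨
      ((∀ i, v i = 1 ∨ v i = -1) ∧
        Even (Finset.univ.filter (fun i => v i = -1)).card))) ∧ v 6 + v 7 = 0 ∧ v 5 + v 6 = 0) ∧
    0 < ∑ i : Fin 8, 2 ^ i.val * v i))

theorem root_mem : ∀ i < 36, root i ∈ E6pos := by
  decide +kernel

theorem simpleRoot_mem : ∀ k, simpleRoot k ∈ E6pos := by
  decide +kernel

theorem even_mem_posList : ∀ a ∈ [-2, 0, 2], ∀ b ∈ [-2, 0, 2], ∀ c ∈ [-2, 0, 2],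
    ∀ d ∈ [-2, 0, 2], ∀ e ∈ [-2, 0, 2], ∀ f ∈ [-2, 0, 2],
    ![a, b, c, d, e, f, -f, f] ∈ E6pos → ![a, b, c, d, e, f, -f, f] ∈ posList := by
  decide +kernel

theorem odd_mem_posList : ∀ a ∈ [1, -1], ∀ b ∈ [1, -1], ∀ c ∈ [1, -1],
    ∀ d ∈ [1, -1], ∀ e ∈ [1, -1], ∀ f ∈ [1, -1],
    ![a, b, c, d, e, f, -f, f] ∈ E6pos → ![a, b, c, d, e, f, -f, f] ∈ posList := by
  decide +kernel

theorem mem_posList {v : Fin 8 → ℤ} (hv : v ∈ E6pos) : v ∈ posList := by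
  have hv' := hv
  obtain ⟨⟨⟨hsq, hpar⟩, h67, h56⟩, -⟩ := hv'
  have hvec : v = ![v 0, v 1, v 2, v 3, v 4, v 5, -v 5, v 5] := by
    ext i
    fin_cases i <;> simp <;> omega
  rw [hvec] at hv ⊢
  rcases hpar with hev | ⟨hodd, -⟩
  · have hmem (i : Fin 8) : v i ∈ [-2, 0, 2] := by
      have hle : v i ^ 2 ≤ 8 :=
        hsq ▸ Finset.single_le_sum (f := fun i => v i ^ 2) (fun j _ => sq_nonneg _)
          (Finset.mem_univ i)
      have h₁ : v i ≤ 2 := by nlinarith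
      have h₂ : -2 ≤ v i := by nlinarith
      obtain ⟨k, hk⟩ := hev i
      simp only [List.mem_cons, List.not_mem_nil, or_false]
      omega
    exact even_mem_posList _ (hmem 0) _ (hmem 1) _ (hmem 2) _ (hmem 3) _ (hmem 4) _ (hmem 5) hv
  · have hmem (i : Fin 8) : v i ∈ [1, -1] := by simpa using hodd i
    exact odd_mem_posList _ (hmem 0) _ (hmem 1) _ (hmem 2) _ (hmem 3) _ (hmem 4) _ (hmem 5) hv

theorem mem_E6pos_iff {v : Fin 8 → ℤ} : v ∈ E6pos ↔ ∃ i < 36, root i = v := by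
  constructor
  · intro hv
    obtain ⟨i, hi, rfl⟩ := List.getElem_of_mem (mem_posList hv)
    exact ⟨i, hi, List.getD_eq_getElem _ _ hi⟩
  · rintro ⟨i, hi, rfl⟩
    exact root_mem i hi

theorem root_injective : ∀ i < 36, ∀ j < 36, root i = root j → i = j := by
  decide +kernel

theorem coord_root_nonneg : ∀ i < 36, ∀ k, 0 ≤ (coord.mulVec (root i)) k := by
  decide +kernel

theorem root_eq_add_sum : ∀ i < 36, ∀ j < 36, (i = j ∨ (upperMask i).testBit j) →
    root j = root i +
      ∑ k, ((coord.mulVec (root j - root i) k).toNat / 4) • simpleRoot k := by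
  decide +kernel

theorem testBit_upperMask_of_coord_le : ∀ i < 36, ∀ j < 36,
    (∀ k, coord.mulVec (root i) k ≤ coord.mulVec (root j) k) →
      i = j ∨ (upperMask i).testBit j := by
  decide +kernel

theorem root_add_root_eq_iff : ∀ i < 36, ∀ j < 36,
    (root 0 = root i + root j ↔ (partnerMask i).testBit j) := by
  decide +kernel

theorem coord_le_of_rootLe {a b : Fin 8 → ℤ} (h : rootLe E6pos a b) (k : Fin 6) :
    coord.mulVec a k ≤ coord.mulVec b k := by
  obtain ⟨l, hl, rfl⟩ := h
  rw [Matrix.mulVec_add, Pi.add_apply, le_add_iff_nonneg_right]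
  induction l using Multiset.induction with
  | empty => simp
  | cons x l ih =>
    obtain ⟨i, hi, rfl⟩ := mem_E6pos_iff.1 (hl x (Multiset.mem_cons_self x l))
    rw [Multiset.sum_cons, Matrix.mulVec_add, Pi.add_apply]
    exact add_nonneg (coord_root_nonneg i hi k)
      (ih fun y hy => hl y (Multiset.mem_cons_of_mem hy))

theorem rootLe_root_iff {i j : ℕ} (hi : i < 36) (hj : j < 36) :
    rootLe E6pos (root i) (root j) ↔ i = j ∨ (upperMask i).testBit j := by
  refine ⟨fun h => testBit_upperMask_of_coord_le i hi j hj (coord_le_of_rootLe h), fun h => ?_⟩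
  refine ⟨∑ k, Multiset.replicate ((coord.mulVec (root j - root i) k).toNat / 4) (simpleRoot k),
    fun x hx => ?_, ?_⟩
  · obtain ⟨k, -, hk⟩ := Multiset.mem_sum.1 hx
    rw [Multiset.eq_of_mem_replicate hk]
    exact simpleRoot_mem k
  · rw [Multiset.sum_sum]
    simpa only [Multiset.sum_replicate] using root_eq_add_sum i hi j hj h

theorem upperMask_lt (i : ℕ) : upperMask i < 2 ^ i := by
  by_cases hi : i < 36
  · revert i
    decide +kernel
  · rw [upperMask, List.getD_eq_default _ _ (by simpa using hi)]
    exact Nat.two_pow_pos i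

theorem partnerMask_lt (i : ℕ) : partnerMask i < 2 ^ 36 := by
  by_cases hi : i < 36
  · revert i
    decide +kernel
  · rw [partnerMask, List.getD_eq_default _ _ (by simpa using hi)]
    exact Nat.two_pow_pos 36

theorem lt_of_testBit_partnerMask {i j : ℕ} (h : (partnerMask i).testBit j) : i < 36 := by
  by_contra! hi
  rw [partnerMask, List.getD_eq_default _ _ (by simpa using hi)] at h
  simp at h

theorem partnerMask_symm (i j : ℕ) (h : (partnerMask i).testBit j) :
    (partnerMask j).testBit i := by
  have hi := lt_of_testBit_partnerMask h
  have hj := lt_of_testBit (partnerMask_lt i) h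
  rw [← root_add_root_eq_iff i hi j hj, add_comm] at h
  exact (root_add_root_eq_iff j hj i hi).1 h

theorem partnerMask_irrefl (i : ℕ) : ¬ (partnerMask i).testBit i := by
  have key : ∀ i < 36, ¬ (partnerMask i).testBit i := by decide +kernel
  exact fun h => key i (lt_of_testBit_partnerMask h) h

theorem eq_root_zero {θ : Fin 8 → ℤ}
    (hθ : θ ∈ E6pos ∧ ∀ α ∈ E6pos, rootLe E6pos α θ) : θ = root 0 := by
  obtain ⟨i, hi, rfl⟩ := mem_E6pos_iff.1 hθ.1
  have h := (rootLe_root_iff (by norm_num) hi).1 (hθ.2 (root 0) (root_mem 0 (by norm_num)))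
  rcases h with rfl | h
  · rfl
  · simp [upperMask] at h

/-- The set of positive roots encoded by a bitmask. -/
def rootSet (m : ℕ) : Set (Fin 8 → ℤ) := {v | ∃ i < 36, m.testBit i ∧ root i = v}

theorem root_mem_rootSet {m i : ℕ} (hi : i < 36) : root i ∈ rootSet m ↔ m.testBit i := by
  constructor
  · rintro ⟨j, hj, hm, h⟩
    rwa [← root_injective j hj i hi h]
  · exact fun h => ⟨i, hi, h, rfl⟩

theorem rootSet_injOn : Set.InjOn rootSet {m | m < 2 ^ 36} := by
  intro a ha b hb hab
  refine Nat.eq_of_testBit_eq fun i => ?_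
  by_cases hi : i < 36
  · rw [Bool.eq_iff_iff, ← root_mem_rootSet hi, ← root_mem_rootSet hi, hab]
  · have hp : 2 ^ 36 ≤ 2 ^ i := Nat.pow_le_pow_right two_pos (not_lt.1 hi)
    rw [Nat.testBit_lt_two_pow (lt_of_lt_of_le ha hp),
      Nat.testBit_lt_two_pow (lt_of_lt_of_le hb hp)]

theorem exists_rootSet_eq {Φ : Set (Fin 8 → ℤ)} (hΦ : Φ ⊆ E6pos) :
    ∃ m < 2 ^ 36, rootSet m = Φ := by
  classical
  refine ⟨Nat.ofBits fun i : Fin 36 => decide (root i ∈ Φ), Nat.ofBits_lt_two_pow _, ?_⟩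
  ext v
  constructor
  · rintro ⟨i, hi, hm, rfl⟩
    rw [Nat.testBit_ofBits_lt _ _ hi] at hm
    exact of_decide_eq_true hm
  · intro hv
    obtain ⟨i, hi, rfl⟩ := mem_E6pos_iff.1 (hΦ hv)
    refine ⟨i, hi, ?_, rfl⟩
    rw [Nat.testBit_ofBits_lt _ _ hi]
    exact decide_eq_true hv

theorem rootSet_subset (m : ℕ) : rootSet m ⊆ E6pos := by
  rintro _ ⟨i, hi, -, rfl⟩
  exact root_mem i hi

theorem isGood_iff {m : ℕ} (hm : m < 2 ^ 36) : IsGood upperMask partnerMask m ↔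
    (∀ α ∈ rootSet m, ∀ β ∈ E6pos, rootLe E6pos α β → β ∈ rootSet m) ∧
      root 0 ∉ {γ | ∃ α ∈ rootSet m, ∃ β ∈ rootSet m, γ = α + β} ∩ E6pos := by
  constructor
  · refine fun h => ⟨?_, ?_⟩
    · rintro _ ⟨i, hi, him, rfl⟩ β hβ hle
      obtain ⟨j, hj, rfl⟩ := mem_E6pos_iff.1 hβ
      rw [root_mem_rootSet hj]
      rcases (rootLe_root_iff hi hj).1 hle with rfl | hij
      · exact him
      · exact (h i him j).1 hij
    · rintro ⟨⟨_, ⟨i, hi, him, rfl⟩, _, ⟨j, hj, hjm, rfl⟩, hsum⟩, -⟩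
      exact (h i him j).2 ((root_add_root_eq_iff i hi j hj).1 hsum) hjm
  · rintro ⟨hup, hab⟩ i him j
    have hi := lt_of_testBit hm him
    refine ⟨fun hj => ?_, fun hj hjm => ?_⟩
    · have hj' : j < 36 := (lt_of_testBit (upperMask_lt i) hj).trans hi
      rw [← root_mem_rootSet hj']
      exact hup _ ((root_mem_rootSet hi).2 him) _ (root_mem j hj')
        ((rootLe_root_iff hi hj').2 (.inr hj))
    · have hj' := lt_of_testBit hm hjm
      exact hab ⟨⟨_, (root_mem_rootSet hi).2 him, _, (root_mem_rootSet hj').2 hjm,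
        (root_add_root_eq_iff i hi j hj').2 hj⟩, root_mem 0 (by norm_num)⟩

theorem length_goodMasks : (goodMasks upperMask partnerMask 36).length = 64 := by
  decide +kernel

end E6

/-- In the root system of type `E₆` with highest root `θ`, the number of
upper sets `Φ` of the poset of positive roots `(Δ⁺, ≤)` such that `θ ∉ Φ²` (where
`Φ² = {α + β : α, β ∈ Φ} ∩ Δ⁺`) is `64 = 2⁶`; equivalently, the Borel subalgebra of the
simple Lie algebra of type `E₆` has exactly `64` abelian ideals. -/
theorem stmt14 (θ : Fin 8 → ℤ)
    (hθ : θ ∈ E6pos ∧ ∀ α ∈ E6pos, rootLe E6pos α θ) :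
    {Φ : Set (Fin 8 → ℤ) | Φ ⊆ E6pos ∧
      (∀ α ∈ Φ, ∀ β ∈ E6pos, rootLe E6pos α β → β ∈ Φ) ∧
      θ ∉ {γ | ∃ α ∈ Φ, ∃ β ∈ Φ, γ = α + β} ∩ E6pos}.ncard = 64 := by
  obtain rfl := E6.eq_root_zero hθ
  have hmem {m : ℕ} := E6.mem_goodMasks E6.upperMask_lt E6.partnerMask_symm
    E6.partnerMask_irrefl (n := 36) (m := m)
  calc
    _ = (E6.rootSet ''
          ((E6.goodMasks E6.upperMask E6.partnerMask 36).toFinset : Set ℕ)).ncard := by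
      congr 1
      ext Φ
      simp only [Set.mem_image, Finset.mem_coe, List.mem_toFinset, hmem]
      constructor
      · rintro ⟨hsub, h⟩
        obtain ⟨m, hm, rfl⟩ := E6.exists_rootSet_eq hsub
        exact ⟨m, ⟨hm, (E6.isGood_iff hm).2 h⟩, rfl⟩
      · rintro ⟨m, ⟨hm, h⟩, rfl⟩
        exact ⟨E6.rootSet_subset m, (E6.isGood_iff hm).1 h⟩
    _ = 64 := by
      rw [Set.InjOn.ncard_image (E6.rootSet_injOn.mono fun m hm => ?_), Set.ncard_coe_finset,
        List.toFinset_card_of_nodup (E6.nodup_goodMasks E6.upperMask_lt E6.partnerMask_symm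
          E6.partnerMask_irrefl 36), E6.length_goodMasks]
      exact (hmem.1 (List.mem_toFinset.1 hm)).1
end

section
/- In the root system of type E₇ with highest root θ, the number of upper sets Φ of the poset of positive roots (Δ⁺, ≤) such that θ ∉ Φ² (where Φ² = {α + β : α, β ∈ Φ} ∩ Δ⁺) is 128 = 2⁷; equivalently, the Borel subalgebra of the simple Lie algebra of type E₇ has exactly 128 abelian ideals. -/
/-- The vector with given coefficients with respect to the simple roots of `E7pos`. -/
def E7ofCoeffs (c : Fin 7 → ℕ) : Fin 8 → ℤ :=
  ![-2 * c 0 + 2 * c 5 + c 6, 2 * c 0 - 2 * c 1 + 2 * c 5 - c 6, 2 * c 1 - 2 * c 2 - c 6,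
    2 * c 2 - 2 * c 3 - c 6, 2 * c 3 - 2 * c 4 - c 6, 2 * c 4 - c 6, -c 6, c 6]

theorem E7ofCoeffs_add (c d : Fin 7 → ℕ) :
    E7ofCoeffs (c + d) = E7ofCoeffs c + E7ofCoeffs d := by
  ext j
  fin_cases j <;> simp [E7ofCoeffs] <;> ring

theorem E7ofCoeffs_zero : E7ofCoeffs 0 = 0 := by
  ext j
  fin_cases j <;> simp [E7ofCoeffs]

theorem E7ofCoeffs_injective : Function.Injective E7ofCoeffs := by
  intro c d h
  have h' := fun j => congrFun h j
  simp [E7ofCoeffs, Fin.forall_fin_succ] at h'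
  ext k
  fin_cases k <;> simp <;> omega

/-- The simple-root coefficients of the positive roots, in order of decreasing height; the
coefficient of the `k`-th simple root is the digit of weight `10 ^ k`. -/
def E7codes : List ℕ :=
  [2212343, 1212343, 1212342, 1212332, 1212232, 1112332, 1211232, 1112232,
    1112222, 1201232, 1111232, 1112221, 1111222, 1101232, 1111221, 112221,
    1111122, 1101222, 1111121, 1101221, 111221, 1101122, 1111111, 1101121,
    111121, 101221, 1100122, 1101111, 1011111, 111111, 1100121, 101121,
    111110, 1100111, 1001111, 101111, 11111, 100121, 101110, 11110,
    1100011, 1000111, 100111, 1111, 11100, 100110, 1110, 1000011,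
    100011, 111, 11000, 1100, 100010, 110, 1000001, 11,
    1000000, 100000, 10000, 1000, 100, 10, 1]

/-- The simple-root coefficients of the `i`-th positive root. -/
def E7coeffs (i : ℕ) (k : Fin 7) : ℕ := E7codes.getD i 0 / 10 ^ k.val % 10

/-- The `i`-th positive root. -/
def E7root (i : ℕ) : Fin 8 → ℤ := E7ofCoeffs (E7coeffs i)

theorem E7root_mem (i : Fin 63) : E7root i ∈ E7pos := by
  revert i
  simp only [E7pos, E7roots, E8roots, Set.mem_ofPred_eq]
  decide +kernel

theorem exists_E7root_of_even :
    ∀ a ∈ [-2, 0, 2], ∀ b ∈ [-2, 0, 2], ∀ c ∈ [-2, 0, 2], ∀ d ∈ [-2, 0, 2],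
    ∀ e ∈ [-2, 0, 2], ∀ f ∈ [-2, 0, 2], ∀ g ∈ ([-2, 0, 2] : List ℤ),
      a ^ 2 + b ^ 2 + c ^ 2 + d ^ 2 + e ^ 2 + f ^ 2 + 2 * g ^ 2 = 8 →
      0 < a + 2 * b + 4 * c + 8 * d + 16 * e + 32 * f + 64 * g →
      ∃ i : Fin 63, E7root i = ![a, b, c, d, e, f, -g, g] := by
  decide +kernel

theorem exists_E7root_of_odd :
    ∀ a ∈ [-1, 1], ∀ b ∈ [-1, 1], ∀ c ∈ [-1, 1], ∀ d ∈ [-1, 1],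
    ∀ e ∈ [-1, 1], ∀ f ∈ [-1, 1], ∀ g ∈ ([-1, 1] : List ℤ),
      Even (Finset.univ.filter fun j => (![a, b, c, d, e, f, -g, g] : Fin 8 → ℤ) j = -1).card →
      0 < a + 2 * b + 4 * c + 8 * d + 16 * e + 32 * f + 64 * g →
      ∃ i : Fin 63, E7root i = ![a, b, c, d, e, f, -g, g] := by
  decide +kernel

theorem exists_E7root {v : Fin 8 → ℤ} (hv : v ∈ E7pos) : ∃ i : Fin 63, E7root i = v := by
  obtain ⟨⟨⟨hsq, hpar⟩, h67⟩, hpos⟩ := hv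
  have hv : v = ![v 0, v 1, v 2, v 3, v 4, v 5, -v 7, v 7] := by
    ext j
    fin_cases j <;> simp
    omega
  have h6 : v 6 = -v 7 := by omega
  have hpos' : 0 < v 0 + 2 * v 1 + 4 * v 2 + 8 * v 3 + 16 * v 4 + 32 * v 5 + 64 * v 7 := by
    simp [Fin.sum_univ_eight, h6] at hpos
    omega
  rw [hv]
  rcases hpar with heven | ⟨hodd, hcard⟩
  · have hmem (j : Fin 8) : v j ∈ [-2, 0, 2] := by
      have hj : v j ^ 2 ≤ 8 :=
        hsq ▸ Finset.single_le_sum (fun i _ => sq_nonneg (v i)) (Finset.mem_univ j)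
      have hlo : -3 < v j := by nlinarith
      have hhi : v j < 3 := by nlinarith
      obtain ⟨m, hm⟩ := heven j
      simp only [List.mem_cons, List.not_mem_nil, or_false]
      omega
    refine exists_E7root_of_even _ (hmem 0) _ (hmem 1) _ (hmem 2) _ (hmem 3) _ (hmem 4) _
      (hmem 5) _ (hmem 7) ?_ hpos'
    simp only [Fin.sum_univ_eight, h6] at hsq
    linarith
  · have hmem (j : Fin 8) : v j ∈ [-1, 1] := by
      simpa [or_comm] using hodd j
    rw [hv] at hcard
    exact exists_E7root_of_odd _ (hmem 0) _ (hmem 1) _ (hmem 2) _ (hmem 3) _ (hmem 4) _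
      (hmem 5) _ (hmem 7) hcard hpos'

theorem E7root_injective : Function.Injective fun i : Fin 63 => E7root i := by
  have h : ∀ i j : Fin 63, E7codes.getD i 0 = E7codes.getD j 0 → i = j := by decide +kernel
  have hdigits : ∀ i : Fin 63, E7codes.getD i 0 = ∑ k, E7coeffs i k * 10 ^ k.val := by
    decide +kernel
  intro i j hij
  apply h
  rw [hdigits, hdigits, E7ofCoeffs_injective hij]

theorem rootLe_iff_closure {pos : Set (Fin 8 → ℤ)} {a b : Fin 8 → ℤ} :
    rootLe pos a b ↔ ∃ x ∈ AddSubmonoid.closure pos, b = a + x := by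
  constructor
  · rintro ⟨l, hl, h⟩
    exact ⟨_, AddSubmonoid.multiset_sum_mem _ _ fun x hx =>
      AddSubmonoid.subset_closure (hl x hx), h⟩
  · rintro ⟨x, hx, h⟩
    obtain ⟨l, hl, rfl⟩ := AddSubmonoid.exists_multiset_of_mem_closure hx
    exact ⟨l, hl, h⟩

theorem mem_closure_E7pos_iff_s15 {x : Fin 8 → ℤ} :
    x ∈ AddSubmonoid.closure E7pos ↔ ∃ c, E7ofCoeffs c = x := by
  let f : (Fin 7 → ℕ) →+ (Fin 8 → ℤ) :=
    { toFun := E7ofCoeffs, map_zero' := E7ofCoeffs_zero, map_add' := E7ofCoeffs_add }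
  constructor
  · intro hx
    have hle : AddSubmonoid.closure E7pos ≤ AddMonoidHom.mrange f := by
      rw [AddSubmonoid.closure_le]
      intro v hv
      obtain ⟨i, rfl⟩ := exists_E7root hv
      exact ⟨_, rfl⟩
    exact hle hx
  · rintro ⟨c, rfl⟩
    have hsimple : ∀ k : Fin 7, ∃ i : Fin 63, Pi.single k 1 = E7coeffs i := by decide +kernel
    have hc : c = ∑ k, c k • Pi.single k 1 := by
      ext j
      simp [Finset.sum_apply, Pi.single_apply]
    change f c ∈ _
    rw [hc, map_sum]
    refine sum_mem fun k _ => ?_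
    rw [map_nsmul]
    refine nsmul_mem (AddSubmonoid.subset_closure ?_) _
    obtain ⟨i, hi⟩ := hsimple k
    rw [hi]
    exact E7root_mem i

theorem rootLe_E7ofCoeffs_iff {c d : Fin 7 → ℕ} :
    rootLe E7pos (E7ofCoeffs c) (E7ofCoeffs d) ↔ ∀ k, c k ≤ d k := by
  rw [rootLe_iff_closure]
  constructor
  · rintro ⟨x, hx, h⟩
    obtain ⟨e, rfl⟩ := mem_closure_E7pos_iff_s15.1 hx
    rw [← E7ofCoeffs_add] at h
    rw [E7ofCoeffs_injective h]
    simp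
  · intro h
    obtain ⟨e, rfl⟩ := exists_add_of_le (show c ≤ d from h)
    exact ⟨_, mem_closure_E7pos_iff_s15.2 ⟨e, rfl⟩, E7ofCoeffs_add c e⟩

/-- The bit masks of the subsets of `{0, …, n - 1}` built by successively adjoining elements,
where `i` may be adjoined to the set with mask `m ⊆ {0, …, i - 1}` only if `p i m`. -/
def admissibleMasks (p : ℕ → ℕ → Bool) : ℕ → List ℕ
  | 0 => [0]
  | n + 1 => admissibleMasks p n ++ ((admissibleMasks p n).filter (p n)).map (2 ^ n + ·)

theorem mem_admissibleMasks {p : ℕ → ℕ → Bool} {n m : ℕ} :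
    m ∈ admissibleMasks p n ↔ m < 2 ^ n ∧ ∀ i < n, m.testBit i → p i (m % 2 ^ i) := by
  induction n generalizing m with
  | zero => simp [admissibleMasks]
  | succ n ih =>
    have hmod {q i : ℕ} (hi : i ≤ n) : (2 ^ n + q) % 2 ^ i = q % 2 ^ i := by
      rw [Nat.add_mod, Nat.mod_eq_zero_of_dvd (pow_dvd_pow 2 hi)]
      simp
    simp only [admissibleMasks, List.mem_append, List.mem_map, List.mem_filter, ih,
      Nat.forall_lt_succ_right]
    constructor
    · rintro (⟨hlt, h⟩ | ⟨q, ⟨⟨hlt, h⟩, hp⟩, rfl⟩)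
      · exact ⟨by rw [pow_succ]; omega, h, by simp [Nat.testBit_lt_two_pow hlt]⟩
      · refine ⟨by rw [pow_succ]; omega, fun i hi hbit => ?_, fun _ => ?_⟩
        · rw [Nat.testBit_two_pow_add_gt hi] at hbit
          rw [hmod hi.le]
          exact h i hi hbit
        · rwa [hmod le_rfl, Nat.mod_eq_of_lt hlt]
    · rintro ⟨hlt, h, hn⟩
      by_cases hm : m < 2 ^ n
      · exact Or.inl ⟨hm, h⟩
      · obtain ⟨q, rfl⟩ := Nat.exists_eq_add_of_le (not_lt.1 hm)
        have hq : q < 2 ^ n := by rw [pow_succ] at hlt; omega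
        rw [hmod le_rfl, Nat.mod_eq_of_lt hq, Nat.testBit_two_pow_add_eq,
          Nat.testBit_lt_two_pow hq] at hn
        refine Or.inr ⟨q, ⟨⟨hq, fun i hi hbit => ?_⟩, hn rfl⟩, rfl⟩
        rw [← hmod hi.le]
        exact h i hi (by rwa [Nat.testBit_two_pow_add_gt hi])

theorem nodup_admissibleMasks (p : ℕ → ℕ → Bool) (n : ℕ) : (admissibleMasks p n).Nodup := by
  induction n with
  | zero => simp [admissibleMasks]
  | succ n ih =>
    refine ih.append ((ih.filter _).map (add_right_injective _)) fun m hm hm' => ?_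
    obtain ⟨q, -, rfl⟩ := List.mem_map.1 hm'
    exact absurd (mem_admissibleMasks.1 hm).1 (by omega)

/-- The mask of the set of `j < i` such that `r j`. -/
def maskBelow (r : ℕ → Bool) (i : ℕ) : ℕ := Nat.ofBits fun j : Fin i => r j

theorem testBit_maskBelow {r : ℕ → Bool} {i j : ℕ} :
    (maskBelow r i).testBit j ↔ j < i ∧ r j := by
  rw [maskBelow]
  by_cases h : j < i
  · simp [Nat.testBit_ofBits_lt _ _ h, h]
  · simp [Nat.testBit_ofBits_ge _ _ (not_lt.1 h), h]

/-- Whether the `i`-th positive root may be adjoined to an abelian ideal consisting of roots of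
smaller index: all larger roots must be present, and no root present may sum with it to the
highest root. -/
def E7adjoinable (i m : ℕ) : Bool :=
  m &&& maskBelow (fun j => decide (∀ k, E7coeffs i k ≤ E7coeffs j k)) i =
      maskBelow (fun j => decide (∀ k, E7coeffs i k ≤ E7coeffs j k)) i ∧
    m &&& maskBelow (fun j => decide (∀ k, E7coeffs i k + E7coeffs j k = E7coeffs 0 k)) i = 0

theorem land_eq_right_iff {a b : ℕ} :
    a &&& b = b ↔ ∀ j, b.testBit j → a.testBit j := by
  constructor
  · intro h j hj
    rw [← h, Nat.testBit_land, Bool.and_eq_true] at hj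
    exact hj.1
  · intro h
    refine Nat.eq_of_testBit_eq fun j => ?_
    rw [Nat.testBit_land]
    cases hb : b.testBit j
    · simp
    · simp [h j hb]

theorem land_eq_zero_iff {a b : ℕ} :
    a &&& b = 0 ↔ ∀ j, b.testBit j → ¬ a.testBit j := by
  constructor
  · intro h j hb ha
    have := congrArg (Nat.testBit · j) h
    simp [ha, hb] at this
  · intro h
    refine Nat.eq_of_testBit_eq fun j => ?_
    rw [Nat.testBit_land, Nat.zero_testBit]
    cases hb : b.testBit j
    · simp
    · simpa using h j hb

theorem E7adjoinable_mod_iff {i m : ℕ} :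
    E7adjoinable i (m % 2 ^ i) ↔ ∀ j < i,
      ((∀ k, E7coeffs i k ≤ E7coeffs j k) → m.testBit j) ∧
      ((∀ k, E7coeffs i k + E7coeffs j k = E7coeffs 0 k) → ¬ m.testBit j) := by
  simp only [E7adjoinable, decide_eq_true_eq, Bool.decide_and, Bool.and_eq_true,
    land_eq_right_iff, land_eq_zero_iff, testBit_maskBelow, Nat.testBit_mod_two_pow]
  constructor
  · rintro ⟨hup, hsum⟩ j hj
    exact ⟨fun h => (hup j ⟨hj, h⟩).2, fun h hm => hsum j ⟨hj, h⟩ ⟨hj, hm⟩⟩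
  · intro h
    exact ⟨fun j hj => ⟨hj.1, (h j hj.1).1 hj.2⟩, fun j hj hm => (h j hj.1).2 hj.2 hm.2⟩

theorem length_E7masks : (admissibleMasks E7adjoinable 63).length = 128 := by
  decide +kernel

theorem mem_E7masks {m : ℕ} :
    m ∈ admissibleMasks E7adjoinable 63 ↔ m < 2 ^ 63 ∧ ∀ i j : Fin 63, m.testBit i →
      ((∀ k, E7coeffs i k ≤ E7coeffs j k) → m.testBit j) ∧
      ((∀ k, E7coeffs i k + E7coeffs j k = E7coeffs 0 k) → ¬ m.testBit j) := by
  have hle : ∀ i j : Fin 63, (∀ k, E7coeffs i k ≤ E7coeffs j k) → j ≤ i := by decide +kernel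
  have hne : ∀ i : Fin 63, ¬ ∀ k, E7coeffs i k + E7coeffs i k = E7coeffs 0 k := by
    decide +kernel
  simp only [mem_admissibleMasks, E7adjoinable_mod_iff]
  refine and_congr_right fun _ => ⟨fun h i j hi => ⟨fun hij => ?_, fun hij hj => ?_⟩,
    fun h i hi63 hi j hj => h ⟨i, hi63⟩ ⟨j, hj.trans hi63⟩ hi⟩
  · rcases (hle i j hij).eq_or_lt with rfl | hlt
    · exact hi
    · exact (h i i.isLt hi j hlt).1 hij
  · rcases lt_trichotomy i j with hlt | rfl | hlt
    · exact (h j j.isLt hj i hlt).2 (fun k => by rw [add_comm]; exact hij k) hi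
    · exact hne i hij
    · exact (h i i.isLt hi j hlt).2 hij hj

theorem E7root_zero_of_highest {θ : Fin 8 → ℤ}
    (hθ : θ ∈ E7pos ∧ ∀ α ∈ E7pos, rootLe E7pos α θ) : θ = E7root 0 := by
  have hmax : ∀ i : Fin 63, (∀ k, E7coeffs 0 k ≤ E7coeffs i k) → i = 0 := by decide +kernel
  obtain ⟨i, rfl⟩ := exists_E7root hθ.1
  rw [hmax i (rootLe_E7ofCoeffs_iff.1 (hθ.2 _ (E7root_mem 0)))]
  rfl

theorem E7root_zero_eq_add_iff {i j : ℕ} :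
    E7root 0 = E7root i + E7root j ↔ ∀ k, E7coeffs i k + E7coeffs j k = E7coeffs 0 k := by
  rw [E7root, E7root, E7root, ← E7ofCoeffs_add, E7ofCoeffs_injective.eq_iff, eq_comm,
    funext_iff]
  rfl

/-- The set of positive roots with indices in the set with bit mask `m`. -/
def E7rootsOfMask (m : ℕ) : Set (Fin 8 → ℤ) :=
  {v | ∃ i : Fin 63, m.testBit i ∧ E7root i = v}

theorem E7root_mem_rootsOfMask {m : ℕ} {i : Fin 63} :
    E7root i ∈ E7rootsOfMask m ↔ m.testBit i :=
  ⟨fun ⟨_, hj, h⟩ => E7root_injective h ▸ hj, fun h => ⟨i, h, rfl⟩⟩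

theorem E7rootsOfMask_injOn : Set.InjOn E7rootsOfMask {m | m < 2 ^ 63} := by
  intro m hm m' hm' h
  refine Nat.eq_of_testBit_eq fun i => ?_
  by_cases hi : i < 63
  · have hiff := E7root_mem_rootsOfMask (m := m) (i := ⟨i, hi⟩)
    rw [h, E7root_mem_rootsOfMask] at hiff
    exact Bool.eq_iff_iff.2 hiff.symm
  · have hle : 2 ^ 63 ≤ 2 ^ i := Nat.pow_le_pow_right two_pos (not_lt.1 hi)
    rw [Nat.testBit_lt_two_pow (lt_of_lt_of_le hm hle),
      Nat.testBit_lt_two_pow (lt_of_lt_of_le hm' hle)]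

theorem exists_E7rootsOfMask_eq {Φ : Set (Fin 8 → ℤ)} (hΦ : Φ ⊆ E7pos) :
    ∃ m < 2 ^ 63, E7rootsOfMask m = Φ := by
  classical
  refine ⟨Nat.ofBits fun i : Fin 63 => decide (E7root i ∈ Φ), Nat.ofBits_lt_two_pow _, ?_⟩
  have hbit (i : Fin 63) :
      (Nat.ofBits fun i : Fin 63 => decide (E7root i ∈ Φ)).testBit i ↔ E7root i ∈ Φ := by
    simp [Nat.testBit_ofBits_lt _ _ i.isLt]
  ext v
  constructor
  · rintro ⟨i, hi, rfl⟩
    exact (hbit i).1 hi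
  · intro hv
    obtain ⟨i, rfl⟩ := exists_E7root (hΦ hv)
    exact ⟨i, (hbit i).2 hv, rfl⟩

theorem E7rootsOfMask_subset (m : ℕ) : E7rootsOfMask m ⊆ E7pos := by
  rintro _ ⟨i, -, rfl⟩
  exact E7root_mem i

theorem mem_E7masks_iff_abelian {m : ℕ} (hm : m < 2 ^ 63) :
    m ∈ admissibleMasks E7adjoinable 63 ↔
      (∀ α ∈ E7rootsOfMask m, ∀ β ∈ E7pos, rootLe E7pos α β → β ∈ E7rootsOfMask m) ∧
      E7root 0 ∉
        {γ | ∃ α ∈ E7rootsOfMask m, ∃ β ∈ E7rootsOfMask m, γ = α + β} ∩ E7pos := by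
  rw [mem_E7masks, and_iff_right hm]
  constructor
  · refine fun h => ⟨?_, ?_⟩
    · rintro _ ⟨i, hi, rfl⟩ β hβ hle
      obtain ⟨j, rfl⟩ := exists_E7root hβ
      exact E7root_mem_rootsOfMask.2 ((h i j hi).1 (rootLe_E7ofCoeffs_iff.1 hle))
    · rintro ⟨⟨_, ⟨i, hi, rfl⟩, _, ⟨j, hj, rfl⟩, hij⟩, -⟩
      exact (h i j hi).2 (E7root_zero_eq_add_iff.1 hij) hj
  · rintro ⟨hup, hsum⟩ i j hi
    refine ⟨fun hij => ?_, fun hij hj => hsum ⟨?_, E7root_mem 0⟩⟩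
    · exact E7root_mem_rootsOfMask.1
        (hup _ ⟨i, hi, rfl⟩ _ (E7root_mem j) (rootLe_E7ofCoeffs_iff.2 hij))
    · exact ⟨_, ⟨i, hi, rfl⟩, _, ⟨j, hj, rfl⟩, E7root_zero_eq_add_iff.2 hij⟩

/-- In the root system of type `E₇` with highest root `θ`, the number of
upper sets `Φ` of the poset of positive roots `(Δ⁺, ≤)` such that `θ ∉ Φ²` (where
`Φ² = {α + β : α, β ∈ Φ} ∩ Δ⁺`) is `128 = 2⁷`; equivalently, the Borel subalgebra of the
simple Lie algebra of type `E₇` has exactly `128` abelian ideals. -/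
theorem stmt15 (θ : Fin 8 → ℤ)
    (hθ : θ ∈ E7pos ∧ ∀ α ∈ E7pos, rootLe E7pos α θ) :
    {Φ : Set (Fin 8 → ℤ) | Φ ⊆ E7pos ∧
      (∀ α ∈ Φ, ∀ β ∈ E7pos, rootLe E7pos α β → β ∈ Φ) ∧
      θ ∉ {γ | ∃ α ∈ Φ, ∃ β ∈ Φ, γ = α + β} ∩ E7pos}.ncard = 128 := by
  rw [E7root_zero_of_highest hθ]
  have himage : {Φ : Set (Fin 8 → ℤ) | Φ ⊆ E7pos ∧
      (∀ α ∈ Φ, ∀ β ∈ E7pos, rootLe E7pos α β → β ∈ Φ) ∧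
      E7root 0 ∉ {γ | ∃ α ∈ Φ, ∃ β ∈ Φ, γ = α + β} ∩ E7pos} =
      E7rootsOfMask '' (admissibleMasks E7adjoinable 63).toFinset := by
    ext Φ
    simp only [Set.mem_image, List.coe_toFinset, Set.mem_ofPred_eq]
    constructor
    · rintro ⟨hΦ, h⟩
      obtain ⟨m, hm, rfl⟩ := exists_E7rootsOfMask_eq hΦ
      exact ⟨m, (mem_E7masks_iff_abelian hm).2 h, rfl⟩
    · rintro ⟨m, hm, rfl⟩
      exact ⟨E7rootsOfMask_subset m, (mem_E7masks_iff_abelian (mem_E7masks.1 hm).1).1 hm⟩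
  rw [himage, Set.InjOn.ncard_image, Set.ncard_coe_finset,
    List.toFinset_card_of_nodup (nodup_admissibleMasks _ _), length_E7masks]
  exact E7rootsOfMask_injOn.mono fun m hm => (mem_E7masks.1 (List.mem_toFinset.1 hm)).1
end
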